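/- Let D⊂ℝ^d be a bounded connected open domain with C³ boundary, γ∈(0,1), ν>0, and let A∈C²(ℝ,ℝ^d) with A(0)=0 satisfy condition (S): (Σ_{j=1}^d A_j'(u))·sgn(u) ≥ c|u| − C for all u∈ℝ, with c,C>0. Then for any s>0 there exists a function C_s:ℝ₊²→ℝ₊, increasing in both arguments, such that for every h∈C^{γ/2,γ} and every solution u∈X^γ of ∂_t u + div_x A(u) − νΔu = h, u|_{∂D}=0, u(0,·)=u₀, one has ‖u(s,·)‖_{C^{2+γ}(D)} ≤ C_s(|||h|||_γ, ‖u₀‖_{L^∞}). -/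

import Mathlib

open Set MeasureTheory Filter Topology

noncomputable section

/-- `d`-dimensional Euclidean space. -/
abbrev Euc (d : ℕ) : Type := EuclideanSpace ℝ (Fin d)

/-- The `j`-th vector of the standard basis. -/
def ebasis (d : ℕ) (j : Fin d) : Euc d := EuclideanSpace.single j 1

/-- Time derivative `∂ₜ u (t,x)`. -/
def dtt {d : ℕ} (u : ℝ → Euc d → ℝ) (t : ℝ) (x : Euc d) : ℝ := deriv (fun s => u s x) t

/-- First spatial differential. -/
def dx1 {d : ℕ} (f : Euc d → ℝ) (x : Euc d) : Euc d →L[ℝ] ℝ := fderiv ℝ f x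

/-- Second spatial differential. -/
def dx2 {d : ℕ} (f : Euc d → ℝ) (x : Euc d) : Euc d →L[ℝ] Euc d →L[ℝ] ℝ :=
  fderiv ℝ (fun y => fderiv ℝ f y) x

/-- Laplacian `Δf(x)`. -/
def lapl {d : ℕ} (f : Euc d → ℝ) (x : Euc d) : ℝ :=
  ∑ j : Fin d, dx2 f x (ebasis d j) (ebasis d j)

/-- `div_x A(f) (x) = Σⱼ ∂_{xⱼ} (Aⱼ(f x))`. -/
def divA {d : ℕ} (A : ℝ → Fin d → ℝ) (f : Euc d → ℝ) (x : Euc d) : ℝ :=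
  ∑ j : Fin d, fderiv ℝ (fun y => A (f y) j) x (ebasis d j)

/-- `div (a(t,·) w(t,·)) (x) = Σⱼ ∂_{xⱼ} (aⱼ(t,x) w(t,x))`. -/
def divAW {d : ℕ} (a : ℝ → Euc d → Euc d) (w : ℝ → Euc d → ℝ) (t : ℝ) (x : Euc d) : ℝ :=
  ∑ j : Fin d, fderiv ℝ (fun y => a t y j * w t y) x (ebasis d j)

/-- The boundary of `D` is of class `C³`: near each boundary point, `D` is the sublevel
set of a `C³` function with non-vanishing differential. -/
def HasC3Boundary {d : ℕ} (D : Set (Euc d)) : Prop :=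
  ∀ x ∈ frontier D, ∃ (U : Set (Euc d)) (ψ : Euc d → ℝ),
    IsOpen U ∧ x ∈ U ∧ ContDiff ℝ 3 ψ ∧ (∀ y ∈ U, fderiv ℝ ψ y ≠ 0) ∧
    D ∩ U = {y ∈ U | ψ y < 0}

/-- A bounded connected open domain with `C³` boundary. -/
def GoodDomain {d : ℕ} (D : Set (Euc d)) : Prop :=
  IsOpen D ∧ IsConnected D ∧ Bornology.IsBounded D ∧ HasC3Boundary D

/-- `u ∈ C^{1,2}(J × D̄)`: continuous on the closed cylinder, once continuously
differentiable in `t` and twice in `x`. -/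
def IsC12On {d : ℕ} (J : Set ℝ) (D : Set (Euc d)) (u : ℝ → Euc d → ℝ) : Prop :=
  ContinuousOn (fun p : ℝ × Euc d => u p.1 p.2) (J ×ˢ closure D) ∧
  (∀ x ∈ closure D, ∀ t ∈ J, DifferentiableAt ℝ (fun s => u s x) t) ∧
  (∀ t ∈ J, ∀ x ∈ closure D, DifferentiableAt ℝ (u t) x) ∧
  (∀ t ∈ J, ∀ x ∈ closure D, DifferentiableAt ℝ (fun y => fderiv ℝ (u t) y) x) ∧
  ContinuousOn (fun p : ℝ × Euc d => dtt u p.1 p.2) (J ×ˢ closure D) ∧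
  ContinuousOn (fun p : ℝ × Euc d => dx1 (u p.1) p.2) (J ×ˢ closure D) ∧
  ContinuousOn (fun p : ℝ × Euc d => dx2 (u p.1) p.2) (J ×ˢ closure D)

/-- `N` bounds both the sup-norm and the parabolic Hölder seminorm of exponent `γ`
of `f` on `J × D̄`. -/
def parHolderBound {d : ℕ} {Y : Type*} [NormedAddCommGroup Y] (γ : ℝ) (J : Set ℝ)
    (D : Set (Euc d)) (f : ℝ → Euc d → Y) (N : ℝ) : Prop :=
  (∀ t ∈ J, ∀ x ∈ closure D, ‖f t x‖ ≤ N) ∧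
  ∀ t₁ ∈ J, ∀ t₂ ∈ J, ∀ x₁ ∈ closure D, ∀ x₂ ∈ closure D,
    ‖f t₁ x₁ - f t₂ x₂‖ ≤ N * (|t₁ - t₂| ^ (γ / 2) + ‖x₁ - x₂‖ ^ γ)

/-- The parabolic Hölder norm `|||f|||_γ` on `J × D̄` (up to equivalence). -/
def parHolderNorm {d : ℕ} {Y : Type*} [NormedAddCommGroup Y] (γ : ℝ) (J : Set ℝ)
    (D : Set (Euc d)) (f : ℝ → Euc d → Y) : ℝ :=
  sInf {N : ℝ | 0 ≤ N ∧ parHolderBound γ J D f N}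

/-- `h ∈ C^{γ/2,γ}(J × D̄)`. -/
def MemParHolder {d : ℕ} (γ : ℝ) (J : Set ℝ) (D : Set (Euc d)) (h : ℝ → Euc d → ℝ) : Prop :=
  ContinuousOn (fun p : ℝ × Euc d => h p.1 p.2) (J ×ˢ closure D) ∧
  ∃ N, parHolderBound γ J D h N

/-- `N` bounds the `X^γ(J × D̄)` norm of `u`. -/
def XgammaBound {d : ℕ} (γ : ℝ) (J : Set ℝ) (D : Set (Euc d)) (u : ℝ → Euc d → ℝ)
    (N : ℝ) : Prop :=
  (∀ t ∈ J, ∀ x ∈ closure D, |u t x| ≤ N) ∧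
  parHolderBound γ J D (fun t x => dtt u t x) N ∧
  parHolderBound γ J D (fun t x => dx1 (u t) x) N ∧
  parHolderBound γ J D (fun t x => dx2 (u t) x) N

/-- The `X^γ(J × D̄)` norm (up to equivalence). -/
def XgammaNorm {d : ℕ} (γ : ℝ) (J : Set ℝ) (D : Set (Euc d)) (u : ℝ → Euc d → ℝ) : ℝ :=
  sInf {N : ℝ | 0 ≤ N ∧ XgammaBound γ J D u N}

/-- `u ∈ X^γ(J × D̄)`. -/
def MemXgamma {d : ℕ} (γ : ℝ) (J : Set ℝ) (D : Set (Euc d)) (u : ℝ → Euc d → ℝ) : Prop :=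
  IsC12On J D u ∧ ∃ N, XgammaBound γ J D u N

/-- `N` bounds the sup and the `γ`-Hölder seminorm of `f` on `S`. -/
def holderBoundOn {X Y : Type*} [NormedAddCommGroup X] [NormedAddCommGroup Y]
    (γ : ℝ) (S : Set X) (f : X → Y) (N : ℝ) : Prop :=
  (∀ x ∈ S, ‖f x‖ ≤ N) ∧ ∀ x ∈ S, ∀ y ∈ S, ‖f x - f y‖ ≤ N * ‖x - y‖ ^ γ

/-- `N` bounds the `C^{2+γ}(D̄)` norm of `g`. -/
def C2gammaBound {d : ℕ} (γ : ℝ) (D : Set (Euc d)) (g : Euc d → ℝ) (N : ℝ) : Prop :=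
  holderBoundOn γ (closure D) g N ∧
  holderBoundOn γ (closure D) (fun x => dx1 g x) N ∧
  holderBoundOn γ (closure D) (fun x => dx2 g x) N

/-- The `C^{2+γ}(D̄)` norm (up to equivalence). -/
def C2gammaNorm {d : ℕ} (γ : ℝ) (D : Set (Euc d)) (g : Euc d → ℝ) : ℝ :=
  sInf {N : ℝ | 0 ≤ N ∧ C2gammaBound γ D g N}

/-- `g ∈ C^{2+γ}(D̄)`. -/
def MemC2gamma {d : ℕ} (γ : ℝ) (D : Set (Euc d)) (g : Euc d → ℝ) : Prop :=
  (∀ x ∈ closure D, DifferentiableAt ℝ g x ∧ DifferentiableAt ℝ (fun y => fderiv ℝ g y) x) ∧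
  ∃ N, C2gammaBound γ D g N

/-- `u` satisfies `∂ₜu + div_x A(u) - ν Δu = h` for `t ∈ Jpde`, `x ∈ D`. -/
def SolvesPDE {d : ℕ} (ν : ℝ) (A : ℝ → Fin d → ℝ) (Jpde : Set ℝ) (D : Set (Euc d))
    (h u : ℝ → Euc d → ℝ) : Prop :=
  ∀ t ∈ Jpde, ∀ x ∈ D, dtt u t x + divA A (u t) x - ν * lapl (u t) x = h t x

/-- Homogeneous Dirichlet boundary condition on `J × ∂D`. -/
def DirichletBC {d : ℕ} (J : Set ℝ) (D : Set (Euc d)) (u : ℝ → Euc d → ℝ) : Prop :=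
  ∀ t ∈ J, ∀ x ∈ frontier D, u t x = 0

/-- The compatibility conditions on `∂D`. -/
def CompatCond {d : ℕ} (ν : ℝ) (A : ℝ → Fin d → ℝ) (D : Set (Euc d))
    (h : ℝ → Euc d → ℝ) (u₀ : Euc d → ℝ) : Prop :=
  ∀ x ∈ frontier D, u₀ x = 0 ∧ divA A u₀ x - ν * lapl u₀ x - h 0 x = 0

/-- The sign condition (S): `(Σⱼ Aⱼ'(u)) sgn u ≥ c|u| - C`. -/
def SignCondition {d : ℕ} (A : ℝ → Fin d → ℝ) (c C : ℝ) : Prop :=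
  ∀ u : ℝ, c * |u| - C ≤ (∑ j : Fin d, deriv (fun v => A v j) u) * Real.sign u

/-- The `L¹(D)` norm. -/
def L1norm {d : ℕ} (D : Set (Euc d)) (f : Euc d → ℝ) : ℝ := ∫ x in D, |f x|

/-- The `L^∞(D)` norm (of a bounded continuous function). -/
def supNorm {d : ℕ} (D : Set (Euc d)) (f : Euc d → ℝ) : ℝ :=
  sSup ((fun x => |f x|) '' closure D)

/-- The piecewise constant control from Theorem 2.2: `ξ(t) = ξₖ` for
`t ∈ [k - 1/2, k - 1/2 + τₖ)` (where `k - 1 ≤ t < k`, `k ≥ 1`) and `ξ(t) = 0` otherwise. -/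
def ctrl (ξs τs : ℕ → ℝ) (t : ℝ) : ℝ :=
  Set.indicator
    (Set.Ico (((⌊t⌋₊ + 1 : ℕ) : ℝ) - 1/2) ((((⌊t⌋₊ + 1 : ℕ) : ℝ) - 1/2) + τs (⌊t⌋₊ + 1)))
    (fun _ => ξs (⌊t⌋₊ + 1)) t

/-- `ξ` is piecewise constant on `[0, T]`. -/
def PiecewiseConstOn (ξ : ℝ → ℝ) (T : ℝ) : Prop :=
  ∃ n : ℕ, ∃ τ : ℕ → ℝ, τ 0 = 0 ∧ τ n = T ∧ (∀ k < n, τ k < τ (k + 1)) ∧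
    ∀ k < n, ∀ t ∈ Ico (τ k) (τ (k + 1)), ξ t = ξ (τ k)

/-- `u` is the solution of the controlled problem with control `ξ(t) φ(x)`: a continuous curve
in `C^{2+γ}(D̄)` satisfying the initial and boundary conditions and solving the PDE on every
interval of constancy of `ξ` (i.e. at every time at which `ξ` is locally constant). -/
def IsCtrlSolOn {d : ℕ} (γ ν : ℝ) (A : ℝ → Fin d → ℝ) (D : Set (Euc d))
    (h : ℝ → Euc d → ℝ) (φ : Euc d → ℝ) (ξ : ℝ → ℝ) (u₀ : Euc d → ℝ)
    (J Jo : Set ℝ) (u : ℝ → Euc d → ℝ) : Prop :=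
  ContinuousOn (fun p : ℝ × Euc d => u p.1 p.2) (J ×ˢ closure D) ∧
  (∀ t ∈ J, MemC2gamma γ D (u t)) ∧
  DirichletBC J D u ∧
  (∀ x ∈ closure D, u 0 x = u₀ x) ∧
  ∀ t ∈ Jo, (∀ᶠ s in nhds t, ξ s = ξ t) →
    (∀ x ∈ closure D, DifferentiableAt ℝ (fun s => u s x) t) ∧
    ∀ x ∈ D, dtt u t x + divA A (u t) x - ν * lapl (u t) x = h t x + ξ t * φ x

section

set_option maxSynthPendingDepth 3

section

variable {E : Type*} [NormedAddCommGroup E] [InnerProductSpace ℝ E]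

/-- Second differential. -/
def hess (f : E → ℝ) (x : E) : E →L[ℝ] E →L[ℝ] ℝ :=
  fderiv ℝ (fun y => fderiv ℝ f y) x

/-- `f` is twice differentiable at every point of `S`. -/
def TwiceDiffOn (S : Set E) (f : E → ℝ) : Prop :=
  ∀ x ∈ S, DifferentiableAt ℝ f x ∧ DifferentiableAt ℝ (fun y => fderiv ℝ f y) x

/-- The segment from `p` to `p + w` lies in `S`. -/
def SegIn (S : Set E) (p w : E) : Prop :=
  ∀ σ ∈ Icc (0:ℝ) 1, p + σ • w ∈ S

theorem SegIn.left {S : Set E} {p w : E} (h : SegIn S p w) : p ∈ S := by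
  simpa using h 0 (by simp)

theorem SegIn.right {S : Set E} {p w : E} (h : SegIn S p w) : p + w ∈ S := by
  simpa using h 1 (by simp)

theorem Convex.segIn {S : Set E} (hS : Convex ℝ S) {p w : E} (hp : p ∈ S)
    (hw : p + w ∈ S) : SegIn S p w := by
  intro σ hσ
  have := hS hp hw (sub_nonneg.2 hσ.2) hσ.1 (by ring)
  convert this using 1
  module

theorem grad_sub_on_segment {S : Set E} {f : E → ℝ} (hf : TwiceDiffOn S f)
    {p w : E} (hs : SegIn S p w) {B : E →L[ℝ] E →L[ℝ] ℝ} {K : ℝ}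
    (hK : ∀ σ ∈ Icc (0:ℝ) 1, ‖hess f (p + σ • w) - B‖ ≤ K) :
    ∀ σ ∈ Icc (0:ℝ) 1, ‖fderiv ℝ f (p + σ • w) - fderiv ℝ f p - σ • B w‖ ≤ K * ‖w‖ * σ := by
  intro σ hσ
  have key := norm_image_sub_le_of_norm_deriv_le_segment' (a := (0:ℝ)) (b := 1) (C := K * ‖w‖)
    (f := fun σ : ℝ => fderiv ℝ f (p + σ • w) - σ • B w)
    (f' := fun σ : ℝ => (hess f (p + σ • w) - B) w) ?_ ?_ σ hσ
  · simpa [sub_right_comm] using key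
  · intro x hx
    have h1 : HasFDerivAt (fun y => fderiv ℝ f y) (hess f (p + x • w)) (p + x • w) :=
      (hf _ (hs x hx)).2.hasFDerivAt
    have h2 : HasDerivAt (fun σ : ℝ => p + σ • w) w x := by
      simpa using ((hasDerivAt_id x).smul_const w).const_add p
    have h3 := h1.comp_hasDerivAt x h2
    have h4 : HasDerivAt (fun σ : ℝ => σ • B w) (B w) x := by
      simpa using (hasDerivAt_id x).smul_const (B w)
    simpa only [sub_apply] using! (h3.sub h4).hasDerivWithinAt (s := Icc 0 1)
  · intro x hx
    exact ((hess f (p + x • w) - B).le_opNorm w).trans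
      (mul_le_mul_of_nonneg_right (hK x ⟨hx.1, hx.2.le⟩) (norm_nonneg _))

theorem taylor_on_segment {S : Set E} {f : E → ℝ} (hf : TwiceDiffOn S f)
    {p w : E} (hs : SegIn S p w) {B : E →L[ℝ] E →L[ℝ] ℝ} {K : ℝ}
    (hK : ∀ σ ∈ Icc (0:ℝ) 1, ‖hess f (p + σ • w) - B‖ ≤ K) :
    |f (p + w) - f p - fderiv ℝ f p w - B w w / 2| ≤ K * ‖w‖ ^ 2 := by
  have hg := grad_sub_on_segment hf hs hK
  have hK0 : 0 ≤ K := (norm_nonneg _).trans (hK 0 (by simp))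
  have key := norm_image_sub_le_of_norm_deriv_le_segment_01' (C := K * ‖w‖ ^ 2)
    (f := fun σ : ℝ => f (p + σ • w) - σ * fderiv ℝ f p w - σ ^ 2 / 2 * B w w)
    (f' := fun σ : ℝ => (fderiv ℝ f (p + σ • w) - fderiv ℝ f p - σ • B w) w) ?_ ?_
  · simp only [one_smul, zero_smul, add_zero, one_mul, zero_mul, Real.norm_eq_abs] at key
    convert key using 2
    ring
  · intro x hx
    have h1 : HasFDerivAt f (fderiv ℝ f (p + x • w)) (p + x • w) := (hf _ (hs x hx)).1.hasFDerivAt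
    have h2 : HasDerivAt (fun σ : ℝ => p + σ • w) w x := by
      simpa using ((hasDerivAt_id x).smul_const w).const_add p
    have h3 := h1.comp_hasDerivAt x h2
    have h4 : HasDerivAt (fun σ : ℝ => σ * fderiv ℝ f p w) (fderiv ℝ f p w) x := by
      simpa using (hasDerivAt_id x).mul_const (fderiv ℝ f p w)
    have h5 : HasDerivAt (fun σ : ℝ => σ ^ 2 / 2 * B w w) (x * B w w) x := by
      have := (((hasDerivAt_id x).pow 2).div_const 2).mul_const (B w w)
      simpa using this
    simpa using! ((h3.sub h4).sub h5).hasDerivWithinAt (s := Icc 0 1)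
  · intro x hx
    have h1 := hg x ⟨hx.1, hx.2.le⟩
    refine (ContinuousLinearMap.le_opNorm _ w).trans ?_
    calc _ ≤ (K * ‖w‖ * x) * ‖w‖ := mul_le_mul_of_nonneg_right h1 (norm_nonneg _)
      _ ≤ (K * ‖w‖ * 1) * ‖w‖ := by
        have := hx.2.le
        gcongr
      _ = _ := by ring

theorem fderiv_sub_le_on_segment {S : Set E} {f : E → ℝ} (hf : TwiceDiffOn S f)
    {p w : E} (hs : SegIn S p w) {K : ℝ} (hK : ∀ x ∈ S, ‖hess f x‖ ≤ K) :
    ‖fderiv ℝ f (p + w) - fderiv ℝ f p‖ ≤ K * ‖w‖ := by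
  have := grad_sub_on_segment hf hs (B := 0) (K := K) (fun σ hσ => by
    simpa using hK _ (hs σ hσ)) 1 (by simp)
  simpa using this

theorem sub_le_on_segment {S : Set E} {f : E → ℝ} (hf : TwiceDiffOn S f)
    {p w : E} (hs : SegIn S p w) {K : ℝ} (hK : ∀ x ∈ S, ‖fderiv ℝ f x‖ ≤ K) :
    |f (p + w) - f p| ≤ K * ‖w‖ := by
  have key := norm_image_sub_le_of_norm_deriv_le_segment_01' (C := K * ‖w‖)
    (f := fun σ : ℝ => f (p + σ • w))
    (f' := fun σ : ℝ => fderiv ℝ f (p + σ • w) w) ?_ ?_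
  · simpa using key
  · intro x hx
    have h1 : HasFDerivAt f (fderiv ℝ f (p + x • w)) (p + x • w) := (hf _ (hs x hx)).1.hasFDerivAt
    have h2 : HasDerivAt (fun σ : ℝ => p + σ • w) w x := by
      simpa using ((hasDerivAt_id x).smul_const w).const_add p
    exact (h1.comp_hasDerivAt x h2).hasDerivWithinAt
  · intro x hx
    refine (ContinuousLinearMap.le_opNorm _ w).trans ?_
    exact mul_le_mul_of_nonneg_right (hK _ (hs x ⟨hx.1, hx.2.le⟩)) (norm_nonneg _)

/-- The norm of a symmetric bilinear form is controlled by its quadratic form. -/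
theorem opNorm_le_of_quadratic {B : E →L[ℝ] E →L[ℝ] ℝ}
    (hB : ∀ v w, B v w = B w v) {q : ℝ} (hq0 : 0 ≤ q) (hq : ∀ w, |B w w| ≤ q * ‖w‖ ^ 2) :
    ‖B‖ ≤ q := by
  have hpol : ∀ v w, |B v w| ≤ q / 2 * (‖v‖ ^ 2 + ‖w‖ ^ 2) := by
    intro v w
    have h1 := abs_le.1 (hq (v + w))
    have h2 := abs_le.1 (hq (v - w))
    have h3 : B v w = (B (v + w) (v + w) - B (v - w) (v - w)) / 4 := by
      simp only [map_add, map_sub, add_apply, sub_apply,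
        hB w v]
      ring
    have h4 := parallelogram_law_with_norm ℝ v w
    rw [h3, abs_le]
    constructor <;> nlinarith
  refine ContinuousLinearMap.opNorm_le_bound _ hq0 fun v => ?_
  refine ContinuousLinearMap.opNorm_le_bound _ (by positivity) fun w => ?_
  rcases eq_or_ne v 0 with rfl | hv
  · simp
  rcases eq_or_ne w 0 with rfl | hw
  · simp
  have hv' : 0 < ‖v‖ := norm_pos_iff.2 hv
  have hw' : 0 < ‖w‖ := norm_pos_iff.2 hw
  have h := hpol (‖v‖⁻¹ • v) (‖w‖⁻¹ • w)
  rw [norm_smul, norm_smul, norm_inv, norm_inv, norm_norm, norm_norm, inv_mul_cancel₀ hv'.ne',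
    inv_mul_cancel₀ hw'.ne'] at h
  simp only [map_smul, smul_apply, smul_eq_mul, abs_mul, abs_inv,
    abs_norm] at h
  rw [Real.norm_eq_abs]
  have h6 : |B v w| = ‖v‖ * ‖w‖ * (‖v‖⁻¹ * (‖w‖⁻¹ * |B v w|)) := by
    field_simp
  rw [h6]
  calc _ ≤ ‖v‖ * ‖w‖ * (q / 2 * (1 ^ 2 + 1 ^ 2)) := by
        refine mul_le_mul_of_nonneg_left ?_ (by positivity)
        linarith
    _ = _ := by ring

theorem hess_symm_of_isOpen {D : Set E} (hD : IsOpen D) {f : E → ℝ}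
    (hf : TwiceDiffOn D f) {x : E} (hx : x ∈ D) (v w : E) :
    hess f x v w = hess f x w v := by
  have h1 : ∀ᶠ y in 𝓝 x, HasFDerivAt f (fderiv ℝ f y) y := by
    filter_upwards [hD.mem_nhds hx] with y hy using (hf y hy).1.hasFDerivAt
  exact second_derivative_symmetric_of_eventually h1 (hf x hx).2.hasFDerivAt v w

end

section

/-- `w` solves the heat equation with viscosity `ν` at `(τ, y)` in the sense of symmetric second
difference quotients in space and backward difference quotients in time. -/
def CalAt {E ι : Type*} [NormedAddCommGroup E] [InnerProductSpace ℝ E] [Fintype ι]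
    (b : OrthonormalBasis ι ℝ E) (ν : ℝ) (w : ℝ → E → ℝ) (τ : ℝ) (y : E) : Prop :=
  ∃ m : ι → ℝ,
    (∀ i, Tendsto (fun h : ℝ => (w τ (y + h • b i) + w τ (y - h • b i) - 2 * w τ y) / h ^ 2)
      (𝓝[>] 0) (𝓝 (m i))) ∧
    Tendsto (fun σ : ℝ => (w τ y - w (τ - σ) y) / σ) (𝓝[>] 0) (𝓝 (ν * ∑ i, m i))

section
variable {E ι : Type*} [NormedAddCommGroup E] [InnerProductSpace ℝ E] [Fintype ι]
  {b : OrthonormalBasis ι ℝ E} {ν : ℝ} {w w' : ℝ → E → ℝ} {τ : ℝ} {y : E}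

theorem CalAt.sub (h : CalAt b ν w τ y) (h' : CalAt b ν w' τ y) :
    CalAt b ν (fun t x => w t x - w' t x) τ y := by
  obtain ⟨m, h1, h2⟩ := h
  obtain ⟨m', h1', h2'⟩ := h'
  refine ⟨fun i => m i - m' i, fun i => ?_, ?_⟩
  · refine ((h1 i).sub (h1' i)).congr fun r => ?_
    ring
  · rw [Finset.sum_sub_distrib, mul_sub]
    refine (h2.sub h2').congr fun r => ?_
    ring

theorem CalAt.add (h : CalAt b ν w τ y) (h' : CalAt b ν w' τ y) :
    CalAt b ν (fun t x => w t x + w' t x) τ y := by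
  obtain ⟨m, h1, h2⟩ := h
  obtain ⟨m', h1', h2'⟩ := h'
  refine ⟨fun i => m i + m' i, fun i => ?_, ?_⟩
  · refine ((h1 i).add (h1' i)).congr fun r => ?_
    ring
  · rw [Finset.sum_add_distrib, mul_add]
    refine (h2.add h2').congr fun r => ?_
    ring

theorem CalAt.neg (h : CalAt b ν w τ y) : CalAt b ν (fun t x => - w t x) τ y := by
  obtain ⟨m, h1, h2⟩ := h
  refine ⟨fun i => - m i, fun i => ?_, ?_⟩
  · refine (h1 i).neg.congr fun r => ?_
    ring
  · rw [Finset.sum_neg_distrib, mul_neg]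
    refine h2.neg.congr fun r => ?_
    ring

theorem CalAt.translate {σ : ℝ} {a : E} (h : CalAt b ν w (τ + σ) (y + a)) :
    CalAt b ν (fun t x => w (t + σ) (x + a)) τ y := by
  obtain ⟨m, h1, h2⟩ := h
  refine ⟨m, fun i => (h1 i).congr fun r => ?_, h2.congr fun r => ?_⟩
  · rw [add_right_comm y a, sub_eq_add_neg (y + a), add_right_comm y a, ← sub_eq_add_neg]
  · simp only [sub_add_eq_add_sub]

/-- A maximum principle on half-balls: the key barrier estimate. -/
theorem le_barrier_of_calAt [FiniteDimensional ℝ E] {n : E} (hn : ‖n‖ = 1) (hν : 0 < ν) {γ K : ℝ}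
    (hγ : 0 < γ) (hK : 0 ≤ K)
    (hc : ContinuousOn (fun p : ℝ × E => w p.1 p.2) (Iic 0 ×ˢ {y | 0 ≤ inner ℝ n y}))
    (h0 : ∀ τ ≤ 0, ∀ y, inner ℝ n y = 0 → w τ y = 0)
    (hg : ∀ τ ≤ 0, ∀ y, 0 ≤ inner ℝ n y → |w τ y| ≤ K * (1 + ‖y‖ ^ γ + |τ| ^ (γ / 2)))
    (hcal : ∀ τ ≤ 0, ∀ y, 0 < inner ℝ n y → CalAt b ν w τ y)
    {R : ℝ} (hR : 1 ≤ R) {τ : ℝ} (hτ : τ ∈ Icc (-R ^ 2) 0) {y : E} (hy : ‖y‖ ≤ R)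
    (hny : 0 ≤ inner ℝ n y) :
    w τ y ≤ 3 * K * R ^ γ * (‖y‖ ^ 2 / R ^ 2 - τ / R ^ 2 +
      (Fintype.card ι + 1 / (2 * ν) + 1) * (inner ℝ n y / R) * (2 - inner ℝ n y / R)) := by
  have hR0 : 0 < R := by linarith
  have hRγ : 1 ≤ R ^ γ := Real.one_le_rpow hR hγ.le
  rcases hK.eq_or_lt with rfl | hK
  · have := hg τ hτ.2 y hny
    have := (abs_le.1 this).2
    simpa using this
  set β : ℝ := Fintype.card ι + 1 / (2 * ν) + 1 with hβ
  have hβ0 : 0 < β := by positivity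
  have hs_le : ∀ y : E, ‖y‖ ≤ R → inner ℝ n y / R ≤ 1 := by
    intro y hy
    rw [div_le_one hR0]
    have := real_inner_le_norm n y
    rw [hn, one_mul] at this
    exact this.trans hy
  set φ : ℝ → E → ℝ := fun τ y => 3 * K * R ^ γ * (‖y‖ ^ 2 / R ^ 2 - τ / R ^ 2 +
      β * (inner ℝ n y / R) * (2 - inner ℝ n y / R)) with hφ
  set Q : Set (ℝ × E) := Icc (-R ^ 2) 0 ×ˢ (Metric.closedBall 0 R ∩ {y | 0 ≤ inner ℝ n y}) with hQ
  have hQc : IsCompact Q := by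
    refine isCompact_Icc.prod ((isCompact_closedBall _ _).inter_right ?_)
    exact isClosed_le continuous_const (by fun_prop)
  have hcQ : ContinuousOn (fun p : ℝ × E => w p.1 p.2 - φ p.1 p.2) Q := by
    refine (hc.mono ?_).sub (Continuous.continuousOn (by fun_prop))
    exact fun p hp => ⟨hp.1.2, hp.2.2⟩
  obtain ⟨⟨t, x⟩, hz, hmax⟩ := hQc.exists_isMaxOn ⟨(τ, y), hτ, by simpa using hy, hny⟩ hcQ
  have hmax' : ∀ t' x', (t', x') ∈ Q → w t' x' - φ t' x' ≤ w t x - φ t x := fun t' x' h =>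
    hmax h
  have hfin := hmax' τ y ⟨hτ, by simpa using hy, hny⟩
  by_contra! hcon
  have hpos : 0 < w t x - φ t x := by
    have : 0 < w τ y - φ τ y := by simp only [hφ]; linarith
    linarith
  obtain ⟨⟨ht1, ht2⟩, hx1, hx2⟩ := hz
  simp only [mem_ofPred_eq] at hx2 ht1 ht2
  simp only [Metric.mem_closedBall, dist_zero_right] at hx1
  have hsx := hs_le x hx1
  have hb0 : 0 ≤ β * (inner ℝ n x / R) * (2 - inner ℝ n x / R) :=
    mul_nonneg (mul_nonneg hβ0.le (div_nonneg hx2 hR0.le)) (by linarith)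
  have hwx := (abs_le.1 (hg t ht2 x hx2)).2
  have hxγ : ‖x‖ ^ γ ≤ R ^ γ := Real.rpow_le_rpow (norm_nonneg _) hx1 hγ.le
  have htγ : |t| ^ (γ / 2) ≤ R ^ γ := by
    have h1 : |t| ≤ R ^ 2 := by rw [abs_of_nonpos ht2]; linarith
    calc |t| ^ (γ / 2) ≤ (R ^ 2) ^ (γ / 2) := Real.rpow_le_rpow (abs_nonneg _) h1 (by linarith)
      _ = R ^ γ := by
        rw [← Real.rpow_natCast R 2, ← Real.rpow_mul hR0.le]
        congr 1
        push_cast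
        ring
  have hbd : w t x ≤ 3 * K * R ^ γ := by
    have : K * (1 + ‖x‖ ^ γ + |t| ^ (γ / 2)) ≤ K * (3 * R ^ γ) := by
      apply mul_le_mul_of_nonneg_left _ hK.le
      linarith
    linarith
  have hP : 0 < 3 * K * R ^ γ := by positivity
  have hR2 : 0 < R ^ 2 := by positivity
  have htR : 0 ≤ - t / R ^ 2 := div_nonneg (by linarith) hR2.le
  have hxR : 0 ≤ ‖x‖ ^ 2 / R ^ 2 := by positivity
  have hin : ‖x‖ ^ 2 / R ^ 2 - t / R ^ 2 < 1 := by
    by_contra! h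
    have : 3 * K * R ^ γ * 1 ≤ φ t x := by
      refine mul_le_mul_of_nonneg_left ?_ hP.le
      linarith
    linarith
  have hxlt : ‖x‖ < R := by
    by_contra! h
    have : ‖x‖ = R := le_antisymm hx1 h
    rw [this, div_self hR2.ne'] at hin
    have : -t / R ^ 2 = - (t / R ^ 2) := neg_div _ _
    linarith
  have htlt : -R ^ 2 < t := by
    by_contra! h
    have : t = - R ^ 2 := le_antisymm h ht1
    rw [this, neg_div, div_self hR2.ne'] at hin
    linarith
  have hspos : 0 < inner ℝ n x := by
    refine lt_of_le_of_ne hx2 fun h => ?_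
    have h1 := h0 t ht2 x h.symm
    have : 0 ≤ φ t x := by
      refine mul_nonneg hP.le ?_
      have : -t / R ^ 2 = - (t / R ^ 2) := neg_div _ _
      linarith
    linarith
  obtain ⟨m, hm1, hm2⟩ := hcal t ht2 x hspos
  -- second differences
  have hΩ : {z : E | ‖z‖ < R ∧ 0 < inner ℝ n z} ∈ 𝓝 x := by
    have o1 : IsOpen {z : E | ‖z‖ < R} := isOpen_lt (by fun_prop) continuous_const
    have o2 : IsOpen {z : E | 0 < inner ℝ n z} := isOpen_lt continuous_const (by fun_prop)
    exact (o1.inter o2).mem_nhds ⟨hxlt, hspos⟩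
  have hsecond : ∀ i, m i ≤ 3 * K * R ^ γ * ((2 - 2 * β * (inner ℝ n (b i)) ^ 2) / R ^ 2) := by
    intro i
    refine le_of_tendsto (hm1 i) ?_
    have e1 : ∀ᶠ h : ℝ in 𝓝[>] 0, ‖x + h • b i‖ < R ∧ 0 < inner ℝ n (x + h • b i) := by
      refine nhdsWithin_le_nhds ?_
      have : Tendsto (fun h : ℝ => x + h • b i) (𝓝 0) (𝓝 x) := by
        have : Continuous (fun h : ℝ => x + h • b i) := by fun_prop
        simpa using this.tendsto 0
      exact this hΩ
    have e2 : ∀ᶠ h : ℝ in 𝓝[>] 0, ‖x - h • b i‖ < R ∧ 0 < inner ℝ n (x - h • b i) := by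
      refine nhdsWithin_le_nhds ?_
      have : Tendsto (fun h : ℝ => x - h • b i) (𝓝 0) (𝓝 x) := by
        have : Continuous (fun h : ℝ => x - h • b i) := by fun_prop
        simpa using this.tendsto 0
      exact this hΩ
    filter_upwards [e1, e2, self_mem_nhdsWithin] with h h1 h2 hh
    have hh : 0 < h := hh
    rw [div_le_iff₀ (by positivity)]
    have g1 := hmax' t (x + h • b i) ⟨⟨ht1, ht2⟩, by simpa using h1.1.le, h1.2.le⟩
    have g2 := hmax' t (x - h • b i) ⟨⟨ht1, ht2⟩, by simpa using h2.1.le, h2.2.le⟩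
    have hid : φ t (x + h • b i) + φ t (x - h • b i) - 2 * φ t x =
        3 * K * R ^ γ * ((2 - 2 * β * (inner ℝ n (b i)) ^ 2) / R ^ 2) * h ^ 2 := by
      have hp := parallelogram_law_with_norm ℝ x (h • b i)
      have hbi : ‖h • b i‖ = h := by
        rw [norm_smul, b.norm_eq_one, mul_one, Real.norm_of_nonneg hh.le]
      rw [hbi] at hp
      have : ‖x + h • b i‖ ^ 2 = 2 * ‖x‖ ^ 2 + 2 * h ^ 2 - ‖x - h • b i‖ ^ 2 := by linarith
      simp only [hφ, this, inner_add_right, inner_sub_right, inner_smul_right]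
      field_simp
      ring
    linarith
  have hsum : ∑ i, m i ≤ 3 * K * R ^ γ * ((2 * Fintype.card ι - 2 * β) / R ^ 2) := by
    refine (Finset.sum_le_sum fun i _ => hsecond i).trans (le_of_eq ?_)
    rw [← Finset.mul_sum, ← Finset.sum_div, Finset.sum_sub_distrib, ← Finset.mul_sum]
    have : ∑ i, (inner ℝ n (b i)) ^ 2 = 1 := by
      have := b.sum_sq_norm_inner_left n
      simpa [hn] using this
    rw [this]
    simp only [Finset.sum_const, Finset.card_univ, nsmul_eq_mul]
    ring
  have htime : - (3 * K * R ^ γ / R ^ 2) ≤ ν * ∑ i, m i := by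
    refine ge_of_tendsto hm2 ?_
    have e1 : ∀ᶠ σ : ℝ in 𝓝[>] 0, -R ^ 2 < t - σ := by
      refine nhdsWithin_le_nhds ?_
      have : Tendsto (fun σ : ℝ => t - σ) (𝓝 0) (𝓝 t) := by
        have : Continuous (fun σ : ℝ => t - σ) := by fun_prop
        simpa using this.tendsto 0
      exact this.eventually (lt_mem_nhds htlt)
    filter_upwards [e1, self_mem_nhdsWithin] with σ h1 hσ
    have hσ : 0 < σ := hσ
    rw [le_div_iff₀ hσ]
    have g1 := hmax' (t - σ) x ⟨⟨h1.le, by linarith⟩, by simpa using hx1, hx2⟩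
    have hid : φ t x - φ (t - σ) x = - (3 * K * R ^ γ / R ^ 2) * σ := by
      simp only [hφ]
      field_simp
      ring
    linarith
  have h1 : ν * ∑ i, m i ≤ ν * (3 * K * R ^ γ * ((2 * Fintype.card ι - 2 * β) / R ^ 2)) :=
    mul_le_mul_of_nonneg_left hsum hν.le
  have h2 : ν * (3 * K * R ^ γ * ((2 * Fintype.card ι - 2 * β) / R ^ 2)) =
      (3 * K * R ^ γ / R ^ 2) * (-1 - 2 * ν) := by
    rw [hβ]
    field_simp
    ring
  have h3 : 0 < 3 * K * R ^ γ / R ^ 2 := by positivity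
  nlinarith

/-- Liouville theorem on the half space for functions of sublinear growth. -/
theorem eq_zero_of_calAt_halfSpace [FiniteDimensional ℝ E] {n : E} (hn : ‖n‖ = 1) (hν : 0 < ν)
    {γ K : ℝ} (hγ : γ ∈ Ioo (0 : ℝ) 1) (hK : 0 ≤ K)
    (hc : ContinuousOn (fun p : ℝ × E => w p.1 p.2) (Iic 0 ×ˢ {y | 0 ≤ inner ℝ n y}))
    (h0 : ∀ τ ≤ 0, ∀ y, inner ℝ n y = 0 → w τ y = 0)
    (hg : ∀ τ ≤ 0, ∀ y, 0 ≤ inner ℝ n y → |w τ y| ≤ K * (1 + ‖y‖ ^ γ + |τ| ^ (γ / 2)))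
    (hcal : ∀ τ ≤ 0, ∀ y, 0 < inner ℝ n y → CalAt b ν w τ y)
    {τ : ℝ} (hτ : τ ≤ 0) {y : E} (hny : 0 ≤ inner ℝ n y) : w τ y = 0 := by
  set β : ℝ := Fintype.card ι + 1 / (2 * ν) + 1 with hβ
  have hβ0 : 0 < β := by positivity
  set s : ℝ := inner ℝ n y with hs
  have key : ∀ᶠ R : ℝ in atTop, |w τ y| ≤ 3 * K * (‖y‖ ^ 2 - τ + 2 * β * s) * R ^ (-(1 - γ)) := by
    filter_upwards [eventually_ge_atTop 1, eventually_ge_atTop ‖y‖, eventually_ge_atTop (-τ)]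
      with R hR1 hRy hRτ
    have hR0 : 0 < R := by linarith
    have hmem : τ ∈ Icc (-R ^ 2) 0 := ⟨by nlinarith, hτ⟩
    have a1 := le_barrier_of_calAt hn hν hγ.1 hK hc h0 hg hcal hR1 hmem hRy hny
    have a2 := le_barrier_of_calAt (w := fun t x => - w t x) hn hν hγ.1 hK hc.neg
      (fun t ht x hx => by simp [h0 t ht x hx]) (fun t ht x hx => by simpa using hg t ht x hx)
      (fun t ht x hx => (hcal t ht x hx).neg) hR1 hmem hRy hny
    rw [← hβ, ← hs] at a1 a2
    have a3 : |w τ y| ≤ 3 * K * R ^ γ * (‖y‖ ^ 2 / R ^ 2 - τ / R ^ 2 + β * (s / R) * (2 - s / R)) :=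
      abs_le.2 ⟨by linarith, a1⟩
    refine a3.trans ?_
    have hb : ‖y‖ ^ 2 / R ^ 2 - τ / R ^ 2 + β * (s / R) * (2 - s / R) ≤
        (‖y‖ ^ 2 - τ + 2 * β * s) / R := by
      have hsR : 0 ≤ s / R := div_nonneg hny hR0.le
      have b1 : (‖y‖ ^ 2 - τ) / R ^ 2 ≤ (‖y‖ ^ 2 - τ) / R := by
        apply div_le_div_of_nonneg_left _ hR0 (by nlinarith)
        have := sq_nonneg ‖y‖
        linarith
      have b2 : β * (s / R) * (2 - s / R) ≤ β * (s / R) * 2 := by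
        apply mul_le_mul_of_nonneg_left _ (by positivity)
        linarith
      have b3 : (‖y‖ ^ 2 - τ + 2 * β * s) / R = (‖y‖ ^ 2 - τ) / R + β * (s / R) * 2 := by
        ring
      rw [← sub_div, b3]
      linarith
    calc _ ≤ 3 * K * R ^ γ * ((‖y‖ ^ 2 - τ + 2 * β * s) / R) :=
          mul_le_mul_of_nonneg_left hb (by positivity)
      _ = 3 * K * (‖y‖ ^ 2 - τ + 2 * β * s) * R ^ (-(1 - γ)) := by
        rw [show -(1 - γ) = γ - 1 by ring, Real.rpow_sub_one hR0.ne']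
        ring
  have hlim : Tendsto (fun R : ℝ => 3 * K * (‖y‖ ^ 2 - τ + 2 * β * s) * R ^ (-(1 - γ))) atTop
      (𝓝 (3 * K * (‖y‖ ^ 2 - τ + 2 * β * s) * 0)) :=
    (tendsto_rpow_neg_atTop (by linarith [hγ.2])).const_mul _
  rw [mul_zero] at hlim
  exact abs_nonpos_iff.1 (ge_of_tendsto hlim key)
end
end

section

section
variable {E ι : Type*} [NormedAddCommGroup E] [InnerProductSpace ℝ E] [Fintype ι]

theorem CalAt.reflect {b : OrthonormalBasis ι ℝ E} {ν : ℝ} {w : ℝ → E → ℝ} {τ : ℝ} {y q : E} (i : ι)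
    (h : CalAt b ν w τ (q + (y - (2 * inner ℝ (b i) y) • b i))) :
    CalAt b ν (fun t x => w t (q + (x - (2 * inner ℝ (b i) x) • b i))) τ y := by
  obtain ⟨m, h1, h2⟩ := h
  refine ⟨m, fun j => (h1 j).congr fun r => ?_, h2⟩
  rcases eq_or_ne i j with rfl | hij
  · have e1 : q + (y + r • b i - (2 * inner ℝ (b i) (y + r • b i)) • b i) =
        q + (y - (2 * inner ℝ (b i) y) • b i) - r • b i := by
      rw [inner_add_right, inner_smul_right, real_inner_self_eq_norm_sq, b.norm_eq_one]
      module
    have e2 : q + (y - r • b i - (2 * inner ℝ (b i) (y - r • b i)) • b i) =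
        q + (y - (2 * inner ℝ (b i) y) • b i) + r • b i := by
      rw [inner_sub_right, inner_smul_right, real_inner_self_eq_norm_sq, b.norm_eq_one]
      module
    simp only [e1, e2]
    ring
  · have e0 : inner ℝ (b i) (b j) = 0 := b.inner_eq_zero hij
    have e1 : q + (y + r • b j - (2 * inner ℝ (b i) (y + r • b j)) • b i) =
        q + (y - (2 * inner ℝ (b i) y) • b i) + r • b j := by
      rw [inner_add_right, inner_smul_right, e0]
      module
    have e2 : q + (y - r • b j - (2 * inner ℝ (b i) (y - r • b j)) • b i) =
        q + (y - (2 * inner ℝ (b i) y) • b i) - r • b j := by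
      rw [inner_sub_right, inner_smul_right, e0]
      module
    simp only [e1, e2]

theorem rpow_norm_add_le {E : Type*} [NormedAddCommGroup E] {γ : ℝ}
    (hγ : γ ∈ Ioo (0 : ℝ) 1) (q z : E) :
    ‖q + z‖ ^ γ ≤ ‖q‖ ^ γ + ‖z‖ ^ γ :=
  (Real.rpow_le_rpow (norm_nonneg _) (norm_add_le q z) hγ.1.le).trans
    (Real.rpow_add_le_add_rpow (norm_nonneg _) (norm_nonneg _) hγ.1.le hγ.2.le)

/-- Liouville theorem on the whole space for functions of sublinear growth. -/
theorem eq_of_calAt_univ [FiniteDimensional ℝ E] {b : OrthonormalBasis ι ℝ E} {ν : ℝ}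
    {w : ℝ → E → ℝ} (hν : 0 < ν) {γ K : ℝ} (hγ : γ ∈ Ioo (0 : ℝ) 1) (hK : 0 ≤ K)
    (hc : ContinuousOn (fun p : ℝ × E => w p.1 p.2) (Iic 0 ×ˢ univ))
    (hg : ∀ τ ≤ 0, ∀ y, |w τ y| ≤ K * (1 + ‖y‖ ^ γ + |τ| ^ (γ / 2)))
    (hcal : ∀ τ ≤ 0, ∀ y, CalAt b ν w τ y) {τ : ℝ} (hτ : τ ≤ 0) (y y' : E) :
    w τ y = w τ y' := by
  have step : ∀ (i : ι) (y : E) (c : ℝ), w τ (y + c • b i) = w τ y := by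
    intro i
    have pos : ∀ (y : E) (c : ℝ), 0 ≤ c → w τ (y + c • b i) = w τ y := by
      intro y c hc0
      set q : E := y + (c / 2) • b i with hq
      have key := eq_zero_of_calAt_halfSpace (b := b) (n := b i)
        (w := fun t z => w t (q + z) - w t (q + (z - (2 * inner ℝ (b i) z) • b i)))
        (b.norm_eq_one i) hν hγ (K := K * (2 + 2 * ‖q‖ ^ γ + 4)) (by positivity) ?_ ?_ ?_ ?_ hτ
        (y := (c / 2) • b i) ?_
      · rw [sub_eq_zero] at key
        convert key using 2
        · rw [hq]
          module
        · rw [hq, inner_smul_right, real_inner_self_eq_norm_sq, b.norm_eq_one]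
          module
      · have c1 : Continuous (fun p : ℝ × E => (p.1, q + p.2)) := by fun_prop
        have c2 : Continuous (fun p : ℝ × E =>
          (p.1, q + (p.2 - (2 * inner ℝ (b i) p.2) • b i))) := by fun_prop
        refine (hc.comp c1.continuousOn ?_).sub (hc.comp c2.continuousOn ?_)
        · exact fun p hp => ⟨hp.1, mem_univ _⟩
        · exact fun p hp => ⟨hp.1, mem_univ _⟩
      · intro t _ z hz
        simp [hz]
      · intro t ht z _
        have g1 := hg t ht (q + z)
        have g2 := hg t ht (q + (z - (2 * inner ℝ (b i) z) • b i))
        have n1 := rpow_norm_add_le hγ q z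
        have n2 := rpow_norm_add_le hγ q (z - (2 * inner ℝ (b i) z) • b i)
        have n3 : ‖z - (2 * inner ℝ (b i) z) • b i‖ ^ γ ≤ 3 * ‖z‖ ^ γ := by
          have : ‖z - (2 * inner ℝ (b i) z) • b i‖ ≤ 3 * ‖z‖ := by
            refine (norm_sub_le _ _).trans ?_
            rw [norm_smul, b.norm_eq_one, norm_mul, mul_one]
            have := norm_inner_le_norm (𝕜 := ℝ) (b i) z
            rw [b.norm_eq_one, one_mul] at this
            norm_num
            norm_num at this
            linarith
          calc _ ≤ (3 * ‖z‖) ^ γ := Real.rpow_le_rpow (norm_nonneg _) this hγ.1.le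
            _ = 3 ^ γ * ‖z‖ ^ γ := Real.mul_rpow (by norm_num) (norm_nonneg _)
            _ ≤ 3 ^ (1 : ℝ) * ‖z‖ ^ γ := by
              gcongr
              · norm_num
              · exact hγ.2.le
            _ = _ := by norm_num
        have p1 : 0 ≤ ‖q‖ ^ γ := by positivity
        have p2 : 0 ≤ ‖z‖ ^ γ := by positivity
        have p3 : 0 ≤ |t| ^ (γ / 2) := by positivity
        have g12 := abs_sub (w t (q + z)) (w t (q + (z - (2 * inner ℝ (b i) z) • b i)))
        refine g12.trans ?_
        have : K * (1 + ‖q + z‖ ^ γ + |t| ^ (γ / 2)) +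
            K * (1 + ‖q + (z - (2 * inner ℝ (b i) z) • b i)‖ ^ γ + |t| ^ (γ / 2)) ≤
            K * ((2 + 2 * ‖q‖ ^ γ + 4) * (1 + ‖z‖ ^ γ + |t| ^ (γ / 2))) := by
          rw [← mul_add]
          apply mul_le_mul_of_nonneg_left _ hK
          nlinarith [mul_nonneg p1 p2, mul_nonneg p1 p3]
        linarith
      · intro t ht z _
        refine CalAt.sub ?_ (CalAt.reflect i (hcal t ht _))
        have := CalAt.translate (b := b) (ν := ν) (w := w) (τ := t) (y := z) (σ := 0) (a := q)
          (hcal (t + 0) (by simpa using ht) _)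
        simpa only [add_zero, add_comm] using this
      · rw [inner_smul_right, real_inner_self_eq_norm_sq, b.norm_eq_one]
        linarith
    intro y c
    rcases le_total 0 c with h | h
    · exact pos y c h
    · have := pos (y + c • b i) (-c) (by linarith)
      rw [← this]
      congr 1
      module
  have hsum : ∀ (s : Finset ι) (a : ι → ℝ) (y : E), w τ (y + ∑ i ∈ s, a i • b i) = w τ y := by
    classical
    intro s a
    induction s using Finset.induction_on with
    | empty => simp
    | insert i s hi ih =>
      intro y
      rw [Finset.sum_insert hi, ← add_assoc, ih, step]
  have := hsum Finset.univ (fun i => b.repr (y - y') i) y'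
  rw [b.sum_repr] at this
  rw [← this]
  congr 1
  abel

/-- Local boundedness and a bound on second differences imply continuity. -/
theorem continuousAt_of_second_difference {f : E → ℝ} {y₀ : E} {r B C : ℝ} (hr : 0 < r)
    (hB : ∀ e, ‖e‖ < r → |f (y₀ + e) - f y₀| ≤ B) (hC : 0 ≤ C)
    (hd : ∀ e, ‖e‖ < r → |f (y₀ + (2 : ℝ) • e) + f y₀ - 2 * f (y₀ + e)| ≤ C * ‖e‖) :
    ContinuousAt f y₀ := by
  have hB0 : 0 ≤ B := (abs_nonneg _).trans (hB 0 (by simpa using hr))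
  have ind : ∀ k : ℕ, ∀ e, ‖e‖ < r / 2 ^ k → |f (y₀ + e) - f y₀| ≤ B / 2 ^ k + k * C * ‖e‖ := by
    intro k
    induction k with
    | zero =>
      intro e he
      simpa using hB e (by simpa using he)
    | succ k ih =>
      intro e he
      have he2 : ‖(2 : ℝ) • e‖ < r / 2 ^ k := by
        rw [norm_smul, Real.norm_eq_abs, abs_two]
        calc 2 * ‖e‖ < 2 * (r / 2 ^ (k + 1)) := by linarith
          _ = r / 2 ^ k := by
            rw [pow_succ]
            field_simp
      have h1 := ih _ he2
      have her : ‖e‖ < r := he.trans_le (div_le_self hr.le (one_le_pow₀ (by norm_num)))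
      have h2 := hd e her
      rw [norm_smul, Real.norm_eq_abs, abs_two] at h1
      have h3 : B / 2 ^ (k + 1) = B / 2 ^ k / 2 := by
        rw [pow_succ]
        field_simp
      rw [h3]
      push_cast
      rw [abs_le] at *
      constructor <;> nlinarith [mul_nonneg hC (norm_nonneg e)]
  rw [Metric.continuousAt_iff]
  intro ε hε
  obtain ⟨k, hk⟩ : ∃ k : ℕ, B / 2 ^ k < ε / 2 := by
    have : Tendsto (fun k : ℕ => B / 2 ^ k) atTop (𝓝 0) :=
      tendsto_const_nhds.div_atTop (tendsto_pow_atTop_atTop_of_one_lt (by norm_num))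
    exact (this.eventually (gt_mem_nhds (by linarith))).exists
  refine ⟨min (r / 2 ^ k) (ε / (2 * (k * C + 1))), by positivity, fun {x} hx => ?_⟩
  rw [dist_eq_norm] at hx
  have h1 := ind k (x - y₀) (hx.trans_le (min_le_left _ _))
  have h2 := hx.trans_le (min_le_right _ _)
  rw [add_sub_cancel] at h1
  rw [lt_div_iff₀ (by positivity)] at h2
  rw [Real.dist_eq]
  nlinarith [norm_nonneg (x - y₀)]

/-- The properties of limits of rescaled solutions: `v` is the limit, `M` its second
differential. -/
structure IsLimitPair (b : OrthonormalBasis ι ℝ E) (ν γ K : ℝ) (Ω : Set E) (v : ℝ → E → ℝ)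
    (M : ℝ → E → E →L[ℝ] E →L[ℝ] ℝ) : Prop where
  symm : ∀ τ ≤ 0, ∀ y ∈ Ω, ∀ e f, M τ y e f = M τ y f e
  bound : ∀ τ ≤ 0, ∀ y ∈ Ω, ‖M τ y‖ ≤ K * (‖y‖ ^ γ + |τ| ^ (γ / 2))
  space : ∀ τ ≤ 0, ∀ y ∈ Ω, ∀ e, y + e ∈ Ω → y - e ∈ Ω →
    |v τ (y + e) + v τ (y - e) - 2 * v τ y - M τ y e e| ≤ K * ‖e‖ ^ (2 + γ)
  time : ∀ τ ≤ 0, ∀ σ ≥ 0, ∀ y ∈ Ω,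
    |v τ y - v (τ - σ) y - σ * (ν * ∑ i, M τ y (b i) (b i))| ≤ K * σ ^ (1 + γ / 2)
  init : ∀ y ∈ Ω, |v 0 y| ≤ K * ‖y‖ ^ (2 + γ)

namespace IsLimitPair
variable {b : OrthonormalBasis ι ℝ E} {ν γ K : ℝ} {Ω : Set E} {v : ℝ → E → ℝ}
    {M : ℝ → E → E →L[ℝ] E →L[ℝ] ℝ}

theorem quad_le (h : IsLimitPair b ν γ K Ω v M) {τ : ℝ} (hτ : τ ≤ 0) {y : E} (hy : y ∈ Ω) (e : E) :
    |M τ y e e| ≤ K * (‖y‖ ^ γ + |τ| ^ (γ / 2)) * ‖e‖ ^ 2 := by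
  calc |M τ y e e| ≤ ‖M τ y‖ * ‖e‖ * ‖e‖ := (M τ y).le_opNorm₂ e e
    _ ≤ K * (‖y‖ ^ γ + |τ| ^ (γ / 2)) * ‖e‖ * ‖e‖ := by
      gcongr
      exact h.bound τ hτ y hy
    _ = _ := by ring

theorem trace_le (h : IsLimitPair b ν γ K Ω v M) {τ : ℝ} (hτ : τ ≤ 0) {y : E} (hy : y ∈ Ω) :
    |∑ i, M τ y (b i) (b i)| ≤ Fintype.card ι * (K * (‖y‖ ^ γ + |τ| ^ (γ / 2))) := by
  refine (Finset.abs_sum_le_sum_abs _ _).trans ?_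
  refine (Finset.sum_le_card_nsmul _ _ (K * (‖y‖ ^ γ + |τ| ^ (γ / 2))) fun i _ => ?_).trans ?_
  · simpa [b.norm_eq_one] using h.quad_le hτ hy (b i)
  · simp

theorem calAt (h : IsLimitPair b ν γ K Ω v M) (hΩ : IsOpen Ω) (hγ : 0 < γ) {τ : ℝ} (hτ : τ ≤ 0)
    {y : E} (hy : y ∈ Ω) : CalAt b ν v τ y := by
  refine ⟨fun i => M τ y (b i) (b i), fun i => ?_, ?_⟩
  · have t1 : Tendsto (fun r : ℝ => K * r ^ γ) (𝓝[>] 0) (𝓝 0) := by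
      have : Tendsto (fun r : ℝ => K * r ^ γ) (𝓝 0) (𝓝 (K * 0 ^ γ)) :=
        ((Real.continuousAt_rpow_const 0 γ (Or.inr hγ.le)).tendsto).const_mul K
      rw [Real.zero_rpow hγ.ne', mul_zero] at this
      exact this.mono_left nhdsWithin_le_nhds
    rw [tendsto_iff_dist_tendsto_zero]
    refine squeeze_zero' (Eventually.of_forall fun _ => dist_nonneg) ?_ t1
    have e1 : ∀ᶠ r : ℝ in 𝓝[>] 0, y + r • b i ∈ Ω := by
      refine nhdsWithin_le_nhds ?_
      have : Continuous (fun h : ℝ => y + h • b i) := by fun_prop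
      exact this.tendsto 0 (by simpa using hΩ.mem_nhds hy)
    have e2 : ∀ᶠ r : ℝ in 𝓝[>] 0, y - r • b i ∈ Ω := by
      refine nhdsWithin_le_nhds ?_
      have : Continuous (fun h : ℝ => y - h • b i) := by fun_prop
      exact this.tendsto 0 (by simpa using hΩ.mem_nhds hy)
    filter_upwards [e1, e2, self_mem_nhdsWithin] with r h1 h2 hr
    have hr : 0 < r := hr
    have := h.space τ hτ y hy _ h1 h2
    simp only [map_smul, smul_apply, smul_eq_mul, norm_smul, b.norm_eq_one, mul_one,
      Real.norm_of_nonneg hr.le] at this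
    rw [Real.dist_eq]
    have e : (v τ (y + r • b i) + v τ (y - r • b i) - 2 * v τ y) / r ^ 2 - M τ y (b i) (b i) =
      (v τ (y + r • b i) + v τ (y - r • b i) - 2 * v τ y - r * (r * M τ y (b i) (b i))) / r ^ 2 := by
      field_simp
    rw [e, abs_div, abs_of_pos (by positivity : 0 < r ^ 2), div_le_iff₀ (by positivity)]
    refine this.trans (le_of_eq ?_)
    rw [Real.rpow_add hr]
    norm_num
    ring
  · have t1 : Tendsto (fun r : ℝ => K * r ^ (γ / 2)) (𝓝[>] 0) (𝓝 0) := by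
      have hγ2 : 0 < γ / 2 := by linarith
      have : Tendsto (fun r : ℝ => K * r ^ (γ / 2)) (𝓝 0) (𝓝 (K * 0 ^ (γ / 2))) :=
        ((Real.continuousAt_rpow_const 0 (γ / 2) (Or.inr hγ2.le)).tendsto).const_mul K
      rw [Real.zero_rpow hγ2.ne', mul_zero] at this
      exact this.mono_left nhdsWithin_le_nhds
    rw [tendsto_iff_dist_tendsto_zero]
    refine squeeze_zero' (Eventually.of_forall fun _ => dist_nonneg) ?_ t1
    filter_upwards [self_mem_nhdsWithin] with r hr
    have hr : 0 < r := hr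
    have := h.time τ hτ r hr.le y hy
    rw [Real.dist_eq]
    have e : (v τ y - v (τ - r) y) / r - ν * ∑ i, M τ y (b i) (b i) =
      (v τ y - v (τ - r) y - r * (ν * ∑ i, M τ y (b i) (b i))) / r := by
      field_simp
    rw [e, abs_div, abs_of_pos hr, div_le_iff₀ hr]
    refine this.trans (le_of_eq ?_)
    rw [Real.rpow_add hr, Real.rpow_one]
    ring

/-- Time oscillation. -/
theorem time_osc (h : IsLimitPair b ν γ K Ω v M) (hν : 0 ≤ ν) {τ : ℝ} (hτ : τ ≤ 0) {σ : ℝ}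
    (hσ : 0 ≤ σ) {y : E} (hy : y ∈ Ω) :
    |v τ y - v (τ - σ) y| ≤ σ * (ν * (Fintype.card ι * (K * (‖y‖ ^ γ + |τ| ^ (γ / 2))))) +
      K * σ ^ (1 + γ / 2) := by
  have h1 := h.time τ hτ σ hσ y hy
  have h2 := h.trace_le hτ hy
  have h3 : |σ * (ν * ∑ i, M τ y (b i) (b i))| ≤
      σ * (ν * (Fintype.card ι * (K * (‖y‖ ^ γ + |τ| ^ (γ / 2))))) := by
    rw [abs_mul, abs_mul, abs_of_nonneg hσ, abs_of_nonneg hν]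
    gcongr
  have := abs_add_le (v τ y - v (τ - σ) y - σ * (ν * ∑ i, M τ y (b i) (b i)))
    (σ * (ν * ∑ i, M τ y (b i) (b i)))
  rw [sub_add_cancel] at this
  linarith

theorem abs_le_of_bounds (h : IsLimitPair b ν γ K Ω v M) (hν : 0 ≤ ν) (hγ : 0 < γ) (hK : 0 ≤ K)
    {R : ℝ} {τ : ℝ} (hτ : τ ≤ 0) (hτR : -R ≤ τ) {y : E} (hy : y ∈ Ω) (hyR : ‖y‖ ≤ R) :
    |v τ y| ≤
      K * R ^ (2 + γ) + (R * (ν * (Fintype.card ι * (K * R ^ γ))) + K * R ^ (1 + γ / 2)) := by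
  have hR : 0 ≤ R := (norm_nonneg _).trans hyR
  have h1 := h.init y hy
  have h2 := h.time_osc hν le_rfl (σ := -τ) (by linarith) hy
  rw [zero_sub, neg_neg, abs_zero, Real.zero_rpow (by linarith), add_zero] at h2
  have h3 : |v τ y| ≤ |v 0 y| + |v 0 y - v τ y| := by
    have := abs_sub (v 0 y) (v 0 y - v τ y)
    rwa [sub_sub_cancel] at this
  have hτ' : -τ ≤ R := by linarith
  have hτ0 : 0 ≤ -τ := by linarith
  refine h3.trans (add_le_add (h1.trans ?_) (h2.trans ?_))
  · gcongr
  · gcongr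

theorem continuousAt_space (h : IsLimitPair b ν γ K Ω v M) (hΩ : IsOpen Ω) (hν : 0 ≤ ν)
    (hγ : 0 < γ) (hK : 0 ≤ K) {τ : ℝ} (hτ : τ ≤ 0) {y : E} (hy : y ∈ Ω) :
    ContinuousAt (v τ) y := by
  obtain ⟨r, hr, hball⟩ := Metric.isOpen_iff.1 hΩ y hy
  set R := ‖y‖ + r + |τ| with hR
  have hRτ : -R ≤ τ := by
    have := neg_abs_le τ
    have := norm_nonneg y
    linarith
  have hin : ∀ e : E, ‖e‖ < r → y + e ∈ Ω := fun e he => hball (by simpa using he)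
  have hnR : ∀ e : E, ‖e‖ < r → ‖y + e‖ ≤ R := fun e he => by
    have := norm_add_le y e
    have := abs_nonneg τ
    linarith
  set B := K * R ^ (2 + γ) + (R * (ν * (Fintype.card ι * (K * R ^ γ))) + K * R ^ (1 + γ / 2))
  have hb : ∀ e : E, ‖e‖ < r → |v τ (y + e)| ≤ B := fun e he =>
    h.abs_le_of_bounds hν hγ hK hτ hRτ (hin e he) (hnR e he)
  have hb0 : |v τ y| ≤ B := by simpa using hb 0 (by simpa using hr)
  have hR0 : 0 ≤ R := by positivity
  refine continuousAt_of_second_difference (r := r / 2) (B := B + B)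
    (C := K * (R ^ γ + |τ| ^ (γ / 2)) * r + K * r ^ (1 + γ)) (by linarith) ?_ (by positivity) ?_
  · intro e he
    exact (abs_sub _ _).trans (add_le_add (hb e (by linarith)) hb0)
  · intro e he
    have h2e : ‖(2 : ℝ) • e‖ < r := by
      rw [norm_smul, Real.norm_eq_abs, abs_two]
      linarith
    have her : ‖e‖ < r := by linarith
    have e1 : y + e + e = y + (2 : ℝ) • e := by module
    have e2 : y + e - e = y := by module
    have h1 := h.space τ hτ (y + e) (hin e her) e (by rw [e1]; exact hin _ h2e) (by rwa [e2])
    rw [e1, e2] at h1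
    have h2 := h.quad_le hτ (hin e her) e
    have h3 := abs_add_le (v τ (y + (2 : ℝ) • e) + v τ y - 2 * v τ (y + e) - M τ (y + e) e e)
      (M τ (y + e) e e)
    rw [sub_add_cancel] at h3
    have h4 : K * (‖y + e‖ ^ γ + |τ| ^ (γ / 2)) * ‖e‖ ^ 2 ≤
        K * (R ^ γ + |τ| ^ (γ / 2)) * r * ‖e‖ := by
      rw [pow_two, ← mul_assoc]
      gcongr
      exact hnR e her
    have h5 : K * ‖e‖ ^ (2 + γ) ≤ K * r ^ (1 + γ) * ‖e‖ := by
      rw [show 2 + γ = (1 + γ) + 1 by ring, Real.rpow_add_one' (norm_nonneg _) (by linarith),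
        ← mul_assoc]
      gcongr
    linarith

theorem continuousWithinAt (h : IsLimitPair b ν γ K Ω v M) (hΩ : IsOpen Ω) (hν : 0 ≤ ν)
    (hγ : 0 < γ) (hK : 0 ≤ K) {τ : ℝ} (hτ : τ ≤ 0) {y : E} (hy : y ∈ Ω) :
    ContinuousWithinAt (fun p : ℝ × E => v p.1 p.2) (Iic 0 ×ˢ Ω) (τ, y) := by
  set R := ‖y‖ + 1 + |τ| with hR
  set L : ℝ → ℝ := fun σ => σ * (ν * (Fintype.card ι * (K * (R ^ γ + (R + 1) ^ (γ / 2))))) +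
      K * σ ^ (1 + γ / 2) with hL
  have hR0 : 0 ≤ R := by positivity
  have t1 : Tendsto (fun p : ℝ × E => L |p.1 - τ| + dist (v τ p.2) (v τ y)) (𝓝 (τ, y))
      (𝓝 0) := by
    have c1 : Continuous L := by
      refine (by fun_prop : Continuous _).add (continuous_const.mul ?_)
      exact Real.continuous_rpow_const (by linarith)
    have c2 : Tendsto (fun p : ℝ × E => L |p.1 - τ|) (𝓝 (τ, y)) (𝓝 0) := by
      have : Continuous (fun p : ℝ × E => L |p.1 - τ|) := c1.comp (by fun_prop)
      have := this.tendsto (τ, y)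
      have hz : L 0 = 0 := by simp [hL, Real.zero_rpow (by linarith : 1 + γ / 2 ≠ 0)]
      simpa [hz] using this
    have c3 : Tendsto (fun p : ℝ × E => dist (v τ p.2) (v τ y)) (𝓝 (τ, y)) (𝓝 0) := by
      have := (h.continuousAt_space hΩ hν hγ hK hτ hy).comp (f := fun p : ℝ × E => p.2)
        (x := (τ, y)) continuousAt_snd
      rw [ContinuousAt, tendsto_iff_dist_tendsto_zero] at this
      exact this
    simpa using c2.add c3
  rw [ContinuousWithinAt, tendsto_iff_dist_tendsto_zero]
  refine squeeze_zero' (Eventually.of_forall fun _ => dist_nonneg) ?_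
    (t1.mono_left nhdsWithin_le_nhds)
  have e1 : ∀ᶠ p : ℝ × E in 𝓝 (τ, y), dist p (τ, y) < 1 := Metric.ball_mem_nhds _ one_pos
  filter_upwards [nhdsWithin_le_nhds e1, self_mem_nhdsWithin] with p hp1 hp2
  obtain ⟨t, x⟩ := p
  obtain ⟨ht, hx⟩ := hp2
  simp only [mem_Iic] at ht hx
  rw [Prod.dist_eq, max_lt_iff, Real.dist_eq, dist_eq_norm] at hp1
  have hxR : ‖x‖ ≤ R := by
    have := norm_add_le y (x - y)
    rw [add_sub_cancel] at this
    have := abs_nonneg τ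
    have := hp1.2
    simp only at this
    linarith
  have htR : |t| ≤ R + 1 := by
    have := abs_add_le τ (t - τ)
    rw [add_sub_cancel] at this
    have := hp1.1
    simp only at this
    have := norm_nonneg y
    linarith
  have hτR : |τ| ≤ R + 1 := by
    have := norm_nonneg y
    linarith
  refine (dist_triangle _ (v τ x) _).trans ?_
  refine add_le_add ?_ le_rfl
  rw [Real.dist_eq]
  have aux : ∀ t1 ≤ 0, ∀ t2 ≤ t1, |t1| ≤ R + 1 → |v t1 x - v t2 x| ≤ L (t1 - t2) := by
    intro t1 h1 t2 h2 h3
    have := h.time_osc hν h1 (σ := t1 - t2) (by linarith) hx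
    rw [sub_sub_cancel] at this
    refine this.trans ?_
    have : 0 ≤ t1 - t2 := by linarith
    simp only [hL]
    gcongr
  rcases le_total t τ with hle | hle
  · have := aux τ hτ t hle hτR
    rw [abs_sub_comm] at this
    rwa [abs_of_nonpos (by simpa using hle : t - τ ≤ 0), neg_sub]
  · have := aux t ht τ hle htR
    rwa [abs_of_nonneg (by simpa using hle : 0 ≤ t - τ)]

end IsLimitPair
end
end

section

section
variable {E ι : Type*} [NormedAddCommGroup E] [InnerProductSpace ℝ E] [Fintype ι]

theorem bilin_self_eq_zero {B : E →L[ℝ] E →L[ℝ] ℝ} {e : E} {γ C ε₀ : ℝ} (hγ : 0 < γ) (hε₀ : 0 < ε₀)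
    (h : ∀ ε : ℝ, 0 < ε → ε < ε₀ → |B (ε • e) (ε • e)| ≤ C * ε ^ (2 + γ)) : B e e = 0 := by
  have hev : ∀ᶠ ε : ℝ in 𝓝[>] 0, |B e e| ≤ C * ε ^ γ := by
    filter_upwards [self_mem_nhdsWithin, nhdsWithin_le_nhds (gt_mem_nhds hε₀)] with ε h0 h1
    have h0 : 0 < ε := h0
    have := h ε h0 h1
    simp only [map_smul, smul_apply, smul_eq_mul, abs_mul, abs_of_pos h0] at this
    rw [Real.rpow_add h0, Real.rpow_two] at this
    have h2 : ε ^ 2 * |B e e| ≤ ε ^ 2 * (C * ε ^ γ) := by linarith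
    exact le_of_mul_le_mul_left h2 (by positivity)
  have t1 : Tendsto (fun r : ℝ => C * r ^ γ) (𝓝[>] 0) (𝓝 0) := by
    have : Tendsto (fun r : ℝ => C * r ^ γ) (𝓝 0) (𝓝 (C * 0 ^ γ)) :=
      ((Real.continuousAt_rpow_const 0 γ (Or.inr hγ.le)).tendsto).const_mul C
    rw [Real.zero_rpow hγ.ne', mul_zero] at this
    exact this.mono_left nhdsWithin_le_nhds
  exact abs_nonpos_iff.1 (ge_of_tendsto t1 hev)

theorem eq_zero_of_quadratic {B : E →L[ℝ] E →L[ℝ] ℝ} (hB : ∀ v w, B v w = B w v)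
    (hq : ∀ e, B e e = 0) : B = 0 := by
  have := opNorm_le_of_quadratic hB le_rfl (fun w => by simp [hq w])
  simpa using this

namespace IsLimitPair
variable {b : OrthonormalBasis ι ℝ E} {ν γ K : ℝ} {Ω : Set E} {v : ℝ → E → ℝ}
    {M : ℝ → E → E →L[ℝ] E →L[ℝ] ℝ}

theorem calAt_second_difference (h : IsLimitPair b ν γ K Ω v M) (hΩ : IsOpen Ω) (hγ : 0 < γ)
    {τ : ℝ} (hτ : τ ≤ 0) {x e : E} (hx : x ∈ Ω) (h1 : x + e ∈ Ω) (h2 : x - e ∈ Ω) :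
    CalAt b ν (fun t x => v t (x + e) + v t (x - e) - 2 * v t x) τ x := by
  have c0 := h.calAt hΩ hγ hτ hx
  have c1 : CalAt b ν (fun t x => v t (x + e)) τ x := by
    have := CalAt.translate (b := b) (ν := ν) (w := v) (τ := τ) (y := x) (σ := 0) (a := e)
          (h.calAt hΩ hγ (by simpa using hτ) h1)
    simpa only [add_zero] using this
  have c2 : CalAt b ν (fun t x => v t (x - e)) τ x := by
    have := CalAt.translate (b := b) (ν := ν) (w := v) (τ := τ) (y := x) (σ := 0) (a := -e)
          (h.calAt hΩ hγ (by simpa using hτ) (by rwa [← sub_eq_add_neg]))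
    simpa only [add_zero, ← sub_eq_add_neg] using this
  have := (c1.add c2).sub (c0.add c0)
  simpa only [← two_mul] using this

theorem calAt_time_difference (h : IsLimitPair b ν γ K Ω v M) (hΩ : IsOpen Ω) (hγ : 0 < γ)
    {τ σ : ℝ} (hτ : τ ≤ 0) (hσ : 0 ≤ σ) {x : E} (hx : x ∈ Ω) :
    CalAt b ν (fun t x => v t x - v (t - σ) x) τ x := by
  have c0 := h.calAt hΩ hγ hτ hx
  have c1 : CalAt b ν (fun t x => v (t - σ) x) τ x := by
    have := CalAt.translate (b := b) (ν := ν) (w := v) (τ := τ) (y := x) (σ := -σ) (a := 0)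
          (h.calAt hΩ hγ (by linarith) (by simpa using hx))
    simpa only [add_zero, ← sub_eq_add_neg] using this
  exact c0.sub c1

theorem second_difference_le (h : IsLimitPair b ν γ K Ω v M) (hK : 0 ≤ K)
    {τ : ℝ} (hτ : τ ≤ 0) {x e : E} (hx : x ∈ Ω) (h1 : x + e ∈ Ω) (h2 : x - e ∈ Ω) :
    |v τ (x + e) + v τ (x - e) - 2 * v τ x| ≤
      K * (‖e‖ ^ 2 + ‖e‖ ^ (2 + γ)) * (1 + ‖x‖ ^ γ + |τ| ^ (γ / 2)) := by
  have a1 := h.space τ hτ x hx e h1 h2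
  have a2 := h.quad_le hτ hx e
  have a3 := abs_add_le (v τ (x + e) + v τ (x - e) - 2 * v τ x - M τ x e e) (M τ x e e)
  rw [sub_add_cancel] at a3
  have p1 : 0 ≤ ‖x‖ ^ γ := by positivity
  have p2 : 0 ≤ |τ| ^ (γ / 2) := by positivity
  have p3 : 0 ≤ ‖e‖ ^ (2 + γ) := by positivity
  have : K * ‖e‖ ^ (2 + γ) + K * (‖x‖ ^ γ + |τ| ^ (γ / 2)) * ‖e‖ ^ 2 ≤
      K * (‖e‖ ^ 2 + ‖e‖ ^ (2 + γ)) * (1 + ‖x‖ ^ γ + |τ| ^ (γ / 2)) := by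
    have e1 : K * (‖e‖ ^ 2 + ‖e‖ ^ (2 + γ)) * (1 + ‖x‖ ^ γ + |τ| ^ (γ / 2)) -
      (K * ‖e‖ ^ (2 + γ) + K * (‖x‖ ^ γ + |τ| ^ (γ / 2)) * ‖e‖ ^ 2) =
      K * (‖e‖ ^ 2 + ‖e‖ ^ (2 + γ) * (‖x‖ ^ γ + |τ| ^ (γ / 2))) := by ring
    have e2 : 0 ≤ K * (‖e‖ ^ 2 + ‖e‖ ^ (2 + γ) * (‖x‖ ^ γ + |τ| ^ (γ / 2))) := by positivity
    linarith
  linarith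

theorem time_difference_le (h : IsLimitPair b ν γ K Ω v M) (hν : 0 ≤ ν) (hK : 0 ≤ K)
    {τ σ : ℝ} (hτ : τ ≤ 0) (hσ : 0 ≤ σ) {x : E} (hx : x ∈ Ω) :
    |v τ x - v (τ - σ) x| ≤ (σ * (ν * (Fintype.card ι * K)) + K * σ ^ (1 + γ / 2)) *
      (1 + ‖x‖ ^ γ + |τ| ^ (γ / 2)) := by
  refine (h.time_osc hν hτ hσ hx).trans ?_
  have p1 : 0 ≤ ‖x‖ ^ γ := by positivity
  have p2 : 0 ≤ |τ| ^ (γ / 2) := by positivity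
  have p3 : 0 ≤ σ ^ (1 + γ / 2) := by positivity
  have e1 : (σ * (ν * (Fintype.card ι * K)) + K * σ ^ (1 + γ / 2)) *
      (1 + ‖x‖ ^ γ + |τ| ^ (γ / 2)) - (σ * (ν * (Fintype.card ι * (K * (‖x‖ ^ γ + |τ| ^ (γ / 2)))))
      + K * σ ^ (1 + γ / 2)) = σ * (ν * (Fintype.card ι * K)) +
        K * σ ^ (1 + γ / 2) * (‖x‖ ^ γ + |τ| ^ (γ / 2)) := by ring
  have e2 : 0 ≤ σ * (ν * (Fintype.card ι * K)) +
        K * σ ^ (1 + γ / 2) * (‖x‖ ^ γ + |τ| ^ (γ / 2)) := by positivity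
  linarith

/-- Liouville theorem for limit pairs on the whole space. -/
theorem eq_zero_univ [FiniteDimensional ℝ E] (h : IsLimitPair b ν γ K univ v M) (hν : 0 < ν)
    (hγ : γ ∈ Ioo (0 : ℝ) 1) (hK : 0 ≤ K) {τ : ℝ} (hτ : τ ≤ 0) (y : E) : M τ y = 0 := by
  refine eq_zero_of_quadratic (h.symm τ hτ y trivial) fun e => ?_
  have hcont : ContinuousOn (fun p : ℝ × E => v p.1 p.2) (Iic 0 ×ˢ univ) := fun p hp =>
    h.continuousWithinAt isOpen_univ hν.le hγ.1 hK hp.1 (mem_univ p.2)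
  have hcomp : ∀ (σ : ℝ) (a : E), 0 ≤ σ →
      ContinuousOn (fun p : ℝ × E => v (p.1 - σ) (p.2 + a)) (Iic 0 ×ˢ univ) := by
    intro σ a hσ
    have c1 : Continuous (fun p : ℝ × E => (p.1 - σ, p.2 + a)) := by fun_prop
    refine hcont.comp c1.continuousOn fun p hp => ⟨?_, mem_univ _⟩
    have : p.1 ≤ 0 := hp.1
    simp only [mem_Iic]
    linarith
  have hspace : ∀ t ≤ 0, ∀ (a x : E), v t (x + a) + v t (x - a) - 2 * v t x =
      v t (0 + a) + v t (0 - a) - 2 * v t 0 := by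
    intro t ht a x
    refine eq_of_calAt_univ (b := b) (w := fun t x => v t (x + a) + v t (x - a) - 2 * v t x)
      hν hγ (K := K * (‖a‖ ^ 2 + ‖a‖ ^ (2 + γ))) (by positivity) ?_ ?_ ?_ ht x 0
    · have c0 := hcomp 0 0 le_rfl
      have c1 := hcomp 0 a le_rfl
      have c2 := hcomp 0 (-a) le_rfl
      simp only [sub_zero, add_zero, ← sub_eq_add_neg] at c0 c1 c2
      exact (c1.add c2).sub (c0.const_mul 2)
    · exact fun t ht x => h.second_difference_le hK ht trivial trivial trivial
    · exact fun t ht x => h.calAt_second_difference isOpen_univ hγ.1 ht trivial trivial trivial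
  have htime : ∀ x x' : E, v 0 x - v τ x = v 0 x' - v τ x' := by
    intro x x'
    have := eq_of_calAt_univ (b := b) (w := fun t x => v t x - v (t - (-τ)) x) hν hγ
      (K := (-τ) * (ν * (Fintype.card ι * K)) + K * (-τ) ^ (1 + γ / 2)) ?_ ?_ ?_ ?_ le_rfl x x'
    · simpa using this
    · have : 0 ≤ -τ := by linarith
      positivity
    · have c0 := hcomp 0 0 le_rfl
      have c1 := hcomp (-τ) 0 (by linarith)
      simp only [sub_zero, add_zero] at c0 c1
      exact c0.sub c1
    · exact fun t ht x => h.time_difference_le hν.le hK ht (by linarith) trivial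
    · exact fun t ht x => h.calAt_time_difference isOpen_univ hγ.1 ht (by linarith) trivial
  have hv0 : v 0 0 = 0 := by
    have := h.init 0 trivial
    rw [norm_zero, Real.zero_rpow (by linarith [hγ.1]), mul_zero] at this
    exact abs_nonpos_iff.1 this
  refine bilin_self_eq_zero (γ := γ) (C := 3 * K * ‖e‖ ^ (2 + γ)) hγ.1 one_pos fun ε hε _ => ?_
  have a1 := h.space τ hτ y trivial (ε • e) trivial trivial
  have a2 := hspace 0 le_rfl (ε • e) y
  have a3 := htime (y + ε • e) y
  have a4 := htime (y - ε • e) y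
  have a5 := h.init (ε • e) trivial
  have a6 := h.init (-(ε • e)) trivial
  rw [zero_add, zero_sub, hv0] at a2
  rw [norm_neg] at a6
  have a7 : ‖ε • e‖ ^ (2 + γ) = ε ^ (2 + γ) * ‖e‖ ^ (2 + γ) := by
    rw [norm_smul, Real.norm_of_nonneg hε.le, Real.mul_rpow hε.le (norm_nonneg _)]
  rw [a7] at a1 a5 a6
  rw [abs_le] at *
  constructor <;> linarith

/-- Zero extension of a limit pair on the half space. -/
theorem zeroExtend {n : E} (h : IsLimitPair b ν γ K {y | 0 < inner ℝ n y} v M) :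
    IsLimitPair b ν γ K {y | 0 < inner ℝ n y}
      (fun t x => if 0 < inner ℝ n x then v t x else 0) M := by
  refine ⟨h.symm, h.bound, ?_, ?_, ?_⟩
  · intro τ hτ y hy e h1 h2
    have hy' : 0 < inner ℝ n y := hy
    have h1' : 0 < inner ℝ n (y + e) := h1
    have h2' : 0 < inner ℝ n (y - e) := h2
    simp only [hy', h1', h2', if_true]
    exact h.space τ hτ y hy e h1 h2
  · intro τ hτ σ hσ y hy
    have hy' : 0 < inner ℝ n y := hy
    simp only [hy', if_true]
    exact h.time τ hτ σ hσ y hy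
  · intro y hy
    have hy' : 0 < inner ℝ n y := hy
    simp only [hy', if_true]
    exact h.init y hy

/-- Functions with `o(ε²)` second differences at all scales are midpoint affine. -/
theorem _root_.second_difference_eq_zero {g : ℝ → ℝ} {γ C : ℝ} (hγ : 0 < γ)
    (hg : ∀ t ε, 0 < ε → ε < t → |g (t + ε) + g (t - ε) - 2 * g t| ≤ C * ε ^ (2 + γ)) {t ε : ℝ}
    (hε : 0 < ε) (ht : ε < t) : g (t + ε) + g (t - ε) - 2 * g t = 0 := by
  have ind : ∀ k : ℕ, ∀ t ε, 0 < ε → ε < t →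
      |g (t + ε) + g (t - ε) - 2 * g t| ≤ C * ε ^ (2 + γ) * ((1 / 2) ^ γ) ^ k := by
    intro k
    induction k with
    | zero => simpa using hg
    | succ k ih =>
      intro t ε hε ht
      have i1 := ih t (ε / 2) (by linarith) (by linarith)
      have i2 := ih (t + ε / 2) (ε / 2) (by linarith) (by linarith)
      have i3 := ih (t - ε / 2) (ε / 2) (by linarith) (by linarith)
      rw [show t + ε / 2 + ε / 2 = t + ε by ring, show t + ε / 2 - ε / 2 = t by ring] at i2
      rw [show t - ε / 2 + ε / 2 = t by ring, show t - ε / 2 - ε / 2 = t - ε by ring] at i3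
      have e : C * ε ^ (2 + γ) * ((1 / 2) ^ γ) ^ (k + 1) =
          4 * (C * (ε / 2) ^ (2 + γ) * ((1 / 2) ^ γ) ^ k) := by
        rw [show ε / 2 = ε * (1 / 2) by ring, Real.mul_rpow hε.le (by norm_num),
          Real.rpow_add (by norm_num : (0 : ℝ) < 1 / 2), pow_succ]
        norm_num
        ring
      rw [e]
      rw [abs_le] at *
      constructor <;> linarith
  have hlim : Tendsto (fun k : ℕ => C * ε ^ (2 + γ) * ((1 / 2) ^ γ) ^ k) atTop
      (𝓝 (C * ε ^ (2 + γ) * 0)) :=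
    (tendsto_pow_atTop_nhds_zero_of_lt_one (by positivity)
      (Real.rpow_lt_one (by norm_num) (by norm_num) hγ)).const_mul _
  rw [mul_zero] at hlim
  exact abs_nonpos_iff.1 (ge_of_tendsto' hlim fun k => ind k t ε hε ht)

end IsLimitPair
end
end

section

section
variable {E ι : Type*} [NormedAddCommGroup E] [InnerProductSpace ℝ E] [Fintype ι]
namespace IsLimitPair
variable {b : OrthonormalBasis ι ℝ E} {ν γ K : ℝ} {v : ℝ → E → ℝ}
    {M : ℝ → E → E →L[ℝ] E →L[ℝ] ℝ} {n : E}

theorem continuousOn_halfSpace (h : IsLimitPair b ν γ K {y | 0 < inner ℝ n y} v M)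
    (hν : 0 ≤ ν) (hγ : 0 < γ) (hK : 0 ≤ K)
    (hbd : ∀ R, ∃ C, ∀ τ ∈ Icc (-R) 0, ∀ y, 0 < inner ℝ n y → ‖y‖ ≤ R →
      |v τ y| ≤ C * inner ℝ n y)
    (hz : ∀ τ y, ¬ 0 < inner ℝ n y → v τ y = 0) :
    ContinuousOn (fun p : ℝ × E => v p.1 p.2) (Iic 0 ×ˢ {y | 0 ≤ inner ℝ n y}) := by
  have hopen : IsOpen {y : E | 0 < inner ℝ n y} := isOpen_lt continuous_const (by fun_prop)
  rintro ⟨τ, y⟩ ⟨hτ, hy⟩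
  simp only [mem_Iic, mem_ofPred_eq] at hτ hy
  rcases hy.eq_or_lt with hy0 | hy0
  · have hzy : v τ y = 0 := hz τ y (by simp [← hy0])
    set R := max |τ| ‖y‖ + 1 with hR
    obtain ⟨C, hC⟩ := hbd R
    have t1 : Tendsto (fun p : ℝ × E => C * inner ℝ n p.2) (𝓝 (τ, y)) (𝓝 0) := by
      have : Continuous (fun p : ℝ × E => C * inner ℝ n p.2) := by fun_prop
      have := this.tendsto (τ, y)
      simpa [← hy0] using this
    rw [ContinuousWithinAt, tendsto_iff_dist_tendsto_zero]
    refine squeeze_zero' (Eventually.of_forall fun _ => dist_nonneg) ?_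
      (t1.mono_left nhdsWithin_le_nhds)
    have o1 : ∀ᶠ p : ℝ × E in 𝓝 (τ, y), -R < p.1 := by
      have : Tendsto (fun p : ℝ × E => p.1) (𝓝 (τ, y)) (𝓝 τ) := continuousAt_fst
      refine this.eventually (lt_mem_nhds ?_)
      have := neg_abs_le τ
      have := le_max_left |τ| ‖y‖
      linarith
    have o2 : ∀ᶠ p : ℝ × E in 𝓝 (τ, y), ‖p.2‖ < R := by
      have : Tendsto (fun p : ℝ × E => ‖p.2‖) (𝓝 (τ, y)) (𝓝 ‖y‖) := continuousAt_snd.norm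
      refine this.eventually (gt_mem_nhds ?_)
      have := le_max_right |τ| ‖y‖
      linarith
    filter_upwards [nhdsWithin_le_nhds o1, nhdsWithin_le_nhds o2, self_mem_nhdsWithin]
      with p h1 h2 h3
    obtain ⟨t, x⟩ := p
    obtain ⟨ht, hx⟩ := h3
    simp only [mem_Iic, mem_ofPred_eq] at ht hx
    rw [hzy, Real.dist_eq, sub_zero]
    rcases hx.eq_or_lt with hx0 | hx0
    · rw [hz t x (by simp [← hx0]), ← hx0]
      simp
    · exact hC t ⟨h1.le, ht⟩ x hx0 h2.le
  · refine (h.continuousWithinAt hopen hν hγ hK hτ hy0).mono_of_mem_nhdsWithin ?_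
    have o1 : ∀ᶠ p : ℝ × E in 𝓝 (τ, y), 0 < inner ℝ n p.2 := by
      have : Tendsto (fun p : ℝ × E => p.2) (𝓝 (τ, y)) (𝓝 y) := continuousAt_snd
      exact this.eventually (hopen.mem_nhds hy0)
    filter_upwards [nhdsWithin_le_nhds o1, self_mem_nhdsWithin] with p h1 h2
    exact ⟨h2.1, h1⟩

theorem quad_eq_zero_of_affine (h : IsLimitPair b ν γ K {y | 0 < inner ℝ n y} v M)
    (hn : ‖n‖ = 1) (hγ : 0 < γ)
    (htime : ∀ t ≤ 0, ∀ x, 0 < inner ℝ n x → v t x = v 0 x)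
    (htan : ∀ a x, inner ℝ n a = 0 → 0 < inner ℝ n x →
      v 0 (x + a) + v 0 (x - a) - 2 * v 0 x = 0)
    (hnor : ∀ x (ε : ℝ), |ε| < inner ℝ n x → v 0 (x + ε • n) + v 0 (x - ε • n) - 2 * v 0 x = 0)
    {τ : ℝ} (hτ : τ ≤ 0) {y : E} (hy : 0 < inner ℝ n y) {a : E} (ha : inner ℝ n a = 0) :
    M τ y (n + a) (n + a) = 0 := by
  have hnn : inner ℝ n n = (1 : ℝ) := by rw [real_inner_self_eq_norm_sq, hn]; norm_num
  set s : ℝ := inner ℝ n y with hs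
  refine bilin_self_eq_zero (γ := γ) (C := K * ‖n + a‖ ^ (2 + γ) + (K * ‖a + (2 : ℝ) • n‖ ^ (2 + γ) +
    K * ‖a + n‖ ^ (2 + γ) + K * ‖-a + (2 : ℝ) • n‖ ^ (2 + γ) + K * ‖-a + n‖ ^ (2 + γ)))
    hγ hy fun ε hε hεs => ?_
  have hin : ∀ (x : E) (c : ℝ) (a' : E), inner ℝ n a' = 0 → inner ℝ n (x + a' + c • n) =
      inner ℝ n x + c := by
    intro x c a' ha'
    rw [inner_add_right, inner_add_right, inner_smul_right, hnn, ha']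
    ring
  set D : E → ℝ := fun x => v 0 (x + ε • n) - v 0 x with hD
  -- `D` is invariant along `n`
  have hDn : ∀ x (t : ℝ), 0 < inner ℝ n x → 0 ≤ t → D (x + t • n) = D x := by
    intro x t hx ht
    have hm : inner ℝ n (x + ((ε + t) / 2) • n) = inner ℝ n x + (ε + t) / 2 := by
      simpa using hin x ((ε + t) / 2) 0 (by simp)
    have e1 := hnor (x + ((ε + t) / 2) • n) ((ε - t) / 2) (by
      rw [hm, abs_lt]
      constructor <;> linarith)
    have e2 := hnor (x + ((ε + t) / 2) • n) ((ε + t) / 2) (by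
      rw [hm, abs_lt]
      constructor <;> linarith)
    rw [show x + ((ε + t) / 2) • n + ((ε - t) / 2) • n = x + ε • n by module,
      show x + ((ε + t) / 2) • n - ((ε - t) / 2) • n = x + t • n by module] at e1
    rw [show x + ((ε + t) / 2) • n + ((ε + t) / 2) • n = x + t • n + ε • n by module,
      show x + ((ε + t) / 2) • n - ((ε + t) / 2) • n = x by module] at e2
    simp only [hD]
    linarith
  have hDt : ∀ x a', inner ℝ n a' = 0 → 0 < inner ℝ n x → D (x + a') + D (x - a') = 2 * D x := by
    intro x a' ha' hx
    have e1 := htan a' x ha' hx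
    have e2 := htan a' (x + ε • n) ha' (by
      have := hin x ε 0 (by simp)
      rw [add_zero] at this
      rw [this]
      linarith)
    rw [add_right_comm x, add_sub_right_comm x] at e2
    simp only [hD]
    linarith
  have hεa : inner ℝ n (ε • a) = 0 := by rw [inner_smul_right, ha, mul_zero]
  set x' : E := y - s • n with hx'
  have hx'0 : inner ℝ n x' = 0 := by
    rw [hx', inner_sub_right, inner_smul_right, hnn, ← hs]
    ring
  have iy : ∀ a', inner ℝ n a' = 0 → inner ℝ n (y + a') = s := by
    intro a' ha'
    rw [inner_add_right, ha', add_zero]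
  have in' : ∀ a', inner ℝ n a' = 0 → inner ℝ n (a' + ε • n) = ε := by
    intro a' ha'
    rw [inner_add_right, inner_smul_right, ha', hnn]
    ring
  have i1 : inner ℝ n (x' + ε • a) = 0 := by rw [inner_add_right, hx'0, hεa, add_zero]
  have i2 : inner ℝ n (x' - ε • a) = 0 := by rw [inner_sub_right, hx'0, hεa, sub_zero]
  have w1 : D (y + ε • a) = D (x' + ε • a + ε • n) := by
    rw [← hDn (x' + ε • a + ε • n) (s - ε) (by rw [in' _ i1]; exact hε) (by linarith)]
    congr 1
    rw [hx']
    module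
  have w2 : D (y - ε • a - ε • n) = D (x' - ε • a + ε • n) := by
    have hpos : 0 < inner ℝ n (y - ε • a - ε • n) := by
      rw [inner_sub_right, inner_sub_right, hεa, inner_smul_right, hnn]
      linarith
    rw [← hDn (y - ε • a - ε • n) ε hpos hε.le,
      ← hDn (x' - ε • a + ε • n) (s - ε) (by rw [in' _ i2]; exact hε) (by linarith)]
    congr 1
    rw [hx']
    module
  have ih : inner ℝ n ((1 / 2 : ℝ) • x') = 0 := by rw [inner_smul_right, hx'0, mul_zero]
  have w3 := hDt ((1 / 2 : ℝ) • x' + ε • n) ((1 / 2 : ℝ) • x' + ε • a)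
    (by rw [inner_add_right, ih, hεa, add_zero]) (by rw [in' _ ih]; exact hε)
  have w4 := hDt ((1 / 2 : ℝ) • x' + ε • n) ((1 / 2 : ℝ) • x' - ε • a)
    (by rw [inner_sub_right, ih, hεa, sub_zero]) (by rw [in' _ ih]; exact hε)
  rw [show (1 / 2 : ℝ) • x' + ε • n + ((1 / 2 : ℝ) • x' + ε • a) = x' + ε • a + ε • n by module,
    show (1 / 2 : ℝ) • x' + ε • n - ((1 / 2 : ℝ) • x' + ε • a) = -(ε • a) + ε • n by module] at w3
  rw [show (1 / 2 : ℝ) • x' + ε • n + ((1 / 2 : ℝ) • x' - ε • a) = x' - ε • a + ε • n by module,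
    show (1 / 2 : ℝ) • x' + ε • n - ((1 / 2 : ℝ) • x' - ε • a) = ε • a + ε • n by module] at w4
  have w5 := htan (ε • a) y hεa hy
  have hp1 : inner ℝ n (y + ε • (n + a)) = s + ε := by
    rw [smul_add, add_comm (ε • n), ← add_assoc]
    exact hin y ε _ hεa
  have hp2 : inner ℝ n (y - ε • (n + a)) = s - ε := by
    have := hin y (-ε) (-(ε • a)) (by rw [inner_neg_right, hεa, neg_zero])
    rw [show y + -(ε • a) + -ε • n = y - ε • (n + a) by module] at this
    rw [this]
    ring
  have sp := h.space τ hτ y hy (ε • (n + a)) (by simp only [mem_ofPred_eq, hp1]; linarith)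
    (by simp only [mem_ofPred_eq, hp2]; linarith)
  rw [htime τ hτ y hy, htime τ hτ _ (by rw [hp1]; linarith),
    htime τ hτ _ (by rw [hp2]; linarith)] at sp
  have sc : ∀ x : E, ‖ε • x‖ ^ (2 + γ) = ε ^ (2 + γ) * ‖x‖ ^ (2 + γ) := fun x => by
    rw [norm_smul, Real.norm_of_nonneg hε.le, Real.mul_rpow hε.le (norm_nonneg _)]
  have g1 := h.init (ε • (a + (2 : ℝ) • n)) (by
    have := hin (ε • a) (2 * ε) 0 (by simp)
    simp only [mem_ofPred_eq]
    rw [show ε • (a + (2 : ℝ) • n) = ε • a + 0 + (2 * ε) • n by module, this, hεa]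
    linarith)
  have g2 := h.init (ε • (a + n)) (by
    simp only [mem_ofPred_eq, smul_add]
    rw [in' _ hεa]
    exact hε)
  have g3 := h.init (ε • (-a + (2 : ℝ) • n)) (by
    have := hin (-(ε • a)) (2 * ε) 0 (by simp)
    simp only [mem_ofPred_eq]
    rw [show ε • (-a + (2 : ℝ) • n) = -(ε • a) + 0 + (2 * ε) • n by module, this,
      inner_neg_right, hεa]
    linarith)
  have g4 := h.init (ε • (-a + n)) (by
    simp only [mem_ofPred_eq, smul_add, smul_neg]
    rw [in' _ (by rw [inner_neg_right, hεa, neg_zero])]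
    exact hε)
  rw [sc] at sp g1 g2 g3 g4
  have z1 : D (ε • a + ε • n) = v 0 (ε • (a + (2 : ℝ) • n)) - v 0 (ε • (a + n)) := by
    simp only [hD]
    congr 2 <;> module
  have z2 : D (-(ε • a) + ε • n) = v 0 (ε • (-a + (2 : ℝ) • n)) - v 0 (ε • (-a + n)) := by
    simp only [hD]
    congr 2 <;> module
  have z3 : D (y + ε • a) = v 0 (y + ε • (n + a)) - v 0 (y + ε • a) := by
    simp only [hD]
    congr 2
    module
  have z4 : D (y - ε • a - ε • n) = v 0 (y - ε • a) - v 0 (y - ε • (n + a)) := by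
    simp only [hD]
    congr 2 <;> module
  have tot : v 0 (y + ε • (n + a)) + v 0 (y - ε • (n + a)) - 2 * v 0 y =
      v 0 (ε • (a + (2 : ℝ) • n)) - v 0 (ε • (a + n)) -
      (v 0 (ε • (-a + (2 : ℝ) • n)) - v 0 (ε • (-a + n))) := by
    linarith
  rw [tot] at sp
  rw [abs_le] at *
  constructor <;> linarith

/-- Liouville theorem for limit pairs on the half space. -/
theorem eq_zero_halfSpace [FiniteDimensional ℝ E]
    (h : IsLimitPair b ν γ K {y | 0 < inner ℝ n y} v M) (hn : ‖n‖ = 1) (hν : 0 < ν)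
    (hγ : γ ∈ Ioo (0 : ℝ) 1) (hK : 0 ≤ K)
    (hbd : ∀ R, ∃ C, ∀ τ ∈ Icc (-R) 0, ∀ y, 0 < inner ℝ n y → ‖y‖ ≤ R →
      |v τ y| ≤ C * inner ℝ n y)
    {τ : ℝ} (hτ : τ ≤ 0) {y : E} (hy : 0 < inner ℝ n y) : M τ y = 0 := by
  wlog hz : ∀ τ y, ¬ 0 < inner ℝ n y → v τ y = 0 generalizing v
  · refine this h.zeroExtend (fun R => ?_) fun τ y hy => if_neg hy
    obtain ⟨C, hC⟩ := hbd R
    refine ⟨C, fun t ht x hx hxR => ?_⟩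
    rw [if_pos hx]
    exact hC t ht x hx hxR
  have hnn : inner ℝ n n = (1 : ℝ) := by rw [real_inner_self_eq_norm_sq, hn]; norm_num
  have hopen : IsOpen {y : E | 0 < inner ℝ n y} := isOpen_lt continuous_const (by fun_prop)
  have hcont := h.continuousOn_halfSpace hν.le hγ.1 hK hbd hz
  have hcomp : ∀ (σ : ℝ) (a : E), 0 ≤ σ → inner ℝ n a = 0 →
      ContinuousOn (fun p : ℝ × E => v (p.1 - σ) (p.2 + a)) (Iic 0 ×ˢ {y | 0 ≤ inner ℝ n y}) := by
    intro σ a hσ ha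
    have c1 : Continuous (fun p : ℝ × E => (p.1 - σ, p.2 + a)) := by fun_prop
    refine hcont.comp c1.continuousOn fun p hp => ⟨?_, ?_⟩
    · have : p.1 ≤ 0 := hp.1
      simp only [mem_Iic]
      linarith
    · have : 0 ≤ inner ℝ n p.2 := hp.2
      simp only [mem_ofPred_eq]
      rw [inner_add_right, ha]
      linarith
  have hspace : ∀ t ≤ 0, ∀ (a x : E), inner ℝ n a = 0 → 0 < inner ℝ n x →
      v t (x + a) + v t (x - a) - 2 * v t x = 0 := by
    intro t ht a x ha hx
    have ip : ∀ z, inner ℝ n (z + a) = inner ℝ n z := fun z => by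
      rw [inner_add_right, ha, add_zero]
    have im : ∀ z, inner ℝ n (z - a) = inner ℝ n z := fun z => by
      rw [inner_sub_right, ha, sub_zero]
    refine eq_zero_of_calAt_halfSpace (b := b) (n := n)
      (w := fun t x => v t (x + a) + v t (x - a) - 2 * v t x) hn
      hν hγ (K := K * (‖a‖ ^ 2 + ‖a‖ ^ (2 + γ))) (by positivity) ?_ ?_ ?_ ?_ ht hx.le
    · have c0 := hcomp 0 0 le_rfl (by simp)
      have c1 := hcomp 0 a le_rfl ha
      have c2 := hcomp 0 (-a) le_rfl (by rw [inner_neg_right, ha, neg_zero])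
      simp only [sub_zero, add_zero, ← sub_eq_add_neg] at c0 c1 c2
      exact (c1.add c2).sub (c0.const_mul 2)
    · intro t _ z hzz
      rw [hz t z (by simp [hzz]), hz t _ (by simp [ip, hzz]), hz t _ (by simp [im, hzz])]
      ring
    · intro t ht z hzz
      rcases hzz.eq_or_lt with h0 | h0
      · rw [hz t z (by simp [← h0]), hz t _ (by simp [ip, ← h0]), hz t _ (by simp [im, ← h0])]
        simp only [add_zero, mul_zero, sub_zero, abs_zero]
        positivity
      · exact h.second_difference_le hK ht h0 (by simpa [ip] using h0) (by simpa [im] using h0)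
    · exact fun t ht z h0 => h.calAt_second_difference hopen hγ.1 ht h0 (by simpa [ip] using h0)
        (by simpa [im] using h0)
  have htime : ∀ t ≤ 0, ∀ (σ : ℝ), 0 ≤ σ → ∀ x : E, 0 < inner ℝ n x → v t x - v (t - σ) x = 0 := by
    intro t ht σ hσ x hx
    refine eq_zero_of_calAt_halfSpace (b := b) (n := n) (w := fun t x => v t x - v (t - σ) x)
      hn hν hγ
      (K := σ * (ν * (Fintype.card ι * K)) + K * σ ^ (1 + γ / 2)) (by positivity) ?_ ?_ ?_ ?_ ht hx.le
    · have c0 := hcomp 0 0 le_rfl (by simp)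
      have c1 := hcomp σ 0 hσ (by simp)
      simp only [sub_zero, add_zero] at c0 c1
      exact c0.sub c1
    · intro t _ z hzz
      rw [hz t z (by simp [hzz]), hz _ z (by simp [hzz])]
      ring
    · intro t ht z hzz
      rcases hzz.eq_or_lt with h0 | h0
      · rw [hz t z (by simp [← h0]), hz _ z (by simp [← h0])]
        simp only [sub_zero, abs_zero]
        positivity
      · exact h.time_difference_le hν.le hK ht hσ h0
    · exact fun t ht z h0 => h.calAt_time_difference hopen hγ.1 ht hσ h0
  have htime0 : ∀ t ≤ 0, ∀ x, 0 < inner ℝ n x → v t x = v 0 x := by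
    intro t ht x hx
    have := htime 0 le_rfl (-t) (by linarith) x hx
    simp only [sub_neg_eq_add, zero_add] at this
    linarith
  have hMt : ∀ t ≤ 0, ∀ x, 0 < inner ℝ n x → ∀ a, inner ℝ n a = 0 → M t x a a = 0 := by
    intro t ht x hx a ha
    refine bilin_self_eq_zero (γ := γ) (C := K * ‖a‖ ^ (2 + γ)) hγ.1 one_pos fun ε hε _ => ?_
    have ha' : inner ℝ n (ε • a) = 0 := by rw [inner_smul_right, ha, mul_zero]
    have := h.space t ht x hx (ε • a) (by simpa [inner_add_right, ha'] using hx)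
      (by simpa [inner_sub_right, ha'] using hx)
    rw [hspace t ht _ x ha' hx, zero_sub, abs_neg, norm_smul, Real.norm_of_nonneg hε.le,
      Real.mul_rpow hε.le (norm_nonneg _)] at this
    linarith
  have htr : ∀ t ≤ 0, ∀ x, 0 < inner ℝ n x → ∑ i, M t x (b i) (b i) = 0 := by
    intro t ht x hx
    have ev : ∀ᶠ σ : ℝ in 𝓝[>] 0, |ν * ∑ i, M t x (b i) (b i)| ≤ K * σ ^ (γ / 2) := by
      filter_upwards [self_mem_nhdsWithin] with σ hσ
      have hσ : 0 < σ := hσ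
      have := h.time t ht σ hσ.le x hx
      rw [htime t ht σ hσ.le x hx, zero_sub, abs_neg, abs_mul, abs_of_pos hσ,
        Real.rpow_add hσ, Real.rpow_one] at this
      have h2 : σ * |ν * ∑ i, M t x (b i) (b i)| ≤ σ * (K * σ ^ (γ / 2)) := by linarith
      exact le_of_mul_le_mul_left h2 hσ
    have hγ2 : 0 < γ / 2 := by linarith [hγ.1]
    have t1 : Tendsto (fun r : ℝ => K * r ^ (γ / 2)) (𝓝[>] 0) (𝓝 0) := by
      have : Tendsto (fun r : ℝ => K * r ^ (γ / 2)) (𝓝 0) (𝓝 (K * 0 ^ (γ / 2))) :=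
        ((Real.continuousAt_rpow_const 0 (γ / 2) (Or.inr hγ2.le)).tendsto).const_mul K
      rw [Real.zero_rpow hγ2.ne', mul_zero] at this
      exact this.mono_left nhdsWithin_le_nhds
    have := abs_nonpos_iff.1 (ge_of_tendsto t1 ev)
    exact (mul_eq_zero.1 this).resolve_left hν.ne'
  have hMn : ∀ t ≤ 0, ∀ x, 0 < inner ℝ n x → M t x n n = 0 := by
    intro t ht x hx
    have hsym := h.symm t ht x hx
    have e1 : ∀ i, M t x (b i) (b i) = 2 * inner ℝ n (b i) * M t x n (b i) -
        (inner ℝ n (b i)) ^ 2 * M t x n n := by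
      intro i
      have h0 : inner ℝ n (b i - (inner ℝ n (b i)) • n) = (0 : ℝ) := by
        rw [inner_sub_right, inner_smul_right, hnn]
        ring
      have := hMt t ht x hx _ h0
      simp only [map_sub, map_smul, sub_apply, smul_apply, smul_eq_mul, hsym (b i) n] at this
      linarith
    have e2 := htr t ht x hx
    simp only [e1] at e2
    rw [Finset.sum_sub_distrib, ← Finset.sum_mul] at e2
    have e3 : ∑ i, (inner ℝ n (b i)) ^ 2 = 1 := by
      have := b.sum_sq_norm_inner_left n
      simpa [hn] using this
    have e4 : ∑ i, 2 * inner ℝ n (b i) * M t x n (b i) = 2 * M t x n n := by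
      have h5 := congrArg (M t x n) (b.sum_repr' n)
      simp only [map_sum, map_smul, smul_eq_mul] at h5
      rw [← h5, Finset.mul_sum]
      refine Finset.sum_congr rfl fun i _ => ?_
      rw [real_inner_comm n (b i)]
      ring
    rw [e3, e4] at e2
    linarith
  have hnor : ∀ x (ε : ℝ), |ε| < inner ℝ n x →
      v 0 (x + ε • n) + v 0 (x - ε • n) - 2 * v 0 x = 0 := by
    have pos : ∀ x (ε : ℝ), 0 < ε → ε < inner ℝ n x →
      v 0 (x + ε • n) + v 0 (x - ε • n) - 2 * v 0 x = 0 := by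
      intro x ε hε hεx
      set s : ℝ := inner ℝ n x with hs
      have key := second_difference_eq_zero (g := fun t => v 0 (x + (t - s) • n)) (C := K) hγ.1
        (fun t ε hε ht => ?_) hε hεx
      · convert key using 4
        · module
        · module
        · module
      · have i0 : ∀ c : ℝ, inner ℝ n (x + (c - s) • n) = c := fun c => by
          rw [inner_add_right, inner_smul_right, hnn, ← hs]
          ring
        have e1 : x + (t + ε - s) • n = x + (t - s) • n + ε • n := by module
        have e2 : x + (t - ε - s) • n = x + (t - s) • n - ε • n := by module
        have := h.space 0 le_rfl (x + (t - s) • n) (by simp only [mem_ofPred_eq, i0]; linarith)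
          (ε • n) (by simp only [mem_ofPred_eq, ← e1, i0]; linarith)
          (by simp only [mem_ofPred_eq, ← e2, i0]; linarith)
        rw [← e1, ← e2] at this
        simp only [map_smul, smul_apply, hMn 0 le_rfl (x + (t - s) • n) (by rw [i0]; linarith),
          smul_zero, sub_zero, norm_smul, hn, mul_one, Real.norm_of_nonneg hε.le] at this
        exact this
    intro x ε hε
    rcases lt_trichotomy ε 0 with h0 | h0 | h0
    · have := pos x (-ε) (by linarith) (by rwa [abs_of_neg h0] at hε)
      rw [neg_smul, sub_neg_eq_add, ← sub_eq_add_neg] at this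
      linarith
    · simp [h0]
      ring
    · exact pos x ε h0 (by rwa [abs_of_pos h0] at hε)
  have hsym := h.symm τ hτ y hy
  refine eq_zero_of_quadratic hsym fun e => ?_
  set a : E := e - (inner ℝ n e) • n with ha
  have ha0 : inner ℝ n a = 0 := by
    rw [ha, inner_sub_right, inner_smul_right, hnn]
    ring
  have q1 := h.quad_eq_zero_of_affine hn hγ.1 htime0 (hspace 0 le_rfl) hnor hτ hy ha0
  have q2 := hMt τ hτ y hy a ha0
  have q3 := hMn τ hτ y hy
  have he : e = (inner ℝ n e) • n + a := by
    rw [ha]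
    abel
  simp only [map_add, add_apply, q2, q3, hsym a n] at q1
  have q4 : M τ y n a = 0 := by linarith
  rw [he]
  simp only [map_add, map_smul, add_apply, smul_apply, smul_eq_mul, q2, q3, q4, hsym a n]
  ring

end IsLimitPair
end
end

section

/-- A uniform interior cone condition with locally constant axes. -/
def ConeCond {E : Type*} [NormedAddCommGroup E] [InnerProductSpace ℝ E] (S : Set E) (r κ : ℝ) :
    Prop :=
  0 < r ∧ 0 < κ ∧ κ ≤ 1 ∧ ∀ p ∈ S, ∃ e : E, ‖e‖ ≤ 1 ∧ ∀ x ∈ S, ‖x - p‖ < r →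
    ∀ s ∈ Ioc (0:ℝ) r, Metric.ball (x + s • e) (κ * s) ⊆ S

/-- Mean value inequality with a fixed comparison functional. -/
theorem abs_sub_sub_le_of_fderiv {E : Type*} [NormedAddCommGroup E] [NormedSpace ℝ E]
    {ψ : E → ℝ} (hψ : Differentiable ℝ ψ) {S : Set E} (hS : Convex ℝ S) {N : E →L[ℝ] ℝ} {η : ℝ}
    (hN : ∀ y ∈ S, ‖fderiv ℝ ψ y - N‖ ≤ η) {x y : E} (hx : x ∈ S) (hy : y ∈ S) :
    |ψ y - ψ x - N (y - x)| ≤ η * ‖y - x‖ := by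
  exact hS.norm_image_sub_le_of_norm_fderiv_le' (fun z _ => hψ z) hN hx hy

theorem le_zero_of_mem_closure {d : ℕ} {D U : Set (Euc d)} {ψ : Euc d → ℝ} (hU : IsOpen U)
    (hψ : Continuous ψ) (hDU : D ∩ U = {y ∈ U | ψ y < 0}) {x : Euc d} (hx : x ∈ closure D)
    (hxU : x ∈ U) : ψ x ≤ 0 := by
  have h1 : x ∈ closure (D ∩ U) := by
    rw [inter_comm]
    exact hU.inter_closure ⟨hxU, hx⟩
  have h2 : closure (D ∩ U) ⊆ {y | ψ y ≤ 0} := by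
    refine closure_minimal ?_ (isClosed_le hψ continuous_const)
    rw [hDU]
    exact fun y hy => le_of_lt hy.2
  exact h2 h1

theorem exists_riesz {d : ℕ} (N : Euc d →L[ℝ] ℝ) (hN : N ≠ 0) :
    ∃ n : Euc d, ‖n‖ = 1 ∧ ∀ y, N y = -(‖N‖ * inner ℝ n y) := by
  set g := (InnerProductSpace.toDual ℝ (Euc d)).symm N with hg
  have hgn : ‖g‖ = ‖N‖ := by simp [hg]
  have hN0 : 0 < ‖N‖ := norm_pos_iff.2 hN
  refine ⟨(-‖N‖⁻¹) • g, ?_, fun y => ?_⟩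
  · rw [norm_smul, hgn, norm_neg, norm_inv, norm_norm, inv_mul_cancel₀ hN0.ne']
  · have : N y = inner ℝ g y := by simp [hg]
    rw [this, inner_smul_left]
    simp
    field_simp

theorem cone_at_frontier {d : ℕ} {D : Set (Euc d)} (hD : HasC3Boundary D) {p : Euc d}
    (hp : p ∈ frontier D) : ∃ r > 0, ∃ κ > 0, ∃ e : Euc d, ‖e‖ ≤ 1 ∧ ∀ x ∈ closure D,
      ‖x - p‖ < r → ∀ s ∈ Ioc (0:ℝ) r, Metric.ball (x + s • e) (κ * s) ⊆ D := by
  obtain ⟨U, ψ, hU, hpU, hψ, hψ0, hDU⟩ := hD p hp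
  set N := fderiv ℝ ψ p with hN
  have hm : 0 < ‖N‖ := norm_pos_iff.2 (hψ0 p hpU)
  obtain ⟨n, hn, hNn⟩ := exists_riesz N (hψ0 p hpU)
  have hdiff : Differentiable ℝ ψ := hψ.differentiable (by norm_num)
  have hc : Continuous (fderiv ℝ ψ) := hψ.continuous_fderiv (by norm_num)
  have h1 : ∀ᶠ y in 𝓝 p, y ∈ U ∧ ‖fderiv ℝ ψ y - N‖ ≤ ‖N‖ / 4 := by
    have := hc.continuousAt (x := p)
    rw [Metric.continuousAt_iff'] at this
    filter_upwards [hU.mem_nhds hpU, this (‖N‖ / 4) (by positivity)] with y hyU hy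
    rw [dist_eq_norm] at hy
    exact ⟨hyU, hy.le⟩
  obtain ⟨δ, hδ, hball⟩ := Metric.eventually_nhds_iff_ball.1 h1
  refine ⟨δ / 4, by positivity, 1 / 2, by norm_num, n, hn.le, fun x hx hxp s hs z hz => ?_⟩
  have hxb : x ∈ Metric.ball p δ := by
    rw [Metric.mem_ball, dist_eq_norm]
    linarith
  set k := z - (x + s • n) with hk
  have hkn : ‖k‖ < 1 / 2 * s := by rwa [hk, ← dist_eq_norm]
  have hzx : z - x = s • n + k := by rw [hk]; abel
  have hsn : ‖s • n‖ = s := by rw [norm_smul, hn, mul_one, Real.norm_of_nonneg hs.1.le]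
  have hzxn : ‖z - x‖ ≤ s + ‖k‖ := by
    rw [hzx]
    exact (norm_add_le _ _).trans (by rw [hsn])
  have hzb : z ∈ Metric.ball p δ := by
    rw [Metric.mem_ball, dist_eq_norm]
    have : z - p = (z - x) + (x - p) := by abel
    rw [this]
    have := norm_add_le (z - x) (x - p)
    have := hs.2
    linarith
  have h2 := abs_sub_sub_le_of_fderiv hdiff (convex_ball p δ) (fun y hy => (hball y hy).2) hxb hzb
  have h3 := le_zero_of_mem_closure hU hψ.continuous hDU hx (hball x hxb).1
  have h4 : N (z - x) ≤ -(‖N‖ * s) + ‖N‖ * ‖k‖ := by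
    rw [hzx, map_add]
    have e1 : N (s • n) = -(‖N‖ * s) := by
      rw [hNn, inner_smul_right, real_inner_self_eq_norm_sq, hn]
      ring
    have e2 := (le_abs_self _).trans (N.le_opNorm k)
    linarith
  have h5 := (abs_le.1 h2).2
  have h6 : ψ z < 0 := by
    have := hs.1
    nlinarith
  have : z ∈ {y ∈ U | ψ y < 0} := ⟨(hball z hzb).1, h6⟩
  rw [← hDU] at this
  exact this.1

theorem exists_coneCond {d : ℕ} {D : Set (Euc d)} (hD : GoodDomain D) :
    ∃ r κ : ℝ, ConeCond (closure D) r κ := by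
  obtain ⟨hopen, hconn, hbdd, hC3⟩ := hD
  have key : ∃ r > (0:ℝ), ∃ κ > (0:ℝ), ∀ p ∈ closure D, ∃ e : Euc d, ‖e‖ ≤ 1 ∧ ∀ x ∈ closure D,
      ‖x - p‖ < r → ∀ s ∈ Ioc (0:ℝ) r, Metric.ball (x + s • e) (κ * s) ⊆ D := by
    refine hbdd.isCompact_closure.induction_on
      (p := fun S => ∃ r > (0:ℝ), ∃ κ > (0:ℝ), ∀ p ∈ S, ∃ e : Euc d, ‖e‖ ≤ 1 ∧ ∀ x ∈ closure D,
      ‖x - p‖ < r → ∀ s ∈ Ioc (0:ℝ) r, Metric.ball (x + s • e) (κ * s) ⊆ D) ?_ ?_ ?_ ?_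
    · exact ⟨1, one_pos, 1, one_pos, by simp⟩
    · rintro S T hST ⟨r, hr, κ, hκ, h⟩
      exact ⟨r, hr, κ, hκ, fun p hp => h p (hST hp)⟩
    · rintro S T ⟨r, hr, κ, hκ, h⟩ ⟨r', hr', κ', hκ', h'⟩
      refine ⟨min r r', lt_min hr hr', min κ κ', lt_min hκ hκ', fun p hp => ?_⟩
      rcases hp with hp | hp
      · obtain ⟨e, he, H⟩ := h p hp
        refine ⟨e, he, fun x hx hxp s hs => (Metric.ball_subset_ball ?_).trans
          (H x hx (hxp.trans_le (min_le_left _ _)) s ⟨hs.1, hs.2.trans (min_le_left _ _)⟩)⟩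
        exact mul_le_mul_of_nonneg_right (min_le_left _ _) hs.1.le
      · obtain ⟨e, he, H⟩ := h' p hp
        refine ⟨e, he, fun x hx hxp s hs => (Metric.ball_subset_ball ?_).trans
          (H x hx (hxp.trans_le (min_le_right _ _)) s ⟨hs.1, hs.2.trans (min_le_right _ _)⟩)⟩
        exact mul_le_mul_of_nonneg_right (min_le_right _ _) hs.1.le
    · intro p hp
      have loc : ∃ r > (0:ℝ), ∃ κ > (0:ℝ), ∃ e : Euc d, ‖e‖ ≤ 1 ∧ ∀ x ∈ closure D,
          ‖x - p‖ < r → ∀ s ∈ Ioc (0:ℝ) r, Metric.ball (x + s • e) (κ * s) ⊆ D := by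
        by_cases hpD : p ∈ D
        · obtain ⟨δ, hδ, hb⟩ := Metric.isOpen_iff.1 hopen p hpD
          refine ⟨δ / 2, by positivity, 1, one_pos, 0, by simp, fun x hx hxp s hs => ?_⟩
          rw [smul_zero, add_zero]
          refine (Metric.ball_subset_ball' ?_).trans hb
          rw [dist_eq_norm]
          have := hs.2
          linarith
        · exact cone_at_frontier hC3 (by rw [hopen.frontier_eq]; exact ⟨hp, hpD⟩)
      obtain ⟨r, hr, κ, hκ, e, he, H⟩ := loc
      refine ⟨Metric.ball p (r / 2),
        mem_nhdsWithin_of_mem_nhds (Metric.ball_mem_nhds _ (by positivity)),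
        r / 2, by positivity, κ, hκ, fun p' hp' => ⟨e, he, fun x hx hxp s hs => H x hx ?_ s
          ⟨hs.1, by linarith [hs.2]⟩⟩⟩
      rw [Metric.mem_ball, dist_eq_norm] at hp'
      have : x - p = (x - p') + (p' - p) := by abel
      rw [this]
      have := norm_add_le (x - p') (p' - p)
      linarith
  obtain ⟨r, hr, κ, hκ, h⟩ := key
  refine ⟨r, min κ 1, hr, lt_min hκ one_pos, min_le_right _ _, fun p hp => ?_⟩
  obtain ⟨e, he, H⟩ := h p hp
  refine ⟨e, he, fun x hx hxp s hs => ((Metric.ball_subset_ball ?_).trans (H x hx hxp s hs)).trans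
    subset_closure⟩
  exact mul_le_mul_of_nonneg_right (min_le_left _ _) hs.1.le

section Interpolation

variable {E : Type*} [NormedAddCommGroup E] [InnerProductSpace ℝ E] {S : Set E} {f : E → ℝ}
  {r₀ κ : ℝ}

theorem ConeCond.segIn (hS : ConeCond S r₀ κ) {e x : E} (hx : x ∈ S)
    (he : ∀ s ∈ Ioc (0:ℝ) r₀, Metric.ball (x + s • e) (κ * s) ⊆ S) {s : ℝ} (hs0 : 0 ≤ s)
    (hs : s ≤ r₀) : SegIn S x (s • e) := by
  intro σ hσ
  rcases (mul_nonneg hσ.1 hs0).eq_or_lt with h | h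
  · rw [smul_smul, ← h, zero_smul, add_zero]
    exact hx
  · rw [smul_smul]
    refine he (σ * s) ⟨h, ?_⟩ (Metric.mem_ball_self (mul_pos hS.2.1 h))
    nlinarith [hσ.2]

/-- Interpolation bound for second derivatives. -/
theorem ConeCond.hess_le (hS : ConeCond S r₀ κ) (hf : TwiceDiffOn S f) {x : E} (hx : x ∈ S)
    (hsymm : ∀ v w, hess f x v w = hess f x w v) {M L r : ℝ} (hM : ∀ y ∈ S, |f y| ≤ M)
    (hr : 0 < r) (hr₀ : r ≤ r₀) (hL : ∀ y ∈ S, ‖y - x‖ ≤ 2 * r → ‖hess f y - hess f x‖ ≤ L) :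
    ‖hess f x‖ ≤ 16 * M / (κ * r) ^ 2 + 2 * L := by
  obtain ⟨h0, hκ, hκ1, hcone⟩ := hS
  obtain ⟨e, he, H⟩ := hcone x hx
  have Hx := H x hx (by simpa using h0) r ⟨hr, hr₀⟩
  set y := x + r • e with hy
  have hM0 : 0 ≤ M := (abs_nonneg _).trans (hM x hx)
  have hL0 : 0 ≤ L := (norm_nonneg _).trans (hL x hx (by simp [hr.le]))
  have hκr : 0 < κ * r := mul_pos hκ hr
  have hκr' : κ * r ≤ r := by nlinarith
  have hyx : ‖y - x‖ ≤ r := by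
    rw [hy, add_sub_cancel_left, norm_smul, Real.norm_of_nonneg hr.le]
    nlinarith
  have hyb : y ∈ Metric.ball y (κ * r) := Metric.mem_ball_self hκr
  have tay : ∀ k : E, ‖k‖ = κ * r / 2 →
      |f (y + k) - f y - fderiv ℝ f y k - hess f x k k / 2| ≤ L * ‖k‖ ^ 2 ∧ |f (y + k)| ≤ M := by
    intro k hk
    have hkb : y + k ∈ Metric.ball y (κ * r) := by
      rw [Metric.mem_ball, dist_eq_norm, add_sub_cancel_left, hk]
      linarith
    have hseg := (convex_ball y (κ * r)).segIn hyb hkb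
    refine ⟨taylor_on_segment (fun z hz => hf z (Hx hz)) hseg fun σ hσ => ?_, hM _ (Hx hkb)⟩
    refine hL _ (Hx (hseg σ hσ)) ?_
    have := hseg σ hσ
    rw [Metric.mem_ball, dist_eq_norm] at this
    have e1 : y + σ • k - x = (y + σ • k - y) + (y - x) := by abel
    rw [e1]
    exact (norm_add_le _ _).trans (by linarith)
  refine opNorm_le_of_quadratic hsymm (by positivity) fun w => ?_
  rcases eq_or_ne w 0 with rfl | hw
  · simp
  have hw' : 0 < ‖w‖ := norm_pos_iff.2 hw
  set a : ℝ := κ * r / 2 / ‖w‖ with ha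
  have ha0 : 0 < a := by positivity
  have hk : ‖a • w‖ = κ * r / 2 := by
    rw [norm_smul, Real.norm_of_nonneg ha0.le, ha]
    field_simp
  obtain ⟨t1, b1⟩ := tay (a • w) hk
  obtain ⟨t2, b2⟩ := tay (-(a • w)) (by rw [norm_neg, hk])
  have b3 := hM y (Hx hyb)
  rw [norm_neg] at t2
  simp only [map_neg, neg_apply, neg_neg] at t2
  have q : |hess f x (a • w) (a • w)| ≤ 4 * M + 2 * (L * ‖a • w‖ ^ 2) := by
    rw [abs_le] at *
    constructor <;> linarith
  simp only [map_smul, smul_apply, smul_eq_mul] at q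
  rw [← mul_assoc, abs_mul, abs_of_pos (mul_pos ha0 ha0), hk] at q
  have e2 : ‖w‖ ^ 2 * (a * a) = (κ * r / 2) ^ 2 := by
    rw [ha]
    field_simp
  have e3 : (16 * M / (κ * r) ^ 2 + 2 * L) * ‖w‖ ^ 2 * (a * a) =
      4 * M + 2 * (L * (κ * r / 2) ^ 2) := by
    rw [mul_assoc, e2]
    field_simp
    ring
  have : a * a * |hess f x w w| ≤ a * a * ((16 * M / (κ * r) ^ 2 + 2 * L) * ‖w‖ ^ 2) := by
    linarith
  exact le_of_mul_le_mul_left this (mul_pos ha0 ha0)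

/-- Interpolation bound for the difference of two gradients. -/
theorem ConeCond.fderiv_sub_fderiv_le (hS : ConeCond S r₀ κ) {g : E → ℝ} (hf : TwiceDiffOn S f)
    (hg : TwiceDiffOn S g) {x : E} (hx : x ∈ S)
    {M B r : ℝ} (hM : ∀ y ∈ S, |f y - g y| ≤ M)
    (hr : 0 < r) (hr₀ : r ≤ r₀) (hB : ∀ y ∈ S, ‖hess f y‖ ≤ B) (hBg : ∀ y ∈ S, ‖hess g y‖ ≤ B) :
    ‖fderiv ℝ f x - fderiv ℝ g x‖ ≤ 4 * M / (κ * r) + 4 * B * r := by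
  have hS' := hS
  obtain ⟨h0, hκ, hκ1, hcone⟩ := hS
  obtain ⟨e, he, H⟩ := hcone x hx
  have Hx := H x hx (by simpa using h0) r ⟨hr, hr₀⟩
  have hseg0 := hS'.segIn hx (H x hx (by simpa using h0)) hr.le hr₀
  set y := x + r • e with hy
  have hM0 : 0 ≤ M := (abs_nonneg _).trans (hM x hx)
  have hB0 : 0 ≤ B := (norm_nonneg _).trans (hB x hx)
  have hκr : 0 < κ * r := mul_pos hκ hr
  have hκr' : κ * r ≤ r := by nlinarith
  have hyb : y ∈ Metric.ball y (κ * r) := Metric.mem_ball_self hκr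
  have hre : B * ‖r • e‖ ≤ B * r := by
    rw [norm_smul, Real.norm_of_nonneg hr.le]
    have : r * ‖e‖ ≤ r := by nlinarith
    exact mul_le_mul_of_nonneg_left this hB0
  have g1 : ‖fderiv ℝ f y - fderiv ℝ f x‖ ≤ B * r :=
    (fderiv_sub_le_on_segment hf hseg0 hB).trans hre
  have g1' : ‖fderiv ℝ g y - fderiv ℝ g x‖ ≤ B * r :=
    (fderiv_sub_le_on_segment hg hseg0 hBg).trans hre
  have g2 : ‖fderiv ℝ f y - fderiv ℝ g y‖ ≤ 4 * M / (κ * r) + 2 * B * r := by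
    refine ContinuousLinearMap.opNorm_le_bound _ (by positivity) fun w => ?_
    rcases eq_or_ne w 0 with rfl | hw
    · simp
    have hw' : 0 < ‖w‖ := norm_pos_iff.2 hw
    set a : ℝ := κ * r / 2 / ‖w‖ with ha
    have ha0 : 0 < a := by positivity
    have hk : ‖a • w‖ = κ * r / 2 := by
      rw [norm_smul, Real.norm_of_nonneg ha0.le, ha]
      field_simp
    have hkb : y + a • w ∈ Metric.ball y (κ * r) := by
      rw [Metric.mem_ball, dist_eq_norm, add_sub_cancel_left, hk]
      linarith
    have hseg := (convex_ball y (κ * r)).segIn hyb hkb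
    have t := taylor_on_segment (B := 0) (K := B) (fun z hz => hf z (Hx hz)) hseg fun σ hσ => by
      simpa using hB _ (Hx (hseg σ hσ))
    have t' := taylor_on_segment (B := 0) (K := B) (fun z hz => hg z (Hx hz)) hseg fun σ hσ => by
      simpa using hBg _ (Hx (hseg σ hσ))
    have b1 := hM _ (Hx hkb)
    have b2 := hM _ (Hx hyb)
    simp only [zero_apply, zero_div, sub_zero] at t t'
    rw [hk] at t t'
    have q : |(fderiv ℝ f y - fderiv ℝ g y) (a • w)| ≤ 2 * M + 2 * (B * (κ * r / 2) ^ 2) := by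
      rw [sub_apply]
      rw [abs_le] at *
      constructor <;> linarith
    rw [map_smul, smul_eq_mul, abs_mul, abs_of_pos ha0] at q
    have e2 : ‖w‖ * a = κ * r / 2 := by
      rw [ha]
      field_simp
    have e3 : (4 * M / (κ * r) + 2 * B * r) * ‖w‖ * a = 2 * M + 2 * (B * (r * (κ * r / 2))) := by
      rw [mul_assoc, e2]
      field_simp
      ring
    have e4 : B * (κ * r / 2) ^ 2 ≤ B * (r * (κ * r / 2)) := by
      refine mul_le_mul_of_nonneg_left ?_ hB0
      nlinarith
    rw [Real.norm_eq_abs]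
    have : a * |(fderiv ℝ f y - fderiv ℝ g y) w| ≤
        a * ((4 * M / (κ * r) + 2 * B * r) * ‖w‖) := by linarith
    exact le_of_mul_le_mul_left this ha0
  have e5 : fderiv ℝ f x - fderiv ℝ g x = (fderiv ℝ f y - fderiv ℝ g y) -
      (fderiv ℝ f y - fderiv ℝ f x) + (fderiv ℝ g y - fderiv ℝ g x) := by abel
  rw [e5]
  have n1 := norm_add_le ((fderiv ℝ f y - fderiv ℝ g y) - (fderiv ℝ f y - fderiv ℝ f x))
    (fderiv ℝ g y - fderiv ℝ g x)
  have n2 := norm_sub_le (fderiv ℝ f y - fderiv ℝ g y) (fderiv ℝ f y - fderiv ℝ f x)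
  linarith

/-- Interpolation bound for first derivatives. -/
theorem ConeCond.fderiv_le (hS : ConeCond S r₀ κ) (hf : TwiceDiffOn S f) {x : E} (hx : x ∈ S)
    {M B r : ℝ} (hM : ∀ y ∈ S, |f y| ≤ M)
    (hr : 0 < r) (hr₀ : r ≤ r₀) (hB : ∀ y ∈ S, ‖hess f y‖ ≤ B) :
    ‖fderiv ℝ f x‖ ≤ 4 * M / (κ * r) + 4 * B * r := by
  have h0 : hess (fun _ : E => (0:ℝ)) = fun _ => 0 := by
    funext y
    simp [hess]
  have hB0 : 0 ≤ B := (norm_nonneg _).trans (hB x hx)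
  have := hS.fderiv_sub_fderiv_le (g := fun _ => 0) hf (fun y _ => by simp) hx (by simpa using hM)
    hr hr₀ hB (by simpa [h0] using fun _ _ => hB0)
  simpa using this

theorem ConeCond.exists_path (hS : ConeCond S r₀ κ) {x x' : E} (hx : x ∈ S) (hx' : x' ∈ S)
    (hxx : 2 * ‖x' - x‖ ≤ κ * r₀) : ∃ w : E, ‖w‖ ≤ 2 / κ * ‖x' - x‖ ∧ SegIn S x w ∧
      SegIn S (x + w) (x' - x) ∧ SegIn S x' w := by
  have hS' := hS
  obtain ⟨h0, hκ, hκ1, hcone⟩ := hS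
  rcases eq_or_ne x' x with rfl | hne
  · refine ⟨0, by simp, ?_, ?_, ?_⟩ <;> intro σ _ <;> simpa using hx
  have hpos : 0 < ‖x' - x‖ := norm_pos_iff.2 (sub_ne_zero.2 hne)
  obtain ⟨e, he, H⟩ := hcone x hx
  have hxr : ‖x' - x‖ < r₀ := by nlinarith
  set s : ℝ := 2 / κ * ‖x' - x‖ with hs
  have hs0 : 0 < s := by positivity
  have hκs : κ * s = 2 * ‖x' - x‖ := by rw [hs]; field_simp
  have hsr : s ≤ r₀ := by
    have : κ * s ≤ κ * r₀ := by rw [hκs]; exact hxx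
    exact le_of_mul_le_mul_left this hκ
  have Hx := H x hx (by simpa using h0)
  refine ⟨s • e, ?_, hS'.segIn hx Hx hs0.le hsr, ?_, hS'.segIn hx' (H x' hx' hxr) hs0.le hsr⟩
  · rw [norm_smul, Real.norm_of_nonneg hs0.le]
    nlinarith
  · have hb := Hx s ⟨hs0, hsr⟩
    have c1 : x + s • e ∈ Metric.ball (x + s • e) (κ * s) := Metric.mem_ball_self (by positivity)
    have c2 : x + s • e + (x' - x) ∈ Metric.ball (x + s • e) (κ * s) := by
      rw [Metric.mem_ball, dist_eq_norm, add_sub_cancel_left, hκs]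
      linarith
    exact fun σ hσ => hb ((convex_ball _ _).segIn c1 c2 σ hσ)

theorem ConeCond.sub_le (hS : ConeCond S r₀ κ) (hf : TwiceDiffOn S f) {x x' : E} (hx : x ∈ S)
    (hx' : x' ∈ S) (hxx : 2 * ‖x' - x‖ ≤ κ * r₀) {K : ℝ} (hK : ∀ y ∈ S, ‖fderiv ℝ f y‖ ≤ K) :
    |f x' - f x| ≤ (4 / κ + 1) * K * ‖x' - x‖ := by
  obtain ⟨w, hw, s1, s2, s3⟩ := hS.exists_path hx hx' hxx
  have hK0 : 0 ≤ K := (norm_nonneg _).trans (hK x hx)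
  have a1 := abs_le.1 (sub_le_on_segment hf s1 hK)
  have a2 := abs_le.1 (sub_le_on_segment hf s2 hK)
  have a3 := abs_le.1 (sub_le_on_segment hf s3 hK)
  have e : x + w + (x' - x) = x' + w := by abel
  rw [e] at a2
  have := mul_le_mul_of_nonneg_left hw hK0
  have e2 : (4 / κ + 1) * K * ‖x' - x‖ = 2 * (K * (2 / κ * ‖x' - x‖)) + K * ‖x' - x‖ := by ring
  rw [e2, abs_le]
  constructor <;> linarith

theorem ConeCond.fderiv_sub_le (hS : ConeCond S r₀ κ) (hf : TwiceDiffOn S f) {x x' : E}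
    (hx : x ∈ S) (hx' : x' ∈ S) (hxx : 2 * ‖x' - x‖ ≤ κ * r₀) {K : ℝ}
    (hK : ∀ y ∈ S, ‖hess f y‖ ≤ K) :
    ‖fderiv ℝ f x' - fderiv ℝ f x‖ ≤ (4 / κ + 1) * K * ‖x' - x‖ := by
  obtain ⟨w, hw, s1, s2, s3⟩ := hS.exists_path hx hx' hxx
  have hK0 : 0 ≤ K := (norm_nonneg _).trans (hK x hx)
  have a1 := fderiv_sub_le_on_segment hf s1 hK
  have a2 := fderiv_sub_le_on_segment hf s2 hK
  have a3 := fderiv_sub_le_on_segment hf s3 hK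
  have e : x + w + (x' - x) = x' + w := by abel
  rw [e] at a2
  have := mul_le_mul_of_nonneg_left hw hK0
  have e2 : (4 / κ + 1) * K * ‖x' - x‖ = 2 * (K * (2 / κ * ‖x' - x‖)) + K * ‖x' - x‖ := by ring
  have e3 : fderiv ℝ f x' - fderiv ℝ f x = (fderiv ℝ f (x + w) - fderiv ℝ f x) +
      (fderiv ℝ f (x' + w) - fderiv ℝ f (x + w)) - (fderiv ℝ f (x' + w) - fderiv ℝ f x') := by
    abel
  rw [e2, e3]
  have n1 := norm_sub_le ((fderiv ℝ f (x + w) - fderiv ℝ f x) +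
      (fderiv ℝ f (x' + w) - fderiv ℝ f (x + w))) (fderiv ℝ f (x' + w) - fderiv ℝ f x')
  have n2 := norm_add_le (fderiv ℝ f (x + w) - fderiv ℝ f x)
      (fderiv ℝ f (x' + w) - fderiv ℝ f (x + w))
  linarith

end Interpolation

end

section

/-- Solutions with quantitative bounds on the data. -/
structure AdmSol {d : ℕ} (D : Set (Euc d)) (γ ν : ℝ) (A : ℝ → Fin d → ℝ) (N b : ℝ)
    (h u : ℝ → Euc d → ℝ) : Prop where
  hbound : parHolderBound γ (Ici 0) D h N
  hcont : ContinuousOn (fun p : ℝ × Euc d => h p.1 p.2) (Ici 0 ×ˢ closure D)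
  mem : MemXgamma γ (Ici 0) D u
  pde : SolvesPDE ν A (Ioi 0) D h u
  bc : DirichletBC (Ici 0) D u
  init : ∀ x ∈ closure D, |u 0 x| ≤ b

/-- The right-hand side of the heat equation satisfied by a solution. -/
def forcing {d : ℕ} (A : ℝ → Fin d → ℝ) (h u : ℝ → Euc d → ℝ) (t : ℝ) (x : Euc d) : ℝ :=
  h t x - ∑ j : Fin d, deriv (fun v => A v j) (u t x) * fderiv ℝ (u t) x (ebasis d j)

theorem divA_eq {d : ℕ} {A : ℝ → Fin d → ℝ} (hA : ContDiff ℝ 2 A) {f : Euc d → ℝ} {x : Euc d}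
    (hf : DifferentiableAt ℝ f x) :
    divA A f x = ∑ j : Fin d, deriv (fun v => A v j) (f x) * fderiv ℝ f x (ebasis d j) := by
  refine Finset.sum_congr rfl fun j _ => ?_
  have h1 : DifferentiableAt ℝ (fun v => A v j) (f x) :=
    (differentiableAt_pi.1 (hA.differentiable (by norm_num) (f x))) j
  have := h1.hasDerivAt.comp_hasFDerivAt x hf.hasFDerivAt
  have h2 : fderiv ℝ (fun y => A (f y) j) x = deriv (fun v => A v j) (f x) • fderiv ℝ f x :=
    this.fderiv
  rw [h2]
  simp

theorem deriv_nonneg_of_le_left {g : ℝ → ℝ} {g' t : ℝ} (hg : HasDerivAt g g' t) {a : ℝ} (ha : a < t)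
    (h : ∀ r ∈ Icc a t, g r ≤ g t) : 0 ≤ g' := by
  have h1 := (hg.hasDerivWithinAt (s := Iio t))
  rw [hasDerivWithinAt_iff_tendsto_slope' (by simp)] at h1
  refine ge_of_tendsto h1 ?_
  filter_upwards [Ioo_mem_nhdsLT ha] with r hr
  rw [slope_def_field]
  exact div_nonneg_of_nonpos (by linarith [h r ⟨hr.1.le, hr.2.le⟩]) (by linarith [hr.2])

theorem hess_nonpos_of_isLocalMax {E : Type*} [NormedAddCommGroup E] [InnerProductSpace ℝ E]
    {S : Set E} (hS : IsOpen S) {f : E → ℝ} (hf : TwiceDiffOn S f) {x : E} (hx : x ∈ S)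
    (hc : ContinuousAt (hess f) x) (hmax : IsLocalMax f x) (e : E) : hess f x e e ≤ 0 := by
  by_contra! hpos
  have he : e ≠ 0 := by
    rintro rfl
    simp at hpos
  have he' : 0 < ‖e‖ := norm_pos_iff.2 he
  have hg := hmax.fderiv_eq_zero
  set η : ℝ := hess f x e e / (4 * ‖e‖ ^ 2) with hη
  have hη0 : 0 < η := by positivity
  have h1 : ∀ᶠ y in 𝓝 x, y ∈ S ∧ ‖hess f y - hess f x‖ ≤ η ∧ f y ≤ f x := by
    rw [Metric.continuousAt_iff'] at hc
    filter_upwards [hS.mem_nhds hx, hc η hη0, hmax] with y h1 h2 h3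
    rw [dist_eq_norm] at h2
    exact ⟨h1, h2.le, h3⟩
  obtain ⟨δ, hδ, hb⟩ := Metric.eventually_nhds_iff_ball.1 h1
  set a : ℝ := δ / (2 * ‖e‖) with ha
  have ha0 : 0 < a := by positivity
  have hy : x + a • e ∈ Metric.ball x δ := by
    rw [Metric.mem_ball, dist_eq_norm, add_sub_cancel_left, norm_smul, Real.norm_of_nonneg ha0.le,
      ha]
    have : δ / (2 * ‖e‖) * ‖e‖ = δ / 2 := by field_simp
    rw [this]
    linarith
  have hseg := (convex_ball x δ).segIn (Metric.mem_ball_self hδ) hy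
  have t := taylor_on_segment (fun y hy => hf y (hb y hy).1) hseg
    (fun σ hσ => (hb _ (hseg σ hσ)).2.1)
  rw [hg] at t
  have h3 := (hb _ hy).2.2
  have t1 := (abs_le.1 t).1
  simp only [map_smul, smul_apply, smul_eq_mul, zero_apply, norm_smul,
    Real.norm_of_nonneg ha0.le] at t1
  have e1 : η * (a * ‖e‖) ^ 2 = a * a * hess f x e e / 4 := by
    rw [hη]
    field_simp
  have : 0 < a * a * hess f x e e := by positivity
  rw [e1] at t1
  linarith

namespace AdmSol

variable {d : ℕ} {D : Set (Euc d)} {γ ν : ℝ} {A : ℝ → Fin d → ℝ} {N b : ℝ} {h u : ℝ → Euc d → ℝ}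

theorem twiceDiff (S : AdmSol D γ ν A N b h u) {t : ℝ} (ht : 0 ≤ t) :
    TwiceDiffOn (closure D) (u t) :=
  fun x hx => ⟨S.mem.1.2.2.1 t ht x hx, S.mem.1.2.2.2.1 t ht x hx⟩

theorem hasDerivAt_dtt (S : AdmSol D γ ν A N b h u) {t : ℝ} (ht : 0 ≤ t) {x : Euc d}
    (hx : x ∈ closure D) : HasDerivAt (fun s => u s x) (dtt u t x) t :=
  (S.mem.1.2.1 x hx t ht).hasDerivAt

theorem continuousOn_slice {Y : Type*} [TopologicalSpace Y] {g : ℝ → Euc d → Y}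
    (hg : ContinuousOn (fun p : ℝ × Euc d => g p.1 p.2) (Ici 0 ×ˢ closure D)) {t : ℝ}
    (ht : 0 ≤ t) : ContinuousOn (g t) (closure D) :=
  hg.comp (f := fun x => (t, x)) (by fun_prop) fun _ hx => ⟨ht, hx⟩

theorem hess_continuousOn (S : AdmSol D γ ν A N b h u) {t : ℝ} (ht : 0 ≤ t) :
    ContinuousOn (hess (u t)) (closure D) :=
  continuousOn_slice (g := fun t x => dx2 (u t) x) S.mem.1.2.2.2.2.2.2 ht

theorem hess_symm (hD : IsOpen D) (S : AdmSol D γ ν A N b h u) {t : ℝ} (ht : 0 ≤ t) {x : Euc d}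
    (hx : x ∈ closure D) (v w : Euc d) : hess (u t) x v w = hess (u t) x w v := by
  have hc := S.hess_continuousOn ht
  have key : EqOn (fun x => hess (u t) x v w) (fun x => hess (u t) x w v) (closure D) := by
    refine EqOn.of_subset_closure (s := D) (fun y hy => ?_) ?_ ?_ subset_closure subset_rfl
    · exact hess_symm_of_isOpen hD (fun z hz => S.twiceDiff ht z (subset_closure hz)) hy v w
    · exact (hc.clm_apply continuousOn_const).clm_apply continuousOn_const
    · exact (hc.clm_apply continuousOn_const).clm_apply continuousOn_const
  exact key hx

theorem lapl_eq (f : Euc d → ℝ) (x : Euc d) : lapl f x = ∑ i,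
    hess f x (EuclideanSpace.basisFun (Fin d) ℝ i) (EuclideanSpace.basisFun (Fin d) ℝ i) := by
  simp [lapl, dx2, hess, ebasis]

theorem forcing_continuousOn (hA : ContDiff ℝ 2 A) (S : AdmSol D γ ν A N b h u) {t : ℝ}
    (ht : 0 ≤ t) : ContinuousOn (forcing A h u t) (closure D) := by
  have h1 := continuousOn_slice S.hcont ht
  have h2 : ContinuousOn (u t) (closure D) := continuousOn_slice S.mem.1.1 ht
  have h3 : ContinuousOn (fderiv ℝ (u t)) (closure D) :=
    continuousOn_slice (g := fun t x => dx1 (u t) x) S.mem.1.2.2.2.2.2.1 ht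
  refine h1.sub (continuousOn_finsetSum _ fun j _ => ContinuousOn.mul ?_ ?_)
  · have : Continuous (deriv fun v => A v j) :=
      (contDiff_pi.1 hA j).continuous_deriv (by norm_num)
    exact this.comp_continuousOn h2
  · exact h3.clm_apply continuousOn_const

theorem dtt_eq (hA : ContDiff ℝ 2 A) (S : AdmSol D γ ν A N b h u) {t : ℝ}
    (ht : 0 < t) {x : Euc d} (hx : x ∈ closure D) :
    dtt u t x = ν * ∑ i, hess (u t) x (EuclideanSpace.basisFun (Fin d) ℝ i)
      (EuclideanSpace.basisFun (Fin d) ℝ i) + forcing A h u t x := by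
  have hc := S.hess_continuousOn ht.le
  have key : EqOn (fun x => dtt u t x) (fun x => ν * ∑ i, hess (u t) x
      (EuclideanSpace.basisFun (Fin d) ℝ i)
      (EuclideanSpace.basisFun (Fin d) ℝ i) + forcing A h u t x) (closure D) := by
    refine EqOn.of_subset_closure (s := D) (fun y hy => ?_) ?_ ?_ subset_closure subset_rfl
    · have := S.pde t ht y hy
      rw [divA_eq hA (S.twiceDiff ht.le y (subset_closure hy)).1, lapl_eq] at this
      simp only [forcing]
      linarith
    · exact continuousOn_slice (g := fun t x => dtt u t x) S.mem.1.2.2.2.2.1 ht.le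
    · exact (continuousOn_const.mul (continuousOn_finsetSum _ fun j _ =>
        (hc.clm_apply continuousOn_const).clm_apply continuousOn_const)).add
        (S.forcing_continuousOn hA ht.le)
  exact key hx

theorem abs_le (hD : IsOpen D) (hb : Bornology.IsBounded D) (hν : 0 < ν) (hA : ContDiff ℝ 2 A)
    (S : AdmSol D γ ν A N b h u) {t : ℝ} (ht : 0 ≤ t) {x : Euc d} (hx : x ∈ closure D) :
    |u t x| ≤ b + (N + 1) * t := by
  have main : ∀ ς : ℝ, |ς| = 1 → ς * u t x ≤ b + (N + 1) * t := by
    intro ς hς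
    by_contra! hcon
    have hN : 0 ≤ N := (norm_nonneg _).trans (S.hbound.1 0 self_mem_Ici x hx)
    have hb0 : 0 ≤ b := (abs_nonneg _).trans (S.init x hx)
    have hK : IsCompact (Icc 0 t ×ˢ closure D) := isCompact_Icc.prod hb.isCompact_closure
    have hcont : ContinuousOn (fun p : ℝ × Euc d => ς * u p.1 p.2 - (b + (N + 1) * p.1))
        (Icc 0 t ×ˢ closure D) := by
      refine ContinuousOn.sub (continuousOn_const.mul (S.mem.1.1.mono ?_)) (by fun_prop)
      exact prod_mono Icc_subset_Ici_self subset_rfl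
    obtain ⟨⟨t₀, x₀⟩, ⟨ht₀, hx₀⟩, hmax⟩ := hK.exists_isMaxOn ⟨(t, x), ⟨⟨ht, le_rfl⟩, hx⟩⟩ hcont
    have hmax' : ∀ r ∈ Icc 0 t, ∀ y ∈ closure D,
        ς * u r y - (b + (N + 1) * r) ≤ ς * u t₀ x₀ - (b + (N + 1) * t₀) :=
      fun r hr y hy => hmax (a := (r, y)) ⟨hr, hy⟩
    have ht₀ : t₀ ∈ Icc 0 t := ht₀
    have hx₀ : x₀ ∈ closure D := hx₀
    have hpos : 0 < ς * u t₀ x₀ - (b + (N + 1) * t₀) :=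
      lt_of_lt_of_le (by linarith) (hmax' t ⟨ht, le_rfl⟩ x hx)
    have ht₀pos : 0 < t₀ := by
      rcases ht₀.1.eq_or_lt with h0 | h0
      · rw [← h0] at hpos
        have h1 := S.init x₀ hx₀
        have h2 : ς * u 0 x₀ ≤ |u 0 x₀| := by
          have := le_abs_self (ς * u 0 x₀)
          rwa [abs_mul, hς, one_mul] at this
        linarith
      · exact h0
    have hx₀D : x₀ ∈ D := by
      by_contra hno
      have := S.bc t₀ ht₀.1 x₀ (by rw [hD.frontier_eq]; exact ⟨hx₀, hno⟩)
      rw [this] at hpos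
      have : 0 ≤ (N + 1) * t₀ := by positivity
      linarith
    have htw := S.twiceDiff ht₀.1
    have hmaxs : IsLocalMax (fun y => ς * u t₀ y) x₀ := by
      filter_upwards [hD.mem_nhds hx₀D] with y hy
      linarith [hmax' t₀ ht₀ y (subset_closure hy)]
    have hfd : ∀ y ∈ closure D, fderiv ℝ (fun y => ς * u t₀ y) y = ς • fderiv ℝ (u t₀) y :=
      fun y hy => fderiv_const_mul (htw y hy).1 ς
    have hev : ∀ y ∈ D, (fun y => fderiv ℝ (fun y => ς * u t₀ y) y) =ᶠ[𝓝 y]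
        fun y => ς • fderiv ℝ (u t₀) y := fun y hy => by
      filter_upwards [hD.mem_nhds hy] with z hz using hfd z (subset_closure hz)
    have hhess : ∀ y ∈ D, hess (fun y => ς * u t₀ y) y = ς • hess (u t₀) y := fun y hy => by
      rw [hess, (hev y hy).fderiv_eq, fderiv_fun_const_smul (htw y (subset_closure hy)).2]
      rfl
    have htw' : TwiceDiffOn D (fun y => ς * u t₀ y) := fun y hy =>
      ⟨(htw y (subset_closure hy)).1.const_mul ς,
        ((htw y (subset_closure hy)).2.const_smul ς).congr_of_eventuallyEq (hev y hy)⟩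
    have hca : ContinuousAt (hess fun y => ς * u t₀ y) x₀ := by
      have : ContinuousAt (fun y => ς • hess (u t₀) y) x₀ :=
        (((S.hess_continuousOn ht₀.1).mono subset_closure).continuousAt
          (hD.mem_nhds hx₀D)).const_smul ς
      refine this.congr ?_
      filter_upwards [hD.mem_nhds hx₀D] with y hy using (hhess y hy).symm
    have hneg := hess_nonpos_of_isLocalMax hD htw' hx₀D hca hmaxs
    have hgrad := hmaxs.fderiv_eq_zero
    rw [hfd x₀ hx₀] at hgrad
    have hς0 : ς ≠ 0 := by
      rintro rfl
      simp at hς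
    have hgrad0 : fderiv ℝ (u t₀) x₀ = 0 := (smul_eq_zero.1 hgrad).resolve_left hς0
    have htime : 0 ≤ ς * dtt u t₀ x₀ - (N + 1) := by
      have h1 : HasDerivAt (fun r => ς * u r x₀ - (b + (N + 1) * r))
          (ς * dtt u t₀ x₀ - (N + 1)) t₀ := by
        have h2 := ((hasDerivAt_id t₀).const_mul (N + 1)).const_add b
        rw [mul_one] at h2
        exact ((S.hasDerivAt_dtt ht₀.1 hx₀).const_mul ς).sub h2
      exact deriv_nonneg_of_le_left h1 ht₀pos fun r hr =>
        hmax' r ⟨hr.1, hr.2.trans ht₀.2⟩ x₀ hx₀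
    have hforce : forcing A h u t₀ x₀ = h t₀ x₀ := by simp [forcing, hgrad0]
    rw [S.dtt_eq hA ht₀pos hx₀, hforce] at htime
    have h5 := S.hbound.1 t₀ ht₀.1 x₀ hx₀
    have h6 : ς * h t₀ x₀ ≤ N := by
      have := le_abs_self (ς * h t₀ x₀)
      rw [abs_mul, hς, one_mul] at this
      exact this.trans h5
    have h7 : ∑ i, ς * hess (u t₀) x₀ (EuclideanSpace.basisFun (Fin d) ℝ i)
      (EuclideanSpace.basisFun (Fin d) ℝ i) ≤ 0 := by
      refine Finset.sum_nonpos fun i _ => ?_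
      have := hneg (EuclideanSpace.basisFun (Fin d) ℝ i)
      rw [hhess x₀ hx₀D] at this
      simpa only [smul_apply, smul_eq_mul] using this
    rw [← Finset.mul_sum] at h7
    nlinarith
  rw [_root_.abs_le]
  have a1 := main 1 (by simp)
  have a2 := main (-1) (by simp)
  constructor <;> linarith

theorem dtt_frontier (S : AdmSol D γ ν A N b h u) {t : ℝ} (ht : 0 < t) {x : Euc d}
    (hx : x ∈ frontier D) : dtt u t x = 0 := by
  have : (fun s => u s x) =ᶠ[𝓝 t] fun _ => (0:ℝ) := by
    filter_upwards [Ioi_mem_nhds ht] with r hr using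
      S.bc r (mem_Ici.2 (le_of_lt (mem_Ioi.1 hr))) x hx
  rw [dtt, this.deriv_eq]
  simp

end AdmSol

end

section

theorem abs_trace_le {ι E : Type*} [Fintype ι] [NormedAddCommGroup E] [InnerProductSpace ℝ E]
    (b : OrthonormalBasis ι ℝ E) (B : E →L[ℝ] E →L[ℝ] ℝ) :
    |∑ i, B (b i) (b i)| ≤ Fintype.card ι * ‖B‖ := by
  refine (Finset.abs_sum_le_sum_abs _ _).trans ?_
  have : ∀ i ∈ Finset.univ, |B (b i) (b i)| ≤ ‖B‖ := fun i _ => by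
    simpa using B.le_opNorm₂ (b i) (b i)
  simpa using Finset.sum_le_sum this

theorem exists_bound_and_lipschitz {g : ℝ → ℝ} (hg : ContDiff ℝ 1 g) (M : ℝ) :
    ∃ a ≥ 0, ∀ v ∈ Icc (-M) M, ∀ v' ∈ Icc (-M) M, |g v| ≤ a ∧ |g v - g v'| ≤ a * |v - v'| := by
  obtain ⟨a₁, h₁⟩ := isCompact_Icc.exists_bound_of_continuousOn (s := Icc (-M) M)
    hg.continuous.continuousOn
  obtain ⟨a₂, h₂⟩ := isCompact_Icc.exists_bound_of_continuousOn (s := Icc (-M) M)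
    (hg.continuous_deriv le_rfl).continuousOn
  refine ⟨max 0 (max a₁ a₂), le_max_left _ _, fun v hv v' hv' => ⟨(h₁ v hv).trans (by simp), ?_⟩⟩
  refine (convex_Icc (-M) M).norm_image_sub_le_of_norm_deriv_le
    (fun x _ => (hg.differentiable one_ne_zero) x) (fun x hx => (h₂ x hx).trans ?_) hv' hv
  simp

/-- Bounds at scale `ℓ` for a solution on the time interval `[a, s]`. -/
structure ScaleBounds {d : ℕ} (D : Set (Euc d)) (γ : ℝ) (A : ℝ → Fin d → ℝ) (C r₁ a s ℓ : ℝ)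
    (h u : ℝ → Euc d → ℝ) : Prop where
  hess_le : ∀ t ∈ Icc a s, ∀ x ∈ closure D, ‖hess (u t) x‖ ≤ C / ℓ ^ 2
  fderiv_le : ∀ t ∈ Icc a s, ∀ x ∈ closure D, ‖fderiv ℝ (u t) x‖ ≤ C / ℓ
  forcing_sub_le : ∀ r ∈ Ioc 0 r₁, ∀ t ∈ Icc a s, ∀ t' ∈ Icc a s, ∀ x ∈ closure D,
    ∀ x' ∈ closure D, |t - t'| ≤ r ^ 2 → ‖x - x'‖ ≤ r →
    |forcing A h u t x - forcing A h u t' x'| ≤ C * (r ^ γ + r / ℓ ^ 2 + r ^ 2 / ℓ ^ 3)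

theorem norm_ebasis {d : ℕ} (j : Fin d) : ‖ebasis d j‖ = 1 := by simp [ebasis]

namespace AdmSol

variable {d : ℕ} {D : Set (Euc d)} {γ ν : ℝ} {A : ℝ → Fin d → ℝ} {N b : ℝ}

set_option maxHeartbeats 2000000 in
theorem exists_scaleBounds (hD : GoodDomain D) (hγ : γ ∈ Ioo (0:ℝ) 1) (hν : 0 < ν)
    (hA : ContDiff ℝ 2 A) (hN : 0 ≤ N) (hb : 0 ≤ b) {s : ℝ} (hs : 0 < s) :
    ∃ C r₁ : ℝ, 1 ≤ C ∧ 0 < r₁ ∧ r₁ ≤ 1 ∧ ∀ h u, AdmSol D γ ν A N b h u →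
      ∀ a ℓ Λ : ℝ, 0 < a → 0 < ℓ → ℓ ≤ r₁ → Λ * ℓ ^ (2 + γ) = 1 → (∀ t ∈ Icc a s, ∀ t' ∈ Icc a s, ∀ x ∈ closure D,
        ∀ x' ∈ closure D, ‖hess (u t) x - hess (u t') x'‖ ≤
          4 * Λ * (|t - t'| ^ (γ / 2) + ‖x - x'‖ ^ γ)) →
      ScaleBounds D γ A C r₁ a s ℓ h u := by
  obtain ⟨r₀, κ, hcone⟩ := exists_coneCond hD
  have hr₀ := hcone.1
  have hκ := hcone.2.1
  obtain ⟨M, hM⟩ : ∃ y : ℝ, y = b + (N + 1) * s := ⟨_, rfl⟩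
  have hM0 : 0 ≤ M := by rw [hM]; positivity
  have hAj : ∀ j, ∃ a ≥ 0, ∀ v ∈ Icc (-M) M, ∀ v' ∈ Icc (-M) M,
      |deriv (fun v => A v j) v| ≤ a ∧
      |deriv (fun v => A v j) v - deriv (fun v => A v j) v'| ≤ a * |v - v'| := fun j =>
    exists_bound_and_lipschitz ((contDiff_pi.1 hA j).deriv' (n := 1)) M
  choose α hα0 hα using hAj
  obtain ⟨C₀, hC₀⟩ : ∃ y : ℝ, y = 16 * M / κ ^ 2 + 16 := ⟨_, rfl⟩
  obtain ⟨C₁, hC₁⟩ : ∃ y : ℝ, y = 4 * M / κ + 4 * C₀ := ⟨_, rfl⟩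
  obtain ⟨a₁, ha₁⟩ : ∃ y : ℝ, y = ∑ j, α j := ⟨_, rfl⟩
  have ha₁0 : 0 ≤ a₁ := ha₁ ▸ Finset.sum_nonneg fun j _ => hα0 j
  obtain ⟨C₂, hC₂⟩ : ∃ y : ℝ, y = ν * (d * C₀) + (N + a₁ * C₁) := ⟨_, rfl⟩
  obtain ⟨H, hH⟩ : ∃ y : ℝ, y = C₀ + C₁ + C₂ := ⟨_, rfl⟩
  have hC₀0 : 0 ≤ C₀ := by rw [hC₀]; positivity
  have hC₁0 : 0 ≤ C₁ := by rw [hC₁]; positivity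
  have hC₂0 : 0 ≤ C₂ := by rw [hC₂]; positivity
  have hH0 : 0 ≤ H := by rw [hH]; positivity
  obtain ⟨Q, hQ⟩ : ∃ y : ℝ, y = 8 / κ + 8 := ⟨_, rfl⟩
  have hQ0 : 0 ≤ Q := by rw [hQ]; positivity
  obtain ⟨C, hC⟩ : ∃ y : ℝ, y = 1 + H + 2 * N + a₁ * Q * (H ^ 2 + H) := ⟨_, rfl⟩
  have hCge : 0 ≤ a₁ * Q * (H ^ 2 + H) := by positivity
  refine ⟨C, min 1 (min r₀ (κ * r₀ / 2)), by linarith, by positivity, min_le_left _ _, ?_⟩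
  intro h u S a ℓ Λ ha hℓ hℓr hΛ hhol
  have hℓ1 : ℓ ≤ 1 := hℓr.trans (min_le_left _ _)
  have hℓr₀ : ℓ ≤ r₀ := hℓr.trans ((min_le_right _ _).trans (min_le_left _ _))
  have pos : ∀ t ∈ Icc a s, 0 < t := fun t ht => ha.trans_le ht.1
  have uM : ∀ t ∈ Icc a s, ∀ x ∈ closure D, |u t x| ≤ M := fun t ht x hx => by
    refine (S.abs_le hD.1 hD.2.2.1 hν hA (pos t ht).le hx).trans ?_
    have : (N + 1) * t ≤ (N + 1) * s := mul_le_mul_of_nonneg_left ht.2 (by linarith)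
    linarith
  have hΛ0 : 0 ≤ Λ := by
    by_contra! hneg
    have : 0 < ℓ ^ (2 + γ) := Real.rpow_pos_of_pos hℓ _
    nlinarith
  have hΛγ : Λ * ℓ ^ γ = 1 / ℓ ^ 2 := by
    rw [Real.rpow_add hℓ, Real.rpow_two] at hΛ
    field_simp
    linarith
  have hess0 : ∀ t ∈ Icc a s, ∀ x ∈ closure D, ‖hess (u t) x‖ ≤ C₀ / ℓ ^ 2 := by
    intro t ht x hx
    have := hcone.hess_le (L := 8 / ℓ ^ 2) (S.twiceDiff (pos t ht).le) hx
      (S.hess_symm hD.1 (pos t ht).le hx) (uM t ht) hℓ hℓr₀ fun y hy hyx => by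
        refine (hhol t ht t ht y hy x hx).trans ?_
        rw [sub_self, abs_zero, Real.zero_rpow (by linarith [hγ.1]), zero_add]
        have h1 : ‖y - x‖ ^ γ ≤ (2 * ℓ) ^ γ := Real.rpow_le_rpow (norm_nonneg _) hyx hγ.1.le
        have h2 : (2:ℝ) ^ γ ≤ 2 := by
          simpa using Real.rpow_le_rpow_of_exponent_le (by norm_num : (1:ℝ) ≤ 2) hγ.2.le
        rw [Real.mul_rpow (by norm_num) hℓ.le] at h1
        calc 4 * Λ * ‖y - x‖ ^ γ ≤ 4 * Λ * (2 ^ γ * ℓ ^ γ) := by gcongr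
          _ = 4 * 2 ^ γ * (Λ * ℓ ^ γ) := by ring
          _ ≤ 4 * 2 * (Λ * ℓ ^ γ) := by
            rw [hΛγ]
            gcongr
          _ = 8 / ℓ ^ 2 := by
            rw [hΛγ]
            ring
    refine this.trans (le_of_eq ?_)
    rw [hC₀]
    field_simp
    ring
  have grad0 : ∀ t ∈ Icc a s, ∀ x ∈ closure D, ‖fderiv ℝ (u t) x‖ ≤ C₁ / ℓ := by
    intro t ht x hx
    refine (hcone.fderiv_le (S.twiceDiff (pos t ht).le) hx (uM t ht) hℓ hℓr₀ (hess0 t ht)).trans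
      (le_of_eq ?_)
    rw [hC₁]
    field_simp
  have hℓ2 : C₁ / ℓ ≤ C₁ / ℓ ^ 2 := by
    refine div_le_div_of_nonneg_left hC₁0 (by positivity) ?_
    nlinarith
  have uI : ∀ t ∈ Icc a s, ∀ x ∈ closure D, u t x ∈ Icc (-M) M := fun t ht x hx =>
    _root_.abs_le.1 (uM t ht x hx)
  have pd : ∀ t ∈ Icc a s, ∀ x ∈ closure D, ∀ j, |fderiv ℝ (u t) x (ebasis d j)| ≤ C₁ / ℓ := by
    intro t ht x hx j
    have := (fderiv ℝ (u t) x).le_opNorm (ebasis d j)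
    rw [norm_ebasis, mul_one] at this
    exact this.trans (grad0 t ht x hx)
  have force0 : ∀ t ∈ Icc a s, ∀ x ∈ closure D, |forcing A h u t x| ≤ N + a₁ * (C₁ / ℓ) := by
    intro t ht x hx
    refine (abs_sub _ _).trans (add_le_add (S.hbound.1 t (pos t ht).le x hx) ?_)
    refine (Finset.abs_sum_le_sum_abs _ _).trans ?_
    rw [ha₁, Finset.sum_mul]
    refine Finset.sum_le_sum fun j _ => ?_
    rw [abs_mul]
    exact mul_le_mul (hα j _ (uI t ht x hx) _ (uI t ht x hx)).1 (pd t ht x hx j) (abs_nonneg _)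
      (hα0 j)
  have dtt0 : ∀ t ∈ Icc a s, ∀ x ∈ closure D, |dtt u t x| ≤ C₂ / ℓ ^ 2 := by
    intro t ht x hx
    rw [S.dtt_eq hA (pos t ht) hx]
    refine (abs_add_le _ _).trans ?_
    have h1 := abs_trace_le (EuclideanSpace.basisFun (Fin d) ℝ) (hess (u t) x)
    rw [Fintype.card_fin] at h1
    have h2 : (d:ℝ) * ‖hess (u t) x‖ ≤ d * (C₀ / ℓ ^ 2) := by
      gcongr
      exact hess0 t ht x hx
    rw [abs_mul, abs_of_pos hν]
    have h3 := mul_le_mul_of_nonneg_left (h1.trans h2) hν.le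
    have h4 := force0 t ht x hx
    have h5 : N ≤ N / ℓ ^ 2 := by
      rw [le_div_iff₀ (by positivity)]
      have : ℓ ^ 2 ≤ 1 := pow_le_one₀ hℓ.le hℓ1
      nlinarith
    have h6 := mul_le_mul_of_nonneg_left hℓ2 ha₁0
    have e : C₂ / ℓ ^ 2 = ν * (d * (C₀ / ℓ ^ 2)) + (N / ℓ ^ 2 + a₁ * (C₁ / ℓ ^ 2)) := by
      rw [hC₂]
      ring
    rw [e]
    linarith
  have hess1 : ∀ t ∈ Icc a s, ∀ x ∈ closure D, ‖hess (u t) x‖ ≤ H / ℓ ^ 2 := fun t ht x hx =>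
    (hess0 t ht x hx).trans (by gcongr; linarith)
  have grad1 : ∀ t ∈ Icc a s, ∀ x ∈ closure D, ‖fderiv ℝ (u t) x‖ ≤ H / ℓ := fun t ht x hx =>
    (grad0 t ht x hx).trans (by gcongr; linarith)
  have dtt1 : ∀ t ∈ Icc a s, ∀ x ∈ closure D, |dtt u t x| ≤ H / ℓ ^ 2 := fun t ht x hx =>
    (dtt0 t ht x hx).trans (by gcongr; linarith)
  have hHC : H ≤ C := by linarith
  refine ⟨fun t ht x hx => (hess1 t ht x hx).trans (by gcongr),
    fun t ht x hx => (grad1 t ht x hx).trans (by gcongr), ?_⟩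
  intro r hr t ht t' ht' x hx x' hx' htt hxx
  have hr0 : 0 < r := hr.1
  have hrr₀ : r ≤ r₀ := hr.2.trans ((min_le_right _ _).trans (min_le_left _ _))
  have hrκ : r ≤ κ * r₀ / 2 := hr.2.trans ((min_le_right _ _).trans (min_le_right _ _))
  have hxx' : 2 * ‖x - x'‖ ≤ κ * r₀ := by linarith
  have hh : |h t x - h t' x'| ≤ 2 * N * r ^ γ := by
    refine (S.hbound.2 t (pos t ht).le t' (pos t' ht').le x hx x' hx').trans ?_
    have h1 : |t - t'| ^ (γ / 2) ≤ r ^ γ := by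
      refine (Real.rpow_le_rpow (abs_nonneg _) htt (by linarith [hγ.1])).trans (le_of_eq ?_)
      rw [← Real.rpow_two, ← Real.rpow_mul hr0.le]
      congr 1
      ring
    have h2 : ‖x - x'‖ ^ γ ≤ r ^ γ := Real.rpow_le_rpow (norm_nonneg _) hxx hγ.1.le
    calc _ ≤ N * (r ^ γ + r ^ γ) := by gcongr
      _ = _ := by ring
  have utt : ∀ y ∈ closure D, |u t y - u t' y| ≤ H / ℓ ^ 2 * r ^ 2 := by
    intro y hy
    have := (convex_Icc a s).norm_image_sub_le_of_norm_hasDerivWithin_le (f := fun t => u t y)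
      (f' := fun t => dtt u t y) (C := H / ℓ ^ 2)
      (fun τ hτ => (S.hasDerivAt_dtt (pos τ hτ).le hy).hasDerivWithinAt)
      (fun τ hτ => dtt1 τ hτ y hy) ht' ht
    exact this.trans (mul_le_mul_of_nonneg_left htt (by positivity))
  have k1 : 4 / κ + 1 ≤ Q := by
    have : 4 / κ ≤ 8 / κ := by gcongr; norm_num
    linarith
  have ud : |u t x - u t' x'| ≤ Q * (H / ℓ ^ 2 * r ^ 2 + H / ℓ * r) := by
    have h1 := utt x hx
    have h2 := hcone.sub_le (S.twiceDiff (pos t' ht').le) hx' hx hxx' (grad1 t' ht')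
    have h3 : (4 / κ + 1) * (H / ℓ) * ‖x - x'‖ ≤ Q * (H / ℓ) * r := by gcongr
    have h4 : 1 ≤ Q := by
      have : 0 ≤ 8 / κ := by positivity
      linarith
    have h5 : 1 * (H / ℓ ^ 2 * r ^ 2) ≤ Q * (H / ℓ ^ 2 * r ^ 2) := by gcongr
    have h6 := abs_add_le (u t x - u t' x) (u t' x - u t' x')
    rw [sub_add_sub_cancel] at h6
    linarith
  have gd : ‖fderiv ℝ (u t) x - fderiv ℝ (u t') x'‖ ≤ Q * (H / ℓ ^ 2 * r) := by
    have h1 := hcone.fderiv_sub_fderiv_le (S.twiceDiff (pos t ht).le) (S.twiceDiff (pos t' ht').le)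
      hx utt hr0 hrr₀ (hess1 t ht) (hess1 t' ht')
    have h2 := hcone.fderiv_sub_le (S.twiceDiff (pos t' ht').le) hx' hx hxx' (hess1 t' ht')
    have h3 : (4 / κ + 1) * (H / ℓ ^ 2) * ‖x - x'‖ ≤ (4 / κ + 1) * (H / ℓ ^ 2) * r := by gcongr
    have h6 := norm_add_le (fderiv ℝ (u t) x - fderiv ℝ (u t') x)
      (fderiv ℝ (u t') x - fderiv ℝ (u t') x')
    rw [sub_add_sub_cancel] at h6
    have e1 : 4 * (H / ℓ ^ 2 * r ^ 2) / (κ * r) = 4 / κ * (H / ℓ ^ 2 * r) := by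
      field_simp
    have e2 : Q * (H / ℓ ^ 2 * r) = 4 / κ * (H / ℓ ^ 2 * r) + 4 * (H / ℓ ^ 2) * r +
        ((4 / κ + 1) * (H / ℓ ^ 2) * r) + 3 * (H / ℓ ^ 2 * r) := by
      rw [hQ]
      ring
    have : 0 ≤ H / ℓ ^ 2 * r := by positivity
    rw [e1] at h1
    linarith
  have term : ∀ j, |deriv (fun v => A v j) (u t x) * fderiv ℝ (u t) x (ebasis d j) -
      deriv (fun v => A v j) (u t' x') * fderiv ℝ (u t') x' (ebasis d j)| ≤
      α j * (Q * (H ^ 2 + H) * (r / ℓ ^ 2 + r ^ 2 / ℓ ^ 3)) := by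
    intro j
    have h1 := (hα j _ (uI t ht x hx) _ (uI t' ht' x' hx')).2
    have h2 := (hα j _ (uI t' ht' x' hx') _ (uI t' ht' x' hx')).1
    have h3 : |fderiv ℝ (u t) x (ebasis d j)| ≤ H / ℓ :=
      (pd t ht x hx j).trans (by gcongr; linarith)
    have h4 : |fderiv ℝ (u t) x (ebasis d j) - fderiv ℝ (u t') x' (ebasis d j)| ≤
        Q * (H / ℓ ^ 2 * r) := by
      have := (fderiv ℝ (u t) x - fderiv ℝ (u t') x').le_opNorm (ebasis d j)
      rw [norm_ebasis, mul_one] at this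
      exact this.trans gd
    have e : deriv (fun v => A v j) (u t x) * fderiv ℝ (u t) x (ebasis d j) -
      deriv (fun v => A v j) (u t' x') * fderiv ℝ (u t') x' (ebasis d j) =
      (deriv (fun v => A v j) (u t x) - deriv (fun v => A v j) (u t' x')) *
        fderiv ℝ (u t) x (ebasis d j) + deriv (fun v => A v j) (u t' x') *
        (fderiv ℝ (u t) x (ebasis d j) - fderiv ℝ (u t') x' (ebasis d j)) := by ring
    rw [e]
    refine (abs_add_le _ _).trans ?_
    rw [abs_mul, abs_mul]
    have m1 := mul_le_mul (h1.trans (mul_le_mul_of_nonneg_left ud (hα0 j))) h3 (abs_nonneg _)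
      (mul_nonneg (hα0 j) (by positivity))
    have m2 := mul_le_mul h2 h4 (abs_nonneg _) (hα0 j)
    refine (add_le_add m1 m2).trans ?_
    have e2 : α j * (Q * (H / ℓ ^ 2 * r ^ 2 + H / ℓ * r)) * (H / ℓ) + α j * (Q * (H / ℓ ^ 2 * r)) =
        α j * (Q * (H ^ 2 * (r / ℓ ^ 2 + r ^ 2 / ℓ ^ 3) + H * (r / ℓ ^ 2))) := by
      field_simp
      ring
    rw [e2, mul_assoc Q, add_mul (H ^ 2)]
    have : 0 ≤ r ^ 2 / ℓ ^ 3 := by positivity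
    refine mul_le_mul_of_nonneg_left (mul_le_mul_of_nonneg_left ?_ hQ0) (hα0 j)
    gcongr
    linarith
  have sumb : |∑ j, (deriv (fun v => A v j) (u t x) * fderiv ℝ (u t) x (ebasis d j) -
      deriv (fun v => A v j) (u t' x') * fderiv ℝ (u t') x' (ebasis d j))| ≤
      a₁ * (Q * (H ^ 2 + H) * (r / ℓ ^ 2 + r ^ 2 / ℓ ^ 3)) := by
    refine (Finset.abs_sum_le_sum_abs _ _).trans ?_
    rw [ha₁, Finset.sum_mul]
    exact Finset.sum_le_sum fun j _ => term j
  have e : forcing A h u t x - forcing A h u t' x' = (h t x - h t' x') -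
      ∑ j, (deriv (fun v => A v j) (u t x) * fderiv ℝ (u t) x (ebasis d j) -
      deriv (fun v => A v j) (u t' x') * fderiv ℝ (u t') x' (ebasis d j)) := by
    rw [Finset.sum_sub_distrib, forcing, forcing]
    ring
  rw [e]
  refine (abs_sub _ _).trans ((add_le_add hh sumb).trans ?_)
  have p1 : 0 ≤ r ^ γ := Real.rpow_nonneg hr0.le _
  have p2 : 0 ≤ r / ℓ ^ 2 + r ^ 2 / ℓ ^ 3 := by positivity
  have q1 : 2 * N * r ^ γ ≤ C * r ^ γ := by
    refine mul_le_mul_of_nonneg_right ?_ p1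
    linarith
  have q2 : a₁ * Q * (H ^ 2 + H) * (r / ℓ ^ 2 + r ^ 2 / ℓ ^ 3) ≤
      C * (r / ℓ ^ 2 + r ^ 2 / ℓ ^ 3) := by
    refine mul_le_mul_of_nonneg_right ?_ p2
    linarith
  calc _ ≤ C * r ^ γ + C * (r / ℓ ^ 2 + r ^ 2 / ℓ ^ 3) := by
        refine add_le_add q1 (le_trans (le_of_eq ?_) q2)
        ring
    _ = _ := by ring

end AdmSol

end

section

/-- Interior-in-time weighted Hölder bound for the second spatial differential. -/
def WeightedHolder {d : ℕ} (D : Set (Euc d)) (γ s : ℝ) (u : ℝ → Euc d → ℝ) (θ : ℝ) : Prop :=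
  ∀ t₁ t₂, 0 < t₁ → t₁ ≤ t₂ → t₂ ≤ s → ∀ x₁ ∈ closure D, ∀ x₂ ∈ closure D,
    t₁ ^ (1 + γ / 2) * ‖hess (u t₁) x₁ - hess (u t₂) x₂‖ ≤
      θ * (|t₁ - t₂| ^ (γ / 2) + ‖x₁ - x₂‖ ^ γ)

/-- A solution and a pair of points almost realising the weighted Hölder seminorm, together
with the associated length scales. -/
structure BlowUp {d : ℕ} (D : Set (Euc d)) (γ ν : ℝ) (A : ℝ → Fin d → ℝ) (N b s C r₁ ε : ℝ) where
  h : ℝ → Euc d → ℝ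
  u : ℝ → Euc d → ℝ
  t₁ : ℝ
  t₂ : ℝ
  x₁ : Euc d
  x₂ : Euc d
  ρ : ℝ
  ℓ : ℝ
  Λ : ℝ
  adm : AdmSol D γ ν A N b h u
  t₁_pos : 0 < t₁
  t₁_le : t₁ ≤ t₂
  t₂_le : t₂ ≤ s
  x₁_mem : x₁ ∈ closure D
  x₂_mem : x₂ ∈ closure D
  ρ_pos : 0 < ρ
  x_le : ‖x₁ - x₂‖ ≤ ρ
  t_le : t₂ - t₁ ≤ ρ ^ 2
  ℓ_pos : 0 < ℓ
  ℓ_le : ℓ ≤ ε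
  Λ_eq : Λ * ℓ ^ (2 + γ) = 1
  ρ_le : ρ ≤ C * ℓ
  ρ_sq_le : ρ ^ 2 ≤ ε ^ 2 * t₁
  big : Λ / 2 * ρ ^ γ ≤ ‖hess (u t₁) x₁ - hess (u t₂) x₂‖
  hol : ∀ t ∈ Icc (t₁ / 2) s, ∀ t' ∈ Icc (t₁ / 2) s, ∀ x ∈ closure D, ∀ x' ∈ closure D,
    ‖hess (u t) x - hess (u t') x'‖ ≤ 4 * Λ * (|t - t'| ^ (γ / 2) + ‖x - x'‖ ^ γ)
  bounds : ScaleBounds D γ A C r₁ (t₁ / 2) s ℓ h u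

theorem WeightedHolder.mono {d : ℕ} {D : Set (Euc d)} {γ s : ℝ} {u : ℝ → Euc d → ℝ} {θ θ' : ℝ}
    (h : WeightedHolder D γ s u θ) (hθ : θ ≤ θ') : WeightedHolder D γ s u θ' := by
  intro t₁ t₂ h1 h12 h2 x₁ hx₁ x₂ hx₂
  refine (h t₁ t₂ h1 h12 h2 x₁ hx₁ x₂ hx₂).trans (mul_le_mul_of_nonneg_right hθ ?_)
  have := Real.rpow_nonneg (abs_nonneg (t₁ - t₂)) (γ / 2)
  have := Real.rpow_nonneg (norm_nonneg (x₁ - x₂)) γ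
  linarith

theorem ScaleBounds.mono {d : ℕ} {D : Set (Euc d)} {γ : ℝ} {A : ℝ → Fin d → ℝ}
    {C C' r₁ a s ℓ : ℝ} {h u : ℝ → Euc d → ℝ} (H : ScaleBounds D γ A C r₁ a s ℓ h u)
    (hC : C ≤ C') (hℓ : 0 < ℓ) : ScaleBounds D γ A C' r₁ a s ℓ h u where
  hess_le t ht x hx := (H.hess_le t ht x hx).trans (by gcongr)
  fderiv_le t ht x hx := (H.fderiv_le t ht x hx).trans (by gcongr)
  forcing_sub_le r hr t ht t' ht' x hx x' hx' h1 h2 := by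
    refine (H.forcing_sub_le r hr t ht t' ht' x hx x' hx' h1 h2).trans ?_
    have : 0 < r := hr.1
    gcongr

namespace AdmSol

variable {d : ℕ} {D : Set (Euc d)} {γ ν : ℝ} {A : ℝ → Fin d → ℝ} {N b : ℝ}

theorem exists_weightedHolder (hγ : γ ∈ Ioo (0:ℝ) 1) {h u : ℝ → Euc d → ℝ}
    (S : AdmSol D γ ν A N b h u) (s : ℝ) : ∃ θ, WeightedHolder D γ s u θ := by
  obtain ⟨N', hN'⟩ := S.mem.2
  refine ⟨s ^ (1 + γ / 2) * |N'|, fun t₁ t₂ h1 h12 h2 x₁ hx₁ x₂ hx₂ => ?_⟩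
  have := hN'.2.2.2.2 t₁ h1.le t₂ (h1.le.trans h12) x₁ hx₁ x₂ hx₂
  have e1 : t₁ ^ (1 + γ / 2) ≤ s ^ (1 + γ / 2) :=
    Real.rpow_le_rpow h1.le (h12.trans h2) (by linarith [hγ.1])
  have e2 : 0 ≤ |t₁ - t₂| ^ (γ / 2) + ‖x₁ - x₂‖ ^ γ := by positivity
  have e3 : ‖hess (u t₁) x₁ - hess (u t₂) x₂‖ ≤
      |N'| * (|t₁ - t₂| ^ (γ / 2) + ‖x₁ - x₂‖ ^ γ) :=
    le_trans this (mul_le_mul_of_nonneg_right (le_abs_self _) e2)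
  rw [mul_assoc]
  exact mul_le_mul e1 e3 (norm_nonneg _) (Real.rpow_nonneg (h1.le.trans (h12.trans h2)) _)

theorem exists_blowUp (hD : GoodDomain D) (hγ : γ ∈ Ioo (0:ℝ) 1) (hν : 0 < ν)
    (hA : ContDiff ℝ 2 A) (hN : 0 ≤ N) (hb : 0 ≤ b) {s : ℝ} (hs : 0 < s) :
    ∃ C r₁ : ℝ, 1 ≤ C ∧ 0 < r₁ ∧ ∀ ε > 0, ∃ θ₀ > 0, ∀ h u, AdmSol D γ ν A N b h u →
      ∀ θ, θ₀ ≤ θ → WeightedHolder D γ s u θ → ¬ WeightedHolder D γ s u (θ / 2) →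
      Nonempty (BlowUp D γ ν A N b s C r₁ ε) := by
  obtain ⟨C, r₁, hC, hr₁, hr₁1, H⟩ := exists_scaleBounds (N := N) (b := b) hD hγ hν hA hN hb hs
  have hγ0 := hγ.1
  obtain ⟨C', hC'⟩ : ∃ y : ℝ, y = max C ((4 * C) ^ (1 / γ)) := ⟨_, rfl⟩
  have hCC' : C ≤ C' := hC' ▸ le_max_left _ _
  have hC'1 : 1 ≤ C' := hC.trans hCC'
  refine ⟨C', r₁, hC'1, hr₁, fun ε hε => ?_⟩
  have htend : Tendsto (fun θ : ℝ => θ ^ (-(1 / (2 + γ)))) atTop (𝓝 0) :=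
    tendsto_rpow_neg_atTop (by positivity)
  have hss : 0 < √s := Real.sqrt_pos.2 hs
  have hev := (htend.eventually (gt_mem_nhds (show 0 < min (ε / C') (min ε r₁ / √s) by positivity)))
  obtain ⟨θ₀, hθ₀⟩ := (hev.and (eventually_gt_atTop 0)).exists_forall_of_atTop
  refine ⟨max θ₀ 1, by positivity, fun h u S θ hθ hW hnW => ?_⟩
  obtain ⟨hη, hθ0⟩ := hθ₀ θ ((le_max_left _ _).trans hθ)
  obtain ⟨η, hηdef⟩ : ∃ y : ℝ, y = θ ^ (-(1 / (2 + γ))) := ⟨_, rfl⟩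
  rw [← hηdef] at hη
  have hη0 : 0 < η := hηdef ▸ Real.rpow_pos_of_pos hθ0 _
  have hη1 : C' * η ≤ ε := by
    have := hη.le.trans (min_le_left _ _)
    rw [le_div_iff₀ (by positivity)] at this
    linarith
  have hη2 : η * √s ≤ min ε r₁ := by
    have := hη.le.trans (min_le_right _ _)
    rwa [le_div_iff₀ hss] at this
  simp only [WeightedHolder, not_forall, not_le] at hnW
  obtain ⟨t₁, t₂, h1, h12, h2, x₁, hx₁, x₂, hx₂, hbig⟩ := hnW
  obtain ⟨Λ, hΛ⟩ : ∃ y : ℝ, y = θ * t₁ ^ (-(1 + γ / 2)) := ⟨_, rfl⟩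
  obtain ⟨ℓ, hℓ⟩ : ∃ y : ℝ, y = η * √t₁ := ⟨_, rfl⟩
  have hst : 0 < √t₁ := Real.sqrt_pos.2 h1
  have hℓ0 : 0 < ℓ := hℓ ▸ mul_pos hη0 hst
  have hΛ0 : 0 < Λ := hΛ ▸ mul_pos hθ0 (Real.rpow_pos_of_pos h1 _)
  have hℓs : ℓ ≤ min ε r₁ := by
    refine le_trans ?_ hη2
    rw [hℓ]
    have : √t₁ ≤ √s := Real.sqrt_le_sqrt (h12.trans h2)
    gcongr
  have hΛℓ : Λ * ℓ ^ (2 + γ) = 1 := by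
    rw [hΛ, hℓ, Real.mul_rpow hη0.le hst.le, hηdef, ← Real.rpow_mul hθ0.le, Real.sqrt_eq_rpow,
      ← Real.rpow_mul h1.le]
    have e1 : -(1 / (2 + γ)) * (2 + γ) = -1 := by field_simp
    have e2 : 1 / 2 * (2 + γ) = 1 + γ / 2 := by ring
    rw [e1, e2, Real.rpow_neg h1.le, Real.rpow_neg_one]
    have := (Real.rpow_pos_of_pos h1 (1 + γ / 2)).ne'
    field_simp
  have hhol : ∀ t ∈ Icc (t₁ / 2) s, ∀ t' ∈ Icc (t₁ / 2) s, ∀ x ∈ closure D, ∀ x' ∈ closure D,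
      ‖hess (u t) x - hess (u t') x'‖ ≤ 4 * Λ * (|t - t'| ^ (γ / 2) + ‖x - x'‖ ^ γ) := by
    have main : ∀ t ∈ Icc (t₁ / 2) s, ∀ t' ∈ Icc (t₁ / 2) s, t ≤ t' → ∀ x ∈ closure D,
        ∀ x' ∈ closure D,
        ‖hess (u t) x - hess (u t') x'‖ ≤ 4 * Λ * (|t - t'| ^ (γ / 2) + ‖x - x'‖ ^ γ) := by
      intro t ht t' ht' htt x hx x' hx'
      have ht0 : 0 < t := (by positivity : 0 < t₁ / 2).trans_le ht.1
      have := hW t t' ht0 htt ht'.2 x hx x' hx'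
      have e2 : 0 ≤ |t - t'| ^ (γ / 2) + ‖x - x'‖ ^ γ := by positivity
      have e3 : (t₁ / 2) ^ (1 + γ / 2) ≤ t ^ (1 + γ / 2) :=
        Real.rpow_le_rpow (by positivity) ht.1 (by positivity)
      have e4 : t₁ ^ (1 + γ / 2) ≤ 4 * (t₁ / 2) ^ (1 + γ / 2) := by
        rw [Real.div_rpow h1.le (by norm_num)]
        have : (2:ℝ) ^ (1 + γ / 2) ≤ 2 ^ (2:ℝ) :=
          Real.rpow_le_rpow_of_exponent_le (by norm_num) (by linarith [hγ.2])
        have p : 0 < (2:ℝ) ^ (1 + γ / 2) := Real.rpow_pos_of_pos (by norm_num) _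
        have p2 : 0 < t₁ ^ (1 + γ / 2) := Real.rpow_pos_of_pos h1 _
        rw [← mul_div_assoc, le_div_iff₀ p]
        norm_num at this
        nlinarith
      have e5 : t₁ ^ (1 + γ / 2) * ‖hess (u t) x - hess (u t') x'‖ ≤
          4 * (θ * (|t - t'| ^ (γ / 2) + ‖x - x'‖ ^ γ)) := by
        have : t₁ ^ (1 + γ / 2) ≤ 4 * t ^ (1 + γ / 2) := by linarith
        have := mul_le_mul_of_nonneg_right this (norm_nonneg (hess (u t) x - hess (u t') x'))
        linarith
      have p2 : 0 < t₁ ^ (1 + γ / 2) := Real.rpow_pos_of_pos h1 _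
      rw [hΛ, Real.rpow_neg h1.le]
      have e6 : 4 * (θ * (t₁ ^ (1 + γ / 2))⁻¹) * (|t - t'| ^ (γ / 2) + ‖x - x'‖ ^ γ) =
          4 * (θ * (|t - t'| ^ (γ / 2) + ‖x - x'‖ ^ γ)) / t₁ ^ (1 + γ / 2) := by
        field_simp
      rw [e6, le_div_iff₀ p2]
      linarith
    intro t ht t' ht' x hx x' hx'
    rcases le_total t t' with hle | hle
    · exact main t ht t' ht' hle x hx x' hx'
    · have := main t' ht' t ht hle x' hx' x hx
      rwa [norm_sub_rev, abs_sub_comm, norm_sub_rev x'] at this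
  have SB := H h u S (t₁ / 2) ℓ Λ (by positivity) hℓ0 (hℓs.trans (min_le_right _ _)) hΛℓ hhol
  obtain ⟨ρ, hρ⟩ : ∃ y : ℝ, y = max ‖x₁ - x₂‖ (√(t₂ - t₁)) := ⟨_, rfl⟩
  have hρ0 : 0 ≤ ρ := hρ ▸ (norm_nonneg _).trans (le_max_left _ _)
  have hxρ : ‖x₁ - x₂‖ ≤ ρ := hρ ▸ le_max_left _ _
  have htρ : √(t₂ - t₁) ≤ ρ := hρ ▸ le_max_right _ _
  have htρ2 : t₂ - t₁ ≤ ρ ^ 2 := by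
    rw [← Real.sqrt_le_left hρ0]
    exact htρ
  have hρpos : 0 < ρ := by
    rcases hρ0.eq_or_lt with h0 | h0
    · exfalso
      rw [← h0] at hxρ htρ2
      have hx : x₁ = x₂ := sub_eq_zero.1 (norm_le_zero_iff.1 hxρ)
      have ht : t₁ = t₂ := by
        have : t₂ - t₁ ≤ 0 := by simpa using htρ2
        linarith
      subst hx ht
      simp only [sub_self, norm_zero, abs_zero, mul_zero] at hbig
      rw [Real.zero_rpow hγ0.ne', Real.zero_rpow (by positivity)] at hbig
      simp at hbig
    · exact h0
  have hq : ρ ^ γ ≤ |t₁ - t₂| ^ (γ / 2) + ‖x₁ - x₂‖ ^ γ := by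
    have n1 : 0 ≤ |t₁ - t₂| ^ (γ / 2) := by positivity
    have n2 : 0 ≤ ‖x₁ - x₂‖ ^ γ := by positivity
    rcases le_total ‖x₁ - x₂‖ (√(t₂ - t₁)) with hle | hle
    · rw [hρ, max_eq_right hle, Real.sqrt_eq_rpow, ← Real.rpow_mul (by linarith),
        abs_sub_comm, abs_of_nonneg (by linarith : 0 ≤ t₂ - t₁)]
      have : 1 / 2 * γ = γ / 2 := by ring
      rw [this]
      linarith
    · rw [hρ, max_eq_left hle]
      linarith
  have hbig2 : Λ / 2 * ρ ^ γ ≤ ‖hess (u t₁) x₁ - hess (u t₂) x₂‖ := by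
    have p2 : 0 < t₁ ^ (1 + γ / 2) := Real.rpow_pos_of_pos h1 _
    have : θ / 2 * ρ ^ γ ≤ t₁ ^ (1 + γ / 2) * ‖hess (u t₁) x₁ - hess (u t₂) x₂‖ :=
      (mul_le_mul_of_nonneg_left hq (by positivity)).trans hbig.le
    rw [hΛ, Real.rpow_neg h1.le]
    have e : θ * (t₁ ^ (1 + γ / 2))⁻¹ / 2 * ρ ^ γ = θ / 2 * ρ ^ γ / t₁ ^ (1 + γ / 2) := by
      field_simp
    rw [e, div_le_iff₀ p2]
    linarith
  have ht₁I : t₁ ∈ Icc (t₁ / 2) s := ⟨by linarith, h12.trans h2⟩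
  have ht₂I : t₂ ∈ Icc (t₁ / 2) s := ⟨by linarith, h2⟩
  have hρℓ : ρ ≤ C' * ℓ := by
    have a1 := SB.hess_le t₁ ht₁I x₁ hx₁
    have a2 := SB.hess_le t₂ ht₂I x₂ hx₂
    have a3 := norm_sub_le (hess (u t₁) x₁) (hess (u t₂) x₂)
    have a4 : Λ * ρ ^ γ ≤ 4 * C / ℓ ^ 2 := by
      have : 4 * C / ℓ ^ 2 = 4 * (C / ℓ ^ 2) := by ring
      rw [this]
      linarith
    have a5 : ρ ^ γ ≤ 4 * C * ℓ ^ γ := by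
      have hpow : ℓ ^ (2 + γ) = ℓ ^ 2 * ℓ ^ γ := by rw [Real.rpow_add hℓ0, Real.rpow_two]
      have p : 0 < ℓ ^ (2 + γ) := Real.rpow_pos_of_pos hℓ0 _
      have := mul_le_mul_of_nonneg_right a4 p.le
      have e : Λ * ρ ^ γ * ℓ ^ (2 + γ) = ρ ^ γ := by
        calc _ = (Λ * ℓ ^ (2 + γ)) * ρ ^ γ := by ring
          _ = _ := by rw [hΛℓ, one_mul]
      rw [e, hpow] at this
      refine this.trans (le_of_eq ?_)
      field_simp
    have a6 := Real.rpow_le_rpow (by positivity) a5 (by positivity : 0 ≤ 1 / γ)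
    rw [← Real.rpow_mul hρ0, Real.mul_rpow (by positivity) (by positivity),
      ← Real.rpow_mul hℓ0.le, mul_one_div_cancel hγ0.ne', Real.rpow_one, Real.rpow_one] at a6
    refine a6.trans ?_
    have : (4 * C) ^ (1 / γ) ≤ C' := hC' ▸ le_max_right _ _
    gcongr
  have hρt : ρ ^ 2 ≤ ε ^ 2 * t₁ := by
    have e1 : ρ ^ 2 ≤ (C' * ℓ) ^ 2 := by gcongr
    have e2 : (C' * ℓ) ^ 2 = (C' * η) ^ 2 * t₁ := by
      rw [hℓ]
      have := Real.sq_sqrt h1.le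
      calc _ = (C' * η) ^ 2 * √t₁ ^ 2 := by ring
        _ = _ := by rw [this]
    rw [e2] at e1
    refine e1.trans ?_
    gcongr
  exact ⟨⟨h, u, t₁, t₂, x₁, x₂, ρ, ℓ, Λ, S, h1, h12, h2, hx₁, hx₂, hρpos, hxρ, htρ2, hℓ0,
    hℓs.trans (min_le_left _ _), hΛℓ, hρℓ, hρt, hbig2, hhol, SB.mono hCC' hℓ0⟩⟩

/-- A uniform weighted Hölder bound follows if no blow-up sequence exists. -/
theorem exists_uniform_weightedHolder (hD : GoodDomain D) (hγ : γ ∈ Ioo (0:ℝ) 1) (hν : 0 < ν)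
    (hA : ContDiff ℝ 2 A) (hN : 0 ≤ N) (hb : 0 ≤ b) {s : ℝ} (hs : 0 < s)
    (hno : ∀ C r₁ : ℝ, 1 ≤ C → 0 < r₁ →
      (∀ n : ℕ, BlowUp D γ ν A N b s C r₁ (1 / (n + 1))) → False) :
    ∃ Θ ≥ 0, ∀ h u, AdmSol D γ ν A N b h u → WeightedHolder D γ s u Θ := by
  by_contra! hcon
  obtain ⟨C, r₁, hC, hr₁, H⟩ := exists_blowUp (N := N) (b := b) hD hγ hν hA hN hb hs
  have key : ∀ n : ℕ, Nonempty (BlowUp D γ ν A N b s C r₁ (1 / (n + 1))) := by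
    intro n
    obtain ⟨θ₀, hθ₀, H'⟩ := H (1 / (n + 1)) (by positivity)
    obtain ⟨h, u, S, hnot⟩ := hcon θ₀ hθ₀.le
    classical
    have hex : ∃ k : ℕ, WeightedHolder D γ s u (θ₀ * 2 ^ k) := by
      obtain ⟨θ, hθ⟩ := S.exists_weightedHolder hγ s
      obtain ⟨k, hk⟩ := pow_unbounded_of_one_lt (θ / θ₀) (by norm_num : (1:ℝ) < 2)
      refine ⟨k, hθ.mono ?_⟩
      rw [div_lt_iff₀ hθ₀] at hk
      linarith
    have hk := Nat.find_spec hex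
    have hmin := fun m => Nat.find_min hex (m := m)
    rcases hkk : Nat.find hex with _ | m
    · rw [hkk] at hk
      exact absurd (by simpa using hk) hnot
    · rw [hkk] at hk
      refine H' h u S (θ₀ * 2 ^ (m + 1)) ?_ hk ?_
      · have : (1:ℝ) ≤ 2 ^ (m + 1) := one_le_pow₀ (by norm_num)
        nlinarith
      · have := hmin m (by omega)
        have e : θ₀ * 2 ^ (m + 1) / 2 = θ₀ * 2 ^ m := by ring
        rwa [e]
  exact hno C r₁ hC hr₁ fun n => (key n).some

end AdmSol

end

section

section RescaledLimit

variable {E ι : Type*} [NormedAddCommGroup E] [InnerProductSpace ℝ E] [Fintype ι]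

/-- A function on `[-T, 0] × S` solving a heat equation with right-hand side `f`, whose second
differential is Hölder continuous with constant `L`. -/
structure ScaledSol (b : OrthonormalBasis ι ℝ E) (ν γ L T : ℝ) (S : Set E) (w f : ℝ → E → ℝ) :
    Prop where
  zero_mem : 0 ∈ S
  nonneg : 0 ≤ T
  twice : ∀ τ ∈ Icc (-T) 0, TwiceDiffOn S (w τ)
  symm : ∀ τ ∈ Icc (-T) 0, ∀ y ∈ S, ∀ e e', hess (w τ) y e e' = hess (w τ) y e' e
  deriv : ∀ τ ∈ Icc (-T) 0, ∀ y ∈ S, HasDerivAt (fun t => w t y)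
    (ν * ∑ i, hess (w τ) y (b i) (b i) + f τ y) τ
  hol : ∀ τ ∈ Icc (-T) 0, ∀ τ' ∈ Icc (-T) 0, ∀ y ∈ S, ∀ z ∈ S,
    ‖hess (w τ) y - hess (w τ') z‖ ≤ L * (|τ - τ'| ^ (γ / 2) + ‖y - z‖ ^ γ)

/-- `w` minus its parabolic second order Taylor polynomial at the origin. -/
def taylorRem (b : OrthonormalBasis ι ℝ E) (ν : ℝ) (w f : ℝ → E → ℝ) (τ : ℝ) (y : E) : ℝ :=
  w τ y - w 0 0 - fderiv ℝ (w 0) 0 y - hess (w 0) 0 y y / 2 -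
    τ * (ν * ∑ i, hess (w 0) 0 (b i) (b i) + f 0 0)

namespace ScaledSol

variable {b : OrthonormalBasis ι ℝ E} {ν γ L T : ℝ} {S : Set E} {w f : ℝ → E → ℝ}

theorem hess_sub_le (h : ScaledSol b ν γ L T S w f) {τ : ℝ}
    (hτ : τ ∈ Icc (-T) 0) {y : E} (hy : y ∈ S) :
    ‖hess (w τ) y - hess (w 0) 0‖ ≤ L * (‖y‖ ^ γ + |τ| ^ (γ / 2)) := by
  have := h.hol τ hτ 0 ⟨by linarith [h.nonneg], le_rfl⟩ y hy 0 h.zero_mem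
  simpa [add_comm] using this

theorem taylor_le (h : ScaledSol b ν γ L T S w f) (hγ : 0 < γ) (hL : 0 ≤ L) {τ : ℝ}
    (hτ : τ ∈ Icc (-T) 0) {y e : E} (hs : SegIn S y e) :
    |w τ (y + e) - w τ y - fderiv ℝ (w τ) y e - hess (w τ) y e e / 2| ≤ L * ‖e‖ ^ (2 + γ) := by
  have := taylor_on_segment (h.twice τ hτ) hs (B := hess (w τ) y) (K := L * ‖e‖ ^ γ) (by
    intro σ hσ
    refine (h.hol τ hτ τ hτ _ (hs σ hσ) _ hs.left).trans ?_
    gcongr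
    have : ‖σ • e‖ ≤ ‖e‖ := by
      rw [norm_smul, Real.norm_of_nonneg hσ.1]
      exact mul_le_of_le_one_left (norm_nonneg _) hσ.2
    rw [sub_self, abs_zero, Real.zero_rpow (by positivity), zero_add, add_sub_cancel_left]
    exact Real.rpow_le_rpow (norm_nonneg _) this hγ.le)
  refine this.trans (le_of_eq ?_)
  rw [add_comm, Real.rpow_add_of_nonneg (norm_nonneg _) hγ.le (by norm_num), ← mul_assoc]
  norm_cast

theorem space_le (h : ScaledSol b ν γ L T S w f) (hγ : 0 < γ) (hL : 0 ≤ L) {τ : ℝ}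
    (hτ : τ ∈ Icc (-T) 0) {y e : E} (hs : SegIn S y e) (hs' : SegIn S y (-e)) :
    |taylorRem b ν w f τ (y + e) + taylorRem b ν w f τ (y - e) - 2 * taylorRem b ν w f τ y -
      (hess (w τ) y - hess (w 0) 0) e e| ≤ 2 * L * ‖e‖ ^ (2 + γ) := by
  have h1 := h.taylor_le hγ hL hτ hs
  have h2 := h.taylor_le hγ hL hτ hs'
  rw [norm_neg] at h2
  have : taylorRem b ν w f τ (y + e) + taylorRem b ν w f τ (y - e) - 2 * taylorRem b ν w f τ y -
      (hess (w τ) y - hess (w 0) 0) e e =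
      (w τ (y + e) - w τ y - fderiv ℝ (w τ) y e - hess (w τ) y e e / 2) +
      (w τ (y + -e) - w τ y - fderiv ℝ (w τ) y (-e) - hess (w τ) y (-e) (-e) / 2) := by
    simp only [taylorRem, sub_apply, map_add, map_sub, map_neg, add_apply, neg_apply,
      ← sub_eq_add_neg]
    ring
  rw [this]
  refine (abs_add_le _ _).trans ?_
  linarith

theorem init_le (h : ScaledSol b ν γ L T S w f) (hγ : 0 < γ) (hL : 0 ≤ L) {y : E}
    (hs : SegIn S 0 y) : |taylorRem b ν w f 0 y| ≤ L * ‖y‖ ^ (2 + γ) := by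
  have := h.taylor_le hγ hL (τ := 0) ⟨by linarith [h.nonneg], le_rfl⟩ hs
  simpa [taylorRem] using this

theorem time_le (h : ScaledSol b ν γ L T S w f) (hγ : 0 < γ) (hν : 0 ≤ ν) (hL : 0 ≤ L)
    {τ σ ε : ℝ} (hσ : 0 ≤ σ) (hτ : τ ≤ 0) (hτσ : -T ≤ τ - σ) {y : E} (hy : y ∈ S)
    (hε : ∀ τ' ∈ Icc (τ - σ) τ, |f τ' y - f 0 0| ≤ ε) :
    |taylorRem b ν w f τ y - taylorRem b ν w f (τ - σ) y -
      σ * (ν * ∑ i, (hess (w τ) y - hess (w 0) 0) (b i) (b i))| ≤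
      σ * (ν * (Fintype.card ι * L) * σ ^ (γ / 2) + ε) := by
  obtain ⟨q, hq⟩ : ∃ q : ℝ, q = ν * ∑ i, hess (w τ) y (b i) (b i) + f 0 0 := ⟨_, rfl⟩
  have hτ' : τ ∈ Icc (-T) 0 := ⟨by linarith, hτ⟩
  have key := norm_image_sub_le_of_norm_deriv_le_segment' (a := τ - σ) (b := τ)
    (C := ν * (Fintype.card ι * L) * σ ^ (γ / 2) + ε) (f := fun t => w t y - t * q)
    (f' := fun t => ν * ∑ i, hess (w t) y (b i) (b i) + f t y - q) ?_ ?_ τ ⟨by linarith, le_rfl⟩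
  · have e1 : taylorRem b ν w f τ y - taylorRem b ν w f (τ - σ) y -
      σ * (ν * ∑ i, (hess (w τ) y - hess (w 0) 0) (b i) (b i)) =
        (w τ y - τ * q) - (w (τ - σ) y - (τ - σ) * q) := by
      simp only [taylorRem, hq, sub_apply, Finset.sum_sub_distrib]
      ring
    rw [e1, ← Real.norm_eq_abs]
    refine key.trans (le_of_eq ?_)
    ring
  · intro t ht
    have h1 := h.deriv t ⟨hτσ.trans ht.1, ht.2.trans hτ⟩ y hy
    have h2 := (hasDerivAt_id t).mul_const q
    simpa using! (h1.sub h2).hasDerivWithinAt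
  · intro t ht
    have ht' : t ∈ Icc (-T) 0 := ⟨hτσ.trans ht.1, ht.2.le.trans hτ⟩
    have e1 : ν * ∑ i, hess (w t) y (b i) (b i) + f t y - q =
        ν * ∑ i, (hess (w t) y - hess (w τ) y) (b i) (b i) + (f t y - f 0 0) := by
      simp only [hq, sub_apply, Finset.sum_sub_distrib]
      ring
    rw [e1, Real.norm_eq_abs]
    refine (abs_add_le _ _).trans ?_
    refine add_le_add ?_ (hε t ⟨ht.1, ht.2.le⟩)
    rw [abs_mul, abs_of_nonneg hν, mul_assoc]
    gcongr
    refine (abs_trace_le b _).trans ?_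
    rw [mul_assoc]
    gcongr
    refine (h.hol t ht' τ hτ' y hy y hy).trans ?_
    rw [sub_self, norm_zero, Real.zero_rpow hγ.ne', add_zero]
    gcongr
    rw [abs_le]; constructor <;> linarith [ht.1, ht.2]

end ScaledSol

theorem exists_ultrafilter_lim {V : Type*} [NormedAddCommGroup V] [ProperSpace V]
    (F : Ultrafilter ℕ) {g : ℕ → V} {B : ℝ} (hg : ∀ᶠ n in (F : Filter ℕ), ‖g n‖ ≤ B) :
    ∃ x, Tendsto g F (𝓝 x) := by
  have hc := isCompact_closedBall (0 : V) B
  have := hc.ultrafilter_le_nhds (F.map g) (by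
    rw [le_principal_iff, Ultrafilter.coe_map, Filter.mem_map]
    filter_upwards [hg] with n hn
    simpa using hn)
  obtain ⟨x, -, hx⟩ := this
  exact ⟨x, hx⟩

variable [FiniteDimensional ℝ E]

theorem exists_isLimitPair (F : Ultrafilter ℕ) {b : OrthonormalBasis ι ℝ E} {ν γ L : ℝ}
    (hν : 0 ≤ ν) (hγ : 0 < γ) (hL : 0 ≤ L) {T : ℕ → ℝ} {S : ℕ → Set E} {w f : ℕ → ℝ → E → ℝ}
    (h : ∀ n, ScaledSol b ν γ L (T n) (S n) (w n) (f n))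
    (hT : ∀ R, ∀ᶠ n in (F : Filter ℕ), R ≤ T n)
    (hf : ∀ R, ∀ ε > 0, ∀ᶠ n in (F : Filter ℕ), ∀ τ ∈ Icc (-R) 0, ∀ y ∈ S n, ‖y‖ ≤ R →
      |f n τ y - f n 0 0| ≤ ε)
    {Ω : Set E} (h0 : ∀ y ∈ Ω, ∀ᶠ n in (F : Filter ℕ), SegIn (S n) 0 y)
    (hseg : ∀ y ∈ Ω, ∀ e, y + e ∈ Ω → ∀ᶠ n in (F : Filter ℕ), SegIn (S n) y e) :
    ∃ v M, IsLimitPair b ν γ (2 * L + ν * (Fintype.card ι * L)) Ω v M ∧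
      (∀ τ ≤ 0, ∀ y ∈ Ω, Tendsto (fun n => taylorRem b ν (w n) (f n) τ y) F (𝓝 (v τ y))) ∧
      ∀ τ ≤ 0, ∀ y ∈ Ω, Tendsto (fun n => hess (w n τ) y - hess (w n 0) 0) F (𝓝 (M τ y)) := by
  have hmem : ∀ y ∈ Ω, ∀ᶠ n in (F : Filter ℕ), y ∈ S n := by
    intro y hy
    filter_upwards [h0 y hy] with n hn
    simpa using hn.right
  have hIcc : ∀ τ ≤ 0, ∀ᶠ n in (F : Filter ℕ), τ ∈ Icc (-T n) 0 := by
    intro τ hτ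
    filter_upwards [hT (-τ)] with n hn
    exact ⟨by linarith, hτ⟩
  have hM : ∀ τ ≤ 0, ∀ y ∈ Ω, ∀ᶠ n in (F : Filter ℕ),
      ‖hess (w n τ) y - hess (w n 0) 0‖ ≤ L * (‖y‖ ^ γ + |τ| ^ (γ / 2)) := by
    intro τ hτ y hy
    filter_upwards [hmem y hy, hIcc τ hτ] with n hn hn'
    exact (h n).hess_sub_le hn' hn
  have htime : ∀ τ ≤ 0, ∀ σ ≥ 0, ∀ y ∈ Ω, ∀ ε > 0, ∀ᶠ n in (F : Filter ℕ),
      |taylorRem b ν (w n) (f n) τ y - taylorRem b ν (w n) (f n) (τ - σ) y -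
      σ * (ν * ∑ i, (hess (w n τ) y - hess (w n 0) 0) (b i) (b i))| ≤
      σ * (ν * (Fintype.card ι * L) * σ ^ (γ / 2) + ε) := by
    intro τ hτ σ hσ y hy ε hε
    filter_upwards [hmem y hy, hIcc (τ - σ) (by linarith), hf (max (σ - τ) ‖y‖) ε hε]
      with n hn hn' hn2
    refine (h n).time_le hγ hν hL hσ hτ hn'.1 hn ?_
    intro τ' hτ'
    refine hn2 τ' ⟨?_, hτ'.2.trans hτ⟩ y hn (le_max_right _ _)
    have := le_max_left (σ - τ) ‖y‖
    linarith [hτ'.1]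
  have hinit : ∀ y ∈ Ω, ∀ᶠ n in (F : Filter ℕ),
      |taylorRem b ν (w n) (f n) 0 y| ≤ L * ‖y‖ ^ (2 + γ) := by
    intro y hy
    filter_upwards [h0 y hy] with n hn
    exact (h n).init_le hγ hL hn
  have hMex : ∀ τ ≤ 0, ∀ y ∈ Ω, ∃ B,
      Tendsto (fun n => hess (w n τ) y - hess (w n 0) 0) F (𝓝 B) := fun τ hτ y hy =>
    haveI : ProperSpace (E →L[ℝ] E →L[ℝ] ℝ) := FiniteDimensional.proper ℝ _
    exists_ultrafilter_lim F (hM τ hτ y hy)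
  have hvex : ∀ τ ≤ 0, ∀ y ∈ Ω, ∃ c,
      Tendsto (fun n => taylorRem b ν (w n) (f n) τ y) F (𝓝 c) := by
    intro τ hτ y hy
    refine exists_ultrafilter_lim F (B := L * ‖y‖ ^ (2 + γ) + (-τ) *
      (ν * (Fintype.card ι * L) * (-τ) ^ (γ / 2) + 1) + (-τ) * (ν * (Fintype.card ι *
        (L * (‖y‖ ^ γ + |(0:ℝ)| ^ (γ / 2)))))) ?_
    filter_upwards [htime 0 le_rfl (-τ) (by linarith) y hy 1 one_pos, hinit y hy,
      hM 0 le_rfl y hy] with n h1 h2 h3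
    obtain ⟨tr, htr⟩ : ∃ x : ℝ, x = ∑ i, (hess (w n 0) y - hess (w n 0) 0) (b i) (b i) := ⟨_, rfl⟩
    have h4 : |tr| ≤ Fintype.card ι * (L * (‖y‖ ^ γ + |(0:ℝ)| ^ (γ / 2))) := by
      rw [htr]
      refine (abs_trace_le b _).trans ?_
      gcongr
    rw [← htr] at h1
    rw [zero_sub, neg_neg] at h1
    have h5 : |(-τ) * (ν * tr)| ≤ (-τ) * (ν * (Fintype.card ι *
        (L * (‖y‖ ^ γ + |(0:ℝ)| ^ (γ / 2))))) := by
      rw [abs_mul, abs_mul, abs_of_nonneg (by linarith : 0 ≤ -τ), abs_of_nonneg hν]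
      have : 0 ≤ -τ := by linarith
      gcongr
    rw [Real.norm_eq_abs]
    rw [abs_le] at h1 h2 h5 ⊢
    constructor <;> linarith [h1.1, h1.2, h2.1, h2.2, h5.1, h5.2]
  choose! M hMt using hMex
  choose! v hvt using hvex
  have hMapp : ∀ τ ≤ 0, ∀ y ∈ Ω, ∀ e e', Tendsto (fun n => (hess (w n τ) y - hess (w n 0) 0) e e') F
      (𝓝 (M τ y e e')) := by
    intro τ hτ y hy e e'
    have h1 : Continuous fun B : E →L[ℝ] E →L[ℝ] ℝ => B e e' := by fun_prop
    exact (h1.tendsto _).comp (hMt τ hτ y hy)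
  have hcard : 0 ≤ ν * (Fintype.card ι * L) := by positivity
  refine ⟨v, M, ⟨?_, ?_, ?_, ?_, ?_⟩, hvt, hMt⟩
  · intro τ hτ y hy e e'
    refine tendsto_nhds_unique (hMapp τ hτ y hy e e') ((hMapp τ hτ y hy e' e).congr' ?_)
    filter_upwards [hmem y hy, hIcc τ hτ, hIcc 0 le_rfl] with n hn hn' hn2
    simp only [sub_apply]
    rw [(h n).symm τ hn' y hn e e', (h n).symm 0 hn2 0 (h n).zero_mem e e']
  · intro τ hτ y hy
    have := le_of_tendsto (hMt τ hτ y hy).norm (hM τ hτ y hy)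
    refine this.trans ?_
    gcongr
    linarith
  · intro τ hτ y hy e he he'
    have h1 : Tendsto (fun n => |taylorRem b ν (w n) (f n) τ (y + e) +
        taylorRem b ν (w n) (f n) τ (y - e) - 2 * taylorRem b ν (w n) (f n) τ y -
        (hess (w n τ) y - hess (w n 0) 0) e e|) F
        (𝓝 |v τ (y + e) + v τ (y - e) - 2 * v τ y - M τ y e e|) :=
      ((((hvt τ hτ _ he).add (hvt τ hτ _ he')).sub ((hvt τ hτ y hy).const_mul 2)).sub
        (hMapp τ hτ y hy e e)).abs
    refine (le_of_tendsto h1 (b := 2 * L * ‖e‖ ^ (2 + γ)) ?_).trans ?_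
    · filter_upwards [hIcc τ hτ, hseg y hy e he, hseg y hy (-e) (by rwa [← sub_eq_add_neg])]
        with n hn hn' hn2
      exact (h n).space_le hγ hL hn hn' hn2
    · gcongr
      linarith
  · intro τ hτ σ hσ y hy
    have h1 : Tendsto (fun n => |taylorRem b ν (w n) (f n) τ y -
        taylorRem b ν (w n) (f n) (τ - σ) y -
        σ * (ν * ∑ i, (hess (w n τ) y - hess (w n 0) 0) (b i) (b i))|) F
        (𝓝 |v τ y - v (τ - σ) y - σ * (ν * ∑ i, M τ y (b i) (b i))|) :=
      (((hvt τ hτ y hy).sub (hvt (τ - σ) (by linarith) y hy)).sub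
        ((tendsto_finsetSum _ fun i _ => hMapp τ hτ y hy (b i) (b i)).const_mul ν
          |>.const_mul σ)).abs
    have h2 : ∀ ε > 0, |v τ y - v (τ - σ) y - σ * (ν * ∑ i, M τ y (b i) (b i))| ≤
        σ * (ν * (Fintype.card ι * L) * σ ^ (γ / 2) + ε) := fun ε hε =>
      le_of_tendsto h1 (htime τ hτ σ hσ y hy ε hε)
    have h3 : |v τ y - v (τ - σ) y - σ * (ν * ∑ i, M τ y (b i) (b i))| ≤
        σ * (ν * (Fintype.card ι * L) * σ ^ (γ / 2)) := by
      have h4 : Tendsto (fun ε : ℝ => σ * (ν * (Fintype.card ι * L) * σ ^ (γ / 2) + ε)) (𝓝[>] 0)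
          (𝓝 (σ * (ν * (Fintype.card ι * L) * σ ^ (γ / 2) + 0))) := by
        refine Tendsto.mono_left ?_ nhdsWithin_le_nhds
        exact (Continuous.tendsto (by fun_prop) _)
      rw [add_zero] at h4
      refine ge_of_tendsto h4 ?_
      filter_upwards [self_mem_nhdsWithin] with ε hε
      exact h2 ε hε
    refine h3.trans ?_
    rw [Real.rpow_add_of_nonneg hσ zero_le_one (by positivity), Real.rpow_one]
    have : 0 ≤ σ * σ ^ (γ / 2) := by positivity
    nlinarith
  · intro y hy
    have := le_of_tendsto (hvt 0 le_rfl y hy).abs (hinit y hy)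
    refine this.trans ?_
    gcongr
    linarith

/-- If the limiting second differential vanishes then the second differentials at bounded points
tend to the one at the origin. -/
theorem tendsto_hess_of_limit_eq_zero (F : Ultrafilter ℕ) {b : OrthonormalBasis ι ℝ E}
    {ν γ L R : ℝ} (hγ : 0 < γ) (hL : 0 ≤ L) {T : ℕ → ℝ} {S : ℕ → Set E}
    {w f : ℕ → ℝ → E → ℝ}
    (h : ∀ n, ScaledSol b ν γ L (T n) (S n) (w n) (f n))
    (hT : ∀ R, ∀ᶠ n in (F : Filter ℕ), R ≤ T n) {Ω : Set E}
    (h0 : ∀ y ∈ Ω, ∀ᶠ n in (F : Filter ℕ), SegIn (S n) 0 y)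
    (hM : ∀ τ ≤ 0, ∀ y ∈ Ω, Tendsto (fun n => hess (w n τ) y - hess (w n 0) 0) F (𝓝 0))
    {τ : ℕ → ℝ} {y : ℕ → E} (hτ : ∀ᶠ n in (F : Filter ℕ), τ n ∈ Icc (-R) 0)
    (hy : ∀ᶠ n in (F : Filter ℕ), y n ∈ S n)
    {y₀ : E} (hy₀ : Tendsto y F (𝓝 y₀)) (hmem : y₀ ∈ closure Ω) :
    Tendsto (fun n => hess (w n (τ n)) (y n) - hess (w n 0) 0) F (𝓝 0) := by
  obtain ⟨τ₀, hτ₀⟩ := exists_ultrafilter_lim F (g := τ) (B := R) (by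
    filter_upwards [hτ] with n hn
    rw [Real.norm_eq_abs, abs_le]
    exact ⟨hn.1, by linarith [hn.1, hn.2]⟩)
  have hτ₀' : τ₀ ≤ 0 := le_of_tendsto hτ₀ (hτ.mono fun n hn => hn.2)
  rw [Metric.tendsto_nhds]
  intro ε hε
  have hcont : Tendsto (fun x : ℝ => L * (x ^ (γ / 2) + x ^ γ)) (𝓝 0) (𝓝 0) := by
    have := ((Real.continuousAt_rpow_const 0 (γ / 2) (Or.inr (by positivity))).add
      (Real.continuousAt_rpow_const 0 γ (Or.inr hγ.le))).tendsto.const_mul L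
    simpa [Real.zero_rpow hγ.ne', Real.zero_rpow (by positivity : γ / 2 ≠ 0)] using this
  obtain ⟨δ, hδ, hδ'⟩ := Metric.eventually_nhds_iff.1
    (hcont.eventually (gt_mem_nhds (half_pos hε)))
  obtain ⟨z, hz, hzd⟩ := Metric.mem_closure_iff.1 hmem (δ / 4) (by positivity)
  have hclose : ∀ᶠ n in (F : Filter ℕ), dist (y n) y₀ < δ / 4 :=
    Metric.tendsto_nhds.1 hy₀ _ (by positivity)
  have hclose' : ∀ᶠ n in (F : Filter ℕ), dist (τ n) τ₀ < δ / 2 :=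
    Metric.tendsto_nhds.1 hτ₀ _ (by positivity)
  have hMz := Metric.tendsto_nhds.1 (hM τ₀ hτ₀' z hz) (ε / 2) (by positivity)
  filter_upwards [hclose, hclose', hMz, hτ, hy, h0 z hz, hT R, hT (-τ₀)] with
    n h1 h2 h3 h4 h5 h6 h7 h8
  have hz' : z ∈ S n := by simpa using h6.right
  have h9 := (h n).hol (τ n) ⟨by linarith [h4.1], h4.2⟩ τ₀ ⟨by linarith, hτ₀'⟩ (y n) h5 z hz'
  rw [dist_zero_right] at h3 ⊢
  have h10 : ‖y n - z‖ ≤ δ / 2 := by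
    rw [← dist_eq_norm]
    linarith [dist_triangle (y n) y₀ z]
  have h11 : |τ n - τ₀| ≤ δ / 2 := by
    rw [← Real.dist_eq]; exact h2.le
  have h12 := hδ' (y := δ / 2) (by
    rw [Real.dist_eq, sub_zero, abs_of_pos (by positivity)]; linarith)
  have h13 : L * (|τ n - τ₀| ^ (γ / 2) + ‖y n - z‖ ^ γ) ≤
      L * ((δ / 2) ^ (γ / 2) + (δ / 2) ^ γ) := by
    gcongr
  calc ‖hess (w n (τ n)) (y n) - hess (w n 0) 0‖
      = ‖(hess (w n (τ n)) (y n) - hess (w n τ₀) z) + (hess (w n τ₀) z - hess (w n 0) 0)‖ := by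
        congr 1; abel
    _ ≤ _ := norm_add_le _ _
    _ < ε := by linarith

end RescaledLimit

end

section

theorem fderiv_rescale {E V : Type*} [NormedAddCommGroup E] [NormedSpace ℝ E]
    [NormedAddCommGroup V] [NormedSpace ℝ V] (G : E → V) (c ρ : ℝ) (p y : E) :
    fderiv ℝ (fun y => c • G (p + ρ • y)) y = (c * ρ) • fderiv ℝ G (p + ρ • y) := by
  have h1 : fderiv ℝ (fun y => G (p + ρ • y)) y = ρ • fderiv ℝ G (p + ρ • y) := by
    have := fderiv_comp_smul (𝕜 := ℝ) (f := fun z => G (p + z)) (x := y) ρ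
    rwa [fderiv_comp_add_left] at this
  change fderiv ℝ (c • fun y => G (p + ρ • y)) y = _
  rw [fderiv_const_smul_field, Pi.smul_apply, h1, smul_smul]

theorem fderiv_rescale_fun {E : Type*} [NormedAddCommGroup E] [InnerProductSpace ℝ E] (g : E → ℝ)
    (c ρ : ℝ) (p : E) : (fun y => fderiv ℝ (fun y => c * g (p + ρ • y)) y) =
      fun y => (c * ρ) • fderiv ℝ g (p + ρ • y) := by
  funext y
  exact fderiv_rescale g c ρ p y

theorem hess_rescale {E : Type*} [NormedAddCommGroup E] [InnerProductSpace ℝ E] (g : E → ℝ)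
    (c ρ : ℝ) (p y : E) :
    hess (fun y => c * g (p + ρ • y)) y = (c * ρ ^ 2) • hess g (p + ρ • y) := by
  rw [hess, fderiv_rescale_fun, fderiv_rescale (fun z => fderiv ℝ g z), hess]
  congr 1; ring

theorem TwiceDiffOn.rescale {E : Type*} [NormedAddCommGroup E] [InnerProductSpace ℝ E]
    {g : E → ℝ} {S : Set E} (hg : TwiceDiffOn S g) (c ρ : ℝ) (p : E) :
    TwiceDiffOn {y | p + ρ • y ∈ S} (fun y => c * g (p + ρ • y)) := by
  intro y hy
  have h1 : DifferentiableAt ℝ (fun y : E => p + ρ • y) y := by fun_prop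
  refine ⟨((hg _ hy).1.comp y h1).const_mul c, ?_⟩
  rw [fderiv_rescale_fun]
  exact ((hg _ hy).2.comp y h1).const_smul (c * ρ)

namespace BlowUp

variable {d : ℕ} {D : Set (Euc d)} {γ ν : ℝ} {A : ℝ → Fin d → ℝ} {N b s C r₁ ε : ℝ}

/-- Normalising factor of the second differential. -/
def scale (X : BlowUp D γ ν A N b s C r₁ ε) : ℝ := (X.Λ * X.ρ ^ γ)⁻¹

/-- The rescaled solution, centred at `p`. -/
def sol (X : BlowUp D γ ν A N b s C r₁ ε) (p : Euc d) (τ : ℝ) (y : Euc d) : ℝ :=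
  X.scale / X.ρ ^ 2 * X.u (X.t₂ + X.ρ ^ 2 * τ) (p + X.ρ • y)

/-- The rescaled right-hand side. -/
def rhs (X : BlowUp D γ ν A N b s C r₁ ε) (p : Euc d) (τ : ℝ) (y : Euc d) : ℝ :=
  X.scale * forcing A X.h X.u (X.t₂ + X.ρ ^ 2 * τ) (p + X.ρ • y)

/-- The rescaled domain. -/
def dom (X : BlowUp D γ ν A N b s C r₁ ε) (p : Euc d) : Set (Euc d) :=
  {y | p + X.ρ • y ∈ closure D}

variable (X : BlowUp D γ ν A N b s C r₁ ε)

theorem Λ_pos : 0 < X.Λ := by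
  have h1 : 0 < X.ℓ ^ (2 + γ) := Real.rpow_pos_of_pos X.ℓ_pos _
  have := X.Λ_eq
  by_contra! hcon
  nlinarith

theorem scale_pos : 0 < X.scale :=
  inv_pos.2 (mul_pos X.Λ_pos (Real.rpow_pos_of_pos X.ρ_pos _))

theorem scale_mul : X.scale * (X.Λ * X.ρ ^ γ) = 1 :=
  inv_mul_cancel₀ (mul_pos X.Λ_pos (Real.rpow_pos_of_pos X.ρ_pos _)).ne'

theorem scale_eq : X.scale = X.ℓ ^ 2 * (X.ℓ ^ γ / X.ρ ^ γ) := by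
  have h1 : 0 < X.ρ ^ γ := Real.rpow_pos_of_pos X.ρ_pos _
  have h2 := X.scale_mul
  have h3 := X.Λ_eq
  rw [Real.rpow_add X.ℓ_pos, Real.rpow_two] at h3
  field_simp
  calc X.scale * X.ρ ^ γ = X.scale * X.ρ ^ γ * (X.Λ * (X.ℓ ^ 2 * X.ℓ ^ γ)) := by rw [h3, mul_one]
    _ = (X.scale * (X.Λ * X.ρ ^ γ)) * (X.ℓ ^ 2 * X.ℓ ^ γ) := by ring
    _ = _ := by rw [h2, one_mul]

theorem ρ_mul_le (hγ : γ ∈ Ioo (0:ℝ) 1) (hC : 1 ≤ C) :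
    X.ρ * (X.ℓ ^ γ / X.ρ ^ γ) ≤ C * X.ℓ := by
  have h0 := X.ρ_pos
  have h1 : X.ρ * (X.ℓ ^ γ / X.ρ ^ γ) = X.ρ ^ (1 - γ) * X.ℓ ^ γ := by
    rw [Real.rpow_sub X.ρ_pos, Real.rpow_one]; ring
  have h2 : X.ρ ^ (1 - γ) ≤ C * X.ℓ ^ (1 - γ) := by
    refine (Real.rpow_le_rpow h0.le X.ρ_le (by linarith [hγ.2])).trans ?_
    rw [Real.mul_rpow (by linarith) X.ℓ_pos.le]
    refine mul_le_mul_of_nonneg_right ?_ (Real.rpow_nonneg X.ℓ_pos.le _)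
    simpa using Real.rpow_le_rpow_of_exponent_le hC (by linarith [hγ.1] : 1 - γ ≤ 1)
  rw [h1]
  refine (mul_le_mul_of_nonneg_right h2 (Real.rpow_nonneg X.ℓ_pos.le _)).trans (le_of_eq ?_)
  rw [mul_assoc, ← Real.rpow_add X.ℓ_pos]
  norm_num

theorem ratio_nonneg : 0 ≤ X.ℓ ^ γ / X.ρ ^ γ :=
  div_nonneg (Real.rpow_nonneg X.ℓ_pos.le _) (Real.rpow_nonneg X.ρ_pos.le _)

theorem time_mem (hε : 0 < ε) {τ : ℝ} (hτ : τ ∈ Icc (-(1 / (2 * ε ^ 2))) 0) :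
    X.t₂ + X.ρ ^ 2 * τ ∈ Icc (X.t₁ / 2) s := by
  have h1 := X.ρ_sq_le
  have h2 := X.t₁_le
  have h3 := X.t₂_le
  have h4 := X.t₁_pos
  have h5 : X.ρ ^ 2 * (1 / (2 * ε ^ 2)) ≤ X.t₁ / 2 := by
    rw [mul_one_div, div_le_div_iff₀ (by positivity) (by norm_num)]
    linarith
  have h6 := X.ρ_pos
  constructor
  · nlinarith [mul_le_mul_of_nonneg_left hτ.1 (sq_nonneg X.ρ)]
  · nlinarith [mul_nonneg (sq_nonneg X.ρ) (neg_nonneg.2 hτ.2)]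

theorem hess_sol (p : Euc d) (τ : ℝ) (y : Euc d) :
    hess (X.sol p τ) y = X.scale • hess (X.u (X.t₂ + X.ρ ^ 2 * τ)) (p + X.ρ • y) := by
  have := hess_rescale (X.u (X.t₂ + X.ρ ^ 2 * τ)) (X.scale / X.ρ ^ 2) X.ρ p y
  rw [div_mul_cancel₀ _ (pow_ne_zero 2 X.ρ_pos.ne')] at this
  exact this

theorem fderiv_sol (p : Euc d) (τ : ℝ) (y : Euc d) :
    fderiv ℝ (X.sol p τ) y =
      (X.scale / X.ρ) • fderiv ℝ (X.u (X.t₂ + X.ρ ^ 2 * τ)) (p + X.ρ • y) := by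
  have := fderiv_rescale (X.u (X.t₂ + X.ρ ^ 2 * τ)) (X.scale / X.ρ ^ 2) X.ρ p y
  have h1 : X.scale / X.ρ ^ 2 * X.ρ = X.scale / X.ρ := by
    have := X.ρ_pos
    field_simp
  rw [h1] at this
  exact this

theorem sum_hess_sol (p : Euc d) (τ : ℝ) (y : Euc d) :
    ∑ i, hess (X.sol p τ) y (EuclideanSpace.basisFun (Fin d) ℝ i)
      (EuclideanSpace.basisFun (Fin d) ℝ i) =
    X.scale * ∑ i, hess (X.u (X.t₂ + X.ρ ^ 2 * τ)) (p + X.ρ • y)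
      (EuclideanSpace.basisFun (Fin d) ℝ i) (EuclideanSpace.basisFun (Fin d) ℝ i) := by
  simp only [hess_sol, smul_apply, smul_eq_mul, Finset.mul_sum]

theorem scaledSol (hD : IsOpen D) (hA : ContDiff ℝ 2 A) (hε : 0 < ε) {p : Euc d}
    (hp : p ∈ closure D) :
    ScaledSol (EuclideanSpace.basisFun (Fin d) ℝ) ν γ 4 (1 / (2 * ε ^ 2)) (X.dom p) (X.sol p)
      (X.rhs p) := by
  have hpos : ∀ τ ∈ Icc (-(1 / (2 * ε ^ 2))) 0, 0 < X.t₂ + X.ρ ^ 2 * τ := fun τ hτ =>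
    lt_of_lt_of_le (half_pos X.t₁_pos) (X.time_mem hε hτ).1
  refine ⟨by simpa [dom] using hp, by positivity, ?_, ?_, ?_, ?_⟩
  · intro τ hτ
    exact (X.adm.twiceDiff (hpos τ hτ).le).rescale _ _ _
  · intro τ hτ y hy e e'
    simp only [hess_sol, smul_apply]
    rw [X.adm.hess_symm hD (hpos τ hτ).le hy]
  · intro τ hτ y hy
    have h1 := X.adm.hasDerivAt_dtt (hpos τ hτ).le hy
    have h2 : HasDerivAt (fun t : ℝ => X.t₂ + X.ρ ^ 2 * t) (X.ρ ^ 2) τ := by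
      simpa using ((hasDerivAt_id τ).const_mul (X.ρ ^ 2)).const_add X.t₂
    have h3 := (HasDerivAt.comp τ h1 h2).const_mul (X.scale / X.ρ ^ 2)
    refine h3.congr_deriv ?_
    rw [X.adm.dtt_eq hA (hpos τ hτ) hy, sum_hess_sol, rhs]
    have := X.ρ_pos
    field_simp
  · intro τ hτ τ' hτ' y hy y' hy'
    have h1 := X.hol _ (X.time_mem hε hτ) _ (X.time_mem hε hτ') _ hy _ hy'
    have h2 : |X.t₂ + X.ρ ^ 2 * τ - (X.t₂ + X.ρ ^ 2 * τ')| ^ (γ / 2) =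
        X.ρ ^ γ * |τ - τ'| ^ (γ / 2) := by
      rw [show X.t₂ + X.ρ ^ 2 * τ - (X.t₂ + X.ρ ^ 2 * τ') = X.ρ ^ 2 * (τ - τ') by ring, abs_mul,
        abs_of_nonneg (sq_nonneg _), Real.mul_rpow (sq_nonneg _) (abs_nonneg _), ← Real.rpow_two,
        ← Real.rpow_mul X.ρ_pos.le]
      congr 2; ring
    have h3 : ‖p + X.ρ • y - (p + X.ρ • y')‖ ^ γ = X.ρ ^ γ * ‖y - y'‖ ^ γ := by
      rw [add_sub_add_left_eq_sub, ← smul_sub, norm_smul, Real.norm_of_nonneg X.ρ_pos.le,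
        Real.mul_rpow X.ρ_pos.le (norm_nonneg _)]
    rw [h2, h3] at h1
    rw [hess_sol, hess_sol, ← smul_sub, norm_smul, Real.norm_of_nonneg X.scale_pos.le]
    refine (mul_le_mul_of_nonneg_left h1 X.scale_pos.le).trans (le_of_eq ?_)
    linear_combination (4 * (|τ - τ'| ^ (γ / 2) + ‖y - y'‖ ^ γ)) * X.scale_mul

theorem rhs_sub_le (hγ : γ ∈ Ioo (0:ℝ) 1) (hC : 1 ≤ C) (hε : 0 < ε) (hε1 : ε ≤ 1) {p : Euc d}
    (hp : p ∈ closure D) {R : ℝ} (hR : 1 ≤ R) (hRr : R * X.ρ ≤ r₁) {τ : ℝ}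
    (hτ : τ ∈ Icc (-(1 / (2 * ε ^ 2))) 0) (hτR : -R ≤ τ) {y : Euc d} (hy : y ∈ X.dom p)
    (hyR : ‖y‖ ≤ R) : |X.rhs p τ y - X.rhs p 0 0| ≤ 3 * C ^ 3 * R ^ 2 * ε := by
  have hρ := X.ρ_pos
  have hℓ := X.ℓ_pos
  have hℓε := X.ℓ_le
  have h0 : (0:ℝ) ∈ Icc (-(1 / (2 * ε ^ 2))) 0 := ⟨by simp; positivity, le_rfl⟩
  have h1 := X.bounds.forcing_sub_le (R * X.ρ) ⟨by positivity, hRr⟩ _ (X.time_mem hε hτ) _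
    (X.time_mem hε h0) _ hy (p + X.ρ • (0 : Euc d)) (by simpa using hp) (by
      rw [show X.t₂ + X.ρ ^ 2 * τ - (X.t₂ + X.ρ ^ 2 * 0) = X.ρ ^ 2 * τ by ring, abs_mul,
        abs_of_nonneg (sq_nonneg _), abs_of_nonpos hτ.2, mul_pow, mul_comm]
      gcongr
      nlinarith) (by
      rw [smul_zero, add_zero, add_sub_cancel_left, norm_smul, Real.norm_of_nonneg hρ.le, mul_comm]
      gcongr)
  rw [rhs, rhs, ← mul_sub, abs_mul, abs_of_pos X.scale_pos]
  refine (mul_le_mul_of_nonneg_left h1 X.scale_pos.le).trans ?_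
  obtain ⟨K, hK⟩ : ∃ K : ℝ, K = X.ℓ ^ γ / X.ρ ^ γ := ⟨_, rfl⟩
  have hK0 : 0 ≤ K := hK ▸ X.ratio_nonneg
  have h2 : X.ρ * K ≤ C * X.ℓ := hK ▸ X.ρ_mul_le hγ hC
  have h3 : (R * X.ρ) ^ γ * K ≤ R := by
    rw [Real.mul_rpow (by linarith) hρ.le, hK]
    have : 0 < X.ρ ^ γ := Real.rpow_pos_of_pos hρ _
    have h4 : R ^ γ ≤ R := by
      simpa using Real.rpow_le_rpow_of_exponent_le hR hγ.2.le
    have h5 : X.ℓ ^ γ ≤ 1 := Real.rpow_le_one hℓ.le (by linarith) hγ.1.le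
    have h6 : 0 ≤ X.ℓ ^ γ := Real.rpow_nonneg hℓ.le _
    calc R ^ γ * X.ρ ^ γ * (X.ℓ ^ γ / X.ρ ^ γ) = R ^ γ * X.ℓ ^ γ := by field_simp
      _ ≤ R * 1 := by gcongr
      _ = R := mul_one R
  rw [X.scale_eq, ← hK]
  have e : X.ℓ ^ 2 * K * (C * ((R * X.ρ) ^ γ + R * X.ρ / X.ℓ ^ 2 + (R * X.ρ) ^ 2 / X.ℓ ^ 3)) =
      C * (X.ℓ ^ 2 * ((R * X.ρ) ^ γ * K) + R * (X.ρ * K) + R ^ 2 * (X.ρ * K) * (X.ρ / X.ℓ)) := by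
    field_simp
  rw [e]
  have h6 : X.ρ / X.ℓ ≤ C := by rw [div_le_iff₀ hℓ]; exact X.ρ_le
  have hC0 : 0 ≤ C := by linarith
  have h2' : X.ρ * K ≤ C * ε := h2.trans (by gcongr)
  have hRR : R ≤ R ^ 2 := by nlinarith
  have hCC : 1 ≤ C ^ 2 := by nlinarith
  have hR0 : 0 ≤ R := by linarith
  have t1 : X.ℓ ^ 2 * ((R * X.ρ) ^ γ * K) ≤ C ^ 2 * (R ^ 2 * ε) := by
    calc X.ℓ ^ 2 * ((R * X.ρ) ^ γ * K) ≤ X.ℓ ^ 2 * R := by gcongr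
      _ ≤ ε * R ^ 2 := by
        gcongr
        nlinarith
      _ ≤ C ^ 2 * (R ^ 2 * ε) := by nlinarith [mul_nonneg (sq_nonneg R) hε.le]
  have t2 : R * (X.ρ * K) ≤ C ^ 2 * (R ^ 2 * ε) := by
    calc R * (X.ρ * K) ≤ R ^ 2 * (C * ε) := mul_le_mul hRR h2' (by positivity) (by positivity)
      _ ≤ C ^ 2 * (R ^ 2 * ε) := by
          nlinarith [mul_nonneg (mul_nonneg (sq_nonneg R) hε.le) hC0,
            mul_nonneg (mul_nonneg (mul_nonneg (sq_nonneg R) hε.le) hC0) (sub_nonneg.2 hC)]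
  have t3 : R ^ 2 * (X.ρ * K) * (X.ρ / X.ℓ) ≤ C ^ 2 * (R ^ 2 * ε) := by
    calc R ^ 2 * (X.ρ * K) * (X.ρ / X.ℓ) ≤ R ^ 2 * (C * ε) * C :=
          mul_le_mul (mul_le_mul_of_nonneg_left h2' (by positivity)) h6 (by positivity)
            (by positivity)
      _ = C ^ 2 * (R ^ 2 * ε) := by ring
  calc _ ≤ C * (C ^ 2 * (R ^ 2 * ε) + C ^ 2 * (R ^ 2 * ε) + C ^ 2 * (R ^ 2 * ε)) := by gcongr
    _ = _ := by ring

theorem mem_zero (hε : 0 < ε) : (0:ℝ) ∈ Icc (-(1 / (2 * ε ^ 2))) 0 := ⟨by simp; positivity, le_rfl⟩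

theorem norm_fderiv_sol_le (hγ : γ ∈ Ioo (0:ℝ) 1) (hC : 1 ≤ C) (hε : 0 < ε) (hε1 : ε ≤ 1)
    {p : Euc d} (hp : p ∈ closure D) :
    X.ρ ^ 2 * ‖fderiv ℝ (X.sol p 0) 0‖ ≤ C ^ 2 * ε := by
  have hρ := X.ρ_pos
  have hℓ := X.ℓ_pos
  have h1 := X.bounds.fderiv_le _ (X.time_mem hε (mem_zero hε)) (p + X.ρ • (0 : Euc d))
    (by simpa using hp)
  rw [fderiv_sol, norm_smul, Real.norm_of_nonneg (div_nonneg X.scale_pos.le hρ.le), X.scale_eq]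
  have h2 := X.ρ_mul_le hγ hC
  have hr := X.ratio_nonneg
  have hC0 : 0 ≤ C := by linarith
  calc _ ≤ X.ρ ^ 2 * (X.ℓ ^ 2 * (X.ℓ ^ γ / X.ρ ^ γ) / X.ρ * (C / X.ℓ)) := by gcongr
    _ = C * X.ℓ * (X.ρ * (X.ℓ ^ γ / X.ρ ^ γ)) := by field_simp
    _ ≤ C * 1 * (C * ε) := by
      have := X.ℓ_le
      refine mul_le_mul ?_ (h2.trans (by gcongr)) (by positivity) (by positivity)
      gcongr
      linarith
    _ = _ := by ring

theorem norm_hess_sol_le (hγ : γ ∈ Ioo (0:ℝ) 1) (hC : 1 ≤ C) (hε : 0 < ε)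
    {p : Euc d} (hp : p ∈ closure D) :
    X.ρ * ‖hess (X.sol p 0) 0‖ ≤ C ^ 2 * ε := by
  have hρ := X.ρ_pos
  have hℓ := X.ℓ_pos
  have h1 := X.bounds.hess_le _ (X.time_mem hε (mem_zero hε)) (p + X.ρ • (0 : Euc d))
    (by simpa using hp)
  rw [hess_sol, norm_smul, Real.norm_of_nonneg X.scale_pos.le, X.scale_eq]
  have h2 := X.ρ_mul_le hγ hC
  have hr := X.ratio_nonneg
  have hC0 : 0 ≤ C := by linarith
  calc _ ≤ X.ρ * (X.ℓ ^ 2 * (X.ℓ ^ γ / X.ρ ^ γ) * (C / X.ℓ ^ 2)) := by gcongr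
    _ = C * (X.ρ * (X.ℓ ^ γ / X.ρ ^ γ)) := by field_simp
    _ ≤ C * (C * ε) := by
      have := X.ℓ_le
      exact mul_le_mul_of_nonneg_left (h2.trans (by gcongr)) hC0
    _ = _ := by ring

theorem sol_eq_zero (hε : 0 < ε) {p y : Euc d} (hy : p + X.ρ • y ∈ frontier D) {τ : ℝ}
    (hτ : τ ∈ Icc (-(1 / (2 * ε ^ 2))) 0) : X.sol p τ y = 0 := by
  have h1 := (X.time_mem hε hτ).1
  rw [sol, X.adm.bc _ (mem_Ici.2 (le_trans (half_pos X.t₁_pos).le h1)) _ hy, mul_zero]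

/-- At a scaled boundary point the Taylor remainder is an explicit polynomial. -/
theorem taylorRem_frontier (hA : ContDiff ℝ 2 A) (hε : 0 < ε) {p y : Euc d}
    (hp : p ∈ frontier D) (hy : p + X.ρ • y ∈ frontier D) {τ : ℝ}
    (hτ : τ ∈ Icc (-(1 / (2 * ε ^ 2))) 0) :
    taylorRem (EuclideanSpace.basisFun (Fin d) ℝ) ν (X.sol p) (X.rhs p) τ y =
      -(fderiv ℝ (X.sol p 0) 0 y) - hess (X.sol p 0) 0 y y / 2 := by
  have h0 : 0 < X.t₂ + X.ρ ^ 2 * 0 := by linarith [X.t₁_pos, X.t₁_le]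
  have hp' : p + X.ρ • (0 : Euc d) ∈ frontier D := by simpa using hp
  have h1 := X.adm.dtt_eq hA h0 (frontier_subset_closure hp')
  rw [X.adm.dtt_frontier h0 hp'] at h1
  rw [taylorRem, X.sol_eq_zero hε hy hτ, X.sol_eq_zero hε hp' (mem_zero hε), sum_hess_sol, rhs]
  linear_combination (τ * X.scale) * h1

theorem pair_large (p : Euc d) :
    1 / 2 ≤ ‖hess (X.sol p ((X.t₁ - X.t₂) / X.ρ ^ 2)) (X.ρ⁻¹ • (X.x₁ - p)) -
    hess (X.sol p 0) (X.ρ⁻¹ • (X.x₂ - p))‖ := by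
  have hρ := X.ρ_pos
  have h1 : ∀ x : Euc d, p + X.ρ • X.ρ⁻¹ • (x - p) = x := by
    intro x
    rw [smul_smul, mul_inv_cancel₀ hρ.ne', one_smul, add_sub_cancel]
  have h2 : X.t₂ + X.ρ ^ 2 * ((X.t₁ - X.t₂) / X.ρ ^ 2) = X.t₁ := by
    field_simp; ring
  rw [hess_sol, hess_sol, h1, h1, h2, mul_zero, add_zero, ← smul_sub, norm_smul,
    Real.norm_of_nonneg X.scale_pos.le]
  refine le_trans (le_of_eq ?_) (mul_le_mul_of_nonneg_left X.big X.scale_pos.le)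
  linear_combination (-1 / 2) * X.scale_mul

theorem pair_time_mem : (X.t₁ - X.t₂) / X.ρ ^ 2 ∈ Icc (-1) 0 := by
  have := X.ρ_pos
  have h2 := X.t_le
  have h3 := X.t₁_le
  constructor
  · rw [le_div_iff₀ (by positivity)]; linarith
  · exact div_nonpos_of_nonpos_of_nonneg (by linarith) (by positivity)

theorem pair_mem₁ (p : Euc d) : X.ρ⁻¹ • (X.x₁ - p) ∈ X.dom p := by
  change p + X.ρ • X.ρ⁻¹ • (X.x₁ - p) ∈ closure D
  rw [smul_smul, mul_inv_cancel₀ X.ρ_pos.ne', one_smul, add_sub_cancel]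
  exact X.x₁_mem

theorem pair_mem₂ (p : Euc d) : X.ρ⁻¹ • (X.x₂ - p) ∈ X.dom p := by
  change p + X.ρ • X.ρ⁻¹ • (X.x₂ - p) ∈ closure D
  rw [smul_smul, mul_inv_cancel₀ X.ρ_pos.ne', one_smul, add_sub_cancel]
  exact X.x₂_mem

theorem pair_close (p : Euc d) :
    ‖X.ρ⁻¹ • (X.x₁ - p) - X.ρ⁻¹ • (X.x₂ - p)‖ ≤ 1 := by
  rw [← smul_sub, sub_sub_sub_cancel_right, norm_smul, norm_inv, Real.norm_of_nonneg X.ρ_pos.le,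
    inv_mul_le_iff₀ X.ρ_pos, mul_one]
  exact X.x_le

end BlowUp
end

section

/-- Boundary points `p k` of `D` converging to `q` and scales `ρ k` converging to `0`, together
with a local defining function `ψ` of `D` near `q` and the inner unit normal `n` at `q`. -/
structure BoundarySeq {d : ℕ} (F : Filter ℕ) (D U : Set (Euc d)) (ψ : Euc d → ℝ) (p : ℕ → Euc d)
    (ρ : ℕ → ℝ) (q n : Euc d) (κ : ℝ) : Prop where
  isOpen : IsOpen D
  isOpen_chart : IsOpen U
  mem_chart : q ∈ U
  contDiff : ContDiff ℝ 3 ψ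
  inter_eq : D ∩ U = {y ∈ U | ψ y < 0}
  mem_frontier : ∀ k, p k ∈ frontier D
  pos : ∀ k, 0 < ρ k
  tendsto_scale : Tendsto ρ F (𝓝 0)
  tendsto_point : Tendsto p F (𝓝 q)
  norm_normal : ‖n‖ = 1
  κ_pos : 0 < κ
  fderiv_eq : ∀ y, fderiv ℝ ψ q y = -(κ * inner ℝ n y)

namespace BoundarySeq

variable {d : ℕ} {F : Filter ℕ} {D U : Set (Euc d)} {ψ : Euc d → ℝ} {p : ℕ → Euc d}
  {ρ : ℕ → ℝ} {q n : Euc d} {κ : ℝ}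

theorem le_zero (h : BoundarySeq F D U ψ p ρ q n κ) {x : Euc d} (hx : x ∈ closure D)
    (hxU : x ∈ U) : ψ x ≤ 0 :=
  le_zero_of_mem_closure h.isOpen_chart h.contDiff.continuous h.inter_eq hx hxU

theorem mem_of_neg (h : BoundarySeq F D U ψ p ρ q n κ) {x : Euc d} (hxU : x ∈ U)
    (hx : ψ x < 0) : x ∈ D := by
  have : x ∈ D ∩ U := by rw [h.inter_eq]; exact ⟨hxU, hx⟩
  exact this.1

theorem eq_zero_of_mem_frontier (h : BoundarySeq F D U ψ p ρ q n κ) {x : Euc d}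
    (hx : x ∈ frontier D) (hxU : x ∈ U) : ψ x = 0 := by
  refine le_antisymm (h.le_zero (frontier_subset_closure hx) hxU) ?_
  by_contra! hlt
  rw [h.isOpen.frontier_eq] at hx
  exact hx.2 (h.mem_of_neg hxU hlt)

theorem mem_frontier_of_eq_zero (h : BoundarySeq F D U ψ p ρ q n κ) {x : Euc d}
    (hx : x ∈ closure D) (hxU : x ∈ U) (h0 : ψ x = 0) : x ∈ frontier D := by
  rw [h.isOpen.frontier_eq]
  refine ⟨hx, fun hxD => ?_⟩
  have : x ∈ D ∩ U := ⟨hxD, hxU⟩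
  rw [h.inter_eq] at this
  exact absurd h0 this.2.ne

theorem eventually_ball (h : BoundarySeq F D U ψ p ρ q n κ) (R : ℝ) {δ : ℝ} (hδ : 0 < δ) :
    ∀ᶠ k in F, ∀ y : Euc d, ‖y‖ ≤ R → p k + ρ k • y ∈ Metric.ball q δ := by
  have h1 := Metric.tendsto_nhds.1 h.tendsto_point (δ / 2) (half_pos hδ)
  have h2 : Tendsto (fun k => ρ k * R) F (𝓝 0) := by simpa using h.tendsto_scale.mul_const R
  filter_upwards [h1, h2.eventually (gt_mem_nhds (half_pos hδ))] with k h3 h4 y hy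
  rw [Metric.mem_ball]
  calc dist (p k + ρ k • y) q ≤ dist (p k + ρ k • y) (p k) + dist (p k) q := dist_triangle _ _ _
    _ = ρ k * ‖y‖ + dist (p k) q := by
      rw [dist_eq_norm, add_sub_cancel_left, norm_smul, Real.norm_of_nonneg (h.pos k).le]
    _ ≤ ρ k * R + dist (p k) q := by
      have := (h.pos k).le
      gcongr
    _ < δ := by linarith

theorem eventually_approx (h : BoundarySeq F D U ψ p ρ q n κ) (R : ℝ) {η : ℝ} (hη : 0 < η) :
    ∀ᶠ k in F, ∀ y z : Euc d, ‖y‖ ≤ R → ‖z‖ ≤ R → p k + ρ k • y ∈ U ∧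
      |ψ (p k + ρ k • y) - ψ (p k + ρ k • z) + ρ k * κ * inner ℝ n (y - z)| ≤
        η * ρ k * ‖y - z‖ := by
  have hc : Continuous (fderiv ℝ ψ) := h.contDiff.continuous_fderiv (by norm_num)
  obtain ⟨δ₁, hδ₁, h1⟩ := Metric.continuousAt_iff.1 hc.continuousAt η hη
  obtain ⟨δ₂, hδ₂, h2⟩ := Metric.isOpen_iff.1 h.isOpen_chart q h.mem_chart
  filter_upwards [h.eventually_ball R (lt_min hδ₁ hδ₂)] with k hk y z hy hz
  have hy' := hk y hy
  have hz' := hk z hz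
  refine ⟨h2 (Metric.ball_subset_ball (min_le_right _ _) hy'), ?_⟩
  have h3 := abs_sub_sub_le_of_fderiv (ψ := ψ) (S := Metric.ball q (min δ₁ δ₂))
    (N := fderiv ℝ ψ q) (η := η)
    (h.contDiff.differentiable (by norm_num)) (convex_ball _ _) (fun x hx => by
      have := h1 (x := x) (lt_of_lt_of_le (Metric.mem_ball.1 hx) (min_le_left _ _))
      rw [dist_eq_norm] at this
      exact this.le) hz' hy'
  have h4 : p k + ρ k • y - (p k + ρ k • z) = ρ k • (y - z) := by module
  rw [h4, norm_smul, Real.norm_of_nonneg (h.pos k).le, map_smul, h.fderiv_eq, smul_eq_mul] at h3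
  have h5 : ψ (p k + ρ k • y) - ψ (p k + ρ k • z) - ρ k * -(κ * inner ℝ n (y - z)) =
    ψ (p k + ρ k • y) - ψ (p k + ρ k • z) + ρ k * κ * inner ℝ n (y - z) := by ring
  rw [h5] at h3
  linarith

theorem eventually_approx_zero (h : BoundarySeq F D U ψ p ρ q n κ) {R : ℝ} (hR : 0 ≤ R) {η : ℝ}
    (hη : 0 < η) : ∀ᶠ k in F, ∀ y : Euc d, ‖y‖ ≤ R → p k + ρ k • y ∈ U ∧
      |ψ (p k + ρ k • y) + ρ k * κ * inner ℝ n y| ≤ η * ρ k * ‖y‖ := by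
  filter_upwards [h.eventually_approx R hη] with k hk y hy
  obtain ⟨h1, h2⟩ := hk y 0 hy (by simpa using hR)
  obtain ⟨h3, -⟩ := hk 0 0 (by simpa using hR) (by simpa using hR)
  rw [smul_zero, add_zero] at h2 h3
  rw [h.eq_zero_of_mem_frontier (h.mem_frontier k) h3] at h2
  rw [sub_zero, sub_zero] at h2
  exact ⟨h1, h2⟩

/-- Scaled points well inside the half space belong to the scaled domain, uniformly. -/
theorem eventually_mem (h : BoundarySeq F D U ψ p ρ q n κ) {R c : ℝ} (hR : 0 < R) (hc : 0 < c) :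
    ∀ᶠ k in F, ∀ y : Euc d, ‖y‖ ≤ R → 0 < ‖y‖ → c * ‖y‖ ≤ inner ℝ n y →
      p k + ρ k • y ∈ D := by
  have hκ := h.κ_pos
  filter_upwards [h.eventually_approx_zero hR.le (η := κ * c / 2) (by positivity)]
    with k hk y hy hy0 hyc
  obtain ⟨h1, h2⟩ := hk y hy
  refine h.mem_of_neg h1 ?_
  have h3 := (abs_le.1 h2).2
  have h4 := h.pos k
  have h5 : 0 < ρ k * κ * (c * ‖y‖) := by positivity
  have h6 : ρ k * κ * (c * ‖y‖) ≤ ρ k * κ * inner ℝ n y := by gcongr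
  nlinarith

theorem eventually_segIn_zero (h : BoundarySeq F D U ψ p ρ q n κ) {R c : ℝ} (hR : 0 < R)
    (hc : 0 < c) : ∀ᶠ k in F, ∀ y : Euc d, ‖y‖ ≤ R → c ≤ inner ℝ n y →
      SegIn {y | p k + ρ k • y ∈ closure D} 0 y := by
  filter_upwards [h.eventually_mem hR (div_pos hc hR)] with k hk y hy hyc σ hσ
  rw [zero_add]
  change p k + ρ k • σ • y ∈ closure D
  have hy0 : 0 < ‖y‖ := by
    rw [norm_pos_iff]; rintro rfl
    simp at hyc; linarith
  rcases hσ.1.eq_or_lt with rfl | hσ0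
  · simpa using frontier_subset_closure (h.mem_frontier k)
  refine subset_closure (hk _ ?_ ?_ ?_)
  · rw [norm_smul, Real.norm_of_nonneg hσ.1]
    nlinarith [hσ.2]
  · rw [norm_smul, Real.norm_of_nonneg hσ.1]; positivity
  · rw [norm_smul, Real.norm_of_nonneg hσ.1, inner_smul_right]
    have : c / R * ‖y‖ ≤ c := by
      rw [div_mul_eq_mul_div, div_le_iff₀ hR]; gcongr
    nlinarith

theorem eventually_segIn (h : BoundarySeq F D U ψ p ρ q n κ) {y e : Euc d}
    (hy : 0 < inner ℝ n y) (he : 0 < inner ℝ n (y + e)) :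
    ∀ᶠ k in F, SegIn {y | p k + ρ k • y ∈ closure D} y e := by
  obtain ⟨m, hm⟩ : ∃ m, m = min (inner ℝ n y) (inner ℝ n (y + e)) := ⟨_, rfl⟩
  have hm0 : 0 < m := hm ▸ lt_min hy he
  have hR : 0 < ‖y‖ + ‖e‖ + 1 := by positivity
  filter_upwards [h.eventually_segIn_zero hR hm0] with k hk σ hσ
  have h1 : ‖y + σ • e‖ ≤ ‖y‖ + ‖e‖ + 1 := by
    refine (norm_add_le _ _).trans ?_
    rw [norm_smul, Real.norm_of_nonneg hσ.1]
    nlinarith [hσ.2, norm_nonneg e]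
  have h2 : m ≤ inner ℝ n (y + σ • e) := by
    rw [inner_add_right] at he
    have h3 : m ≤ inner ℝ n y := hm ▸ min_le_left _ _
    have h4 : m ≤ inner ℝ n y + inner ℝ n e := by
      rw [← inner_add_right]; exact hm ▸ min_le_right _ _
    rw [inner_add_right, inner_smul_right]
    nlinarith [hσ.1, hσ.2]
  simpa using (hk _ h1 h2).right

theorem inner_nonneg_of_tendsto [F.NeBot] (h : BoundarySeq F D U ψ p ρ q n κ) {y : ℕ → Euc d}
    {y₀ : Euc d} (hy : ∀ᶠ k in F, y k ∈ {y | p k + ρ k • y ∈ closure D})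
    (hy₀ : Tendsto y F (𝓝 y₀)) : 0 ≤ inner ℝ n y₀ := by
  by_contra! hlt
  have hR : 0 < ‖y₀‖ + 1 := by positivity
  have h1 : ∀ᶠ k in F, ‖y k‖ < ‖y₀‖ + 1 := hy₀.norm.eventually (gt_mem_nhds (by linarith))
  have h2 : Tendsto (fun k => inner ℝ n (y k)) F (𝓝 (inner ℝ n y₀)) :=
    (Continuous.tendsto (by fun_prop : Continuous fun z : Euc d => inner ℝ n z) y₀).comp hy₀
  have h3 : ∀ᶠ k in F, inner ℝ n (y k) < inner ℝ n y₀ / 2 :=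
    h2.eventually (gt_mem_nhds (by linarith))
  have hκ := h.κ_pos
  have hη : 0 < κ * (-(inner ℝ n y₀) / 2) / (‖y₀‖ + 1) :=
    div_pos (mul_pos hκ (by linarith)) hR
  obtain ⟨k, hk1, hk2, hk3, hk4⟩ :=
    (hy.and (h1.and (h3.and (h.eventually_approx_zero hR.le hη)))).exists
  obtain ⟨hU, hb⟩ := hk4 _ hk2.le
  have h5 := h.le_zero hk1 hU
  have h6 := (abs_le.1 hb).1
  have h7 := h.pos k
  have h8 : κ * (-(inner ℝ n y₀) / 2) / (‖y₀‖ + 1) * ρ k * ‖y k‖ ≤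
      ρ k * (κ * (-(inner ℝ n y₀) / 2)) := by
    calc _ ≤ κ * (-(inner ℝ n y₀) / 2) / (‖y₀‖ + 1) * ρ k * (‖y₀‖ + 1) := by gcongr
      _ = _ := by field_simp
  have h9 : ρ k * κ * inner ℝ n (y k) < ρ k * κ * (inner ℝ n y₀ / 2) := by
    have : 0 < ρ k * κ := by positivity
    gcongr
  linarith

/-- Over every tangential point there are scaled boundary points converging to it, and the
segments above them lie in the scaled domain. -/
theorem exists_root (h : BoundarySeq F D U ψ p ρ q n κ) {y : Euc d} (hy : inner ℝ n y = 0) :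
    ∃ σ : ℕ → ℝ, Tendsto σ F (𝓝 0) ∧ ∀ᶠ k in F,
      ψ (p k + ρ k • (y + σ k • n)) = 0 ∧ p k + ρ k • (y + σ k • n) ∈ frontier D ∧
      ∀ ς ∈ Icc (0:ℝ) 2, p k + ρ k • (y + σ k • n + ς • n) ∈ closure D := by
  have hκ := h.κ_pos
  have hnn : inner ℝ n n = 1 := by rw [real_inner_self_eq_norm_sq, h.norm_normal]; norm_num
  have hR : 0 < ‖y‖ + 3 := by positivity
  have hnorm : ∀ σ : ℝ, |σ| ≤ 3 → ‖y + σ • n‖ ≤ ‖y‖ + 3 := by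
    intro σ hσ
    refine (norm_add_le _ _).trans ?_
    rw [norm_smul, h.norm_normal, mul_one, Real.norm_eq_abs]
    linarith
  have hinner : ∀ σ : ℝ, inner ℝ n (y + σ • n) = σ := by
    intro σ
    rw [inner_add_right, inner_smul_right, hy, hnn]; ring
  have hex : ∀ᶠ k in F, ∃ σ : ℝ, |σ| ≤ 1 ∧ ψ (p k + ρ k • (y + σ • n)) = 0 := by
    filter_upwards [h.eventually_approx_zero hR.le
      (η := κ / (‖y‖ + 3)) (by positivity)] with k hk
    have hpos := h.pos k
    have hb : ∀ σ : ℝ, |σ| ≤ 3 → |ψ (p k + ρ k • (y + σ • n)) + ρ k * κ * σ| ≤ ρ k * κ := by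
      intro σ hσ
      have h1 := (hk _ (hnorm σ hσ)).2
      rw [hinner] at h1
      refine h1.trans ?_
      calc _ ≤ κ / (‖y‖ + 3) * ρ k * (‖y‖ + 3) := by
            gcongr; exact hnorm σ hσ
        _ = _ := by field_simp
    have hc : ContinuousOn (fun σ : ℝ => ψ (p k + ρ k • (y + σ • n))) (Icc (-1) 1) :=
      (h.contDiff.continuous.comp (by fun_prop)).continuousOn
    have h1 := (abs_le.1 (hb 1 (by norm_num))).2
    have h2 := (abs_le.1 (hb (-1) (by norm_num))).1
    have h3 : (0:ℝ) ∈ Icc (ψ (p k + ρ k • (y + (1:ℝ) • n))) (ψ (p k + ρ k • (y + (-1:ℝ) • n))) :=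
      ⟨by linarith, by linarith⟩
    obtain ⟨σ, hσ, hσ0⟩ := intermediate_value_Icc' (by norm_num) hc h3
    exact ⟨σ, abs_le.2 ⟨hσ.1, hσ.2⟩, hσ0⟩
  obtain ⟨σ, hσ⟩ : ∃ σ : ℕ → ℝ, ∀ᶠ k in F, |σ k| ≤ 1 ∧ ψ (p k + ρ k • (y + σ k • n)) = 0 := by
    classical
    refine ⟨fun k => if hk : ∃ σ : ℝ, |σ| ≤ 1 ∧ ψ (p k + ρ k • (y + σ • n)) = 0 then
      hk.choose else 0, ?_⟩
    filter_upwards [hex] with k hk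
    simp only [dif_pos hk]
    exact hk.choose_spec
  refine ⟨σ, ?_, ?_⟩
  · rw [Metric.tendsto_nhds]
    intro η hη
    filter_upwards [hσ, h.eventually_approx_zero hR.le (η := κ * (η / 2) / (‖y‖ + 3))
      (by positivity)]
      with k h1 h2
    have h3 := (h2 _ (hnorm (σ k) (by linarith [h1.1]))).2
    have hpos := h.pos k
    rw [h1.2, hinner, zero_add, abs_mul, abs_of_pos (by positivity)] at h3
    have h4 : κ * (η / 2) / (‖y‖ + 3) * ρ k * ‖y + σ k • n‖ ≤ ρ k * κ * (η / 2) := by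
      calc _ ≤ κ * (η / 2) / (‖y‖ + 3) * ρ k * (‖y‖ + 3) := by
            gcongr; exact hnorm _ (by linarith [h1.1])
        _ = _ := by field_simp
    have h5 := le_of_mul_le_mul_left (h3.trans h4) (by positivity)
    rw [Real.dist_eq, sub_zero]
    linarith
  · filter_upwards [hσ, h.eventually_approx (‖y‖ + 3) (η := κ / 2) (by positivity)] with k h1 h2
    have hpos := h.pos k
    have habove : ∀ ς ∈ Ioc (0:ℝ) 2, p k + ρ k • (y + σ k • n + ς • n) ∈ D := by
      intro ς hς
      have e1 : y + σ k • n + ς • n = y + (σ k + ς) • n := by module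
      have h3 := abs_le.1 h1.1
      rw [e1]
      obtain ⟨hU, hb⟩ := h2 (y + (σ k + ς) • n) (y + σ k • n)
        (hnorm _ (abs_le.2 ⟨by linarith [hς.1], by linarith [hς.2]⟩)) (hnorm _ (by linarith [h1.1]))
      refine h.mem_of_neg hU ?_
      have e2 : y + (σ k + ς) • n - (y + σ k • n) = ς • n := by module
      rw [h1.2, e2, norm_smul, h.norm_normal, Real.norm_of_nonneg hς.1.le, inner_smul_right,
        hnn] at hb
      have h4 := (abs_le.1 hb).2
      have h5 : 0 < ρ k * κ * ς := mul_pos (by positivity) hς.1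
      linarith
    have hcl : p k + ρ k • (y + σ k • n) ∈ closure D := by
      have hc : Tendsto (fun ς : ℝ => p k + ρ k • (y + σ k • n + ς • n)) (𝓝[>] 0)
          (𝓝 (p k + ρ k • (y + σ k • n + (0:ℝ) • n))) :=
        (Continuous.tendsto (by fun_prop) _).mono_left nhdsWithin_le_nhds
      rw [zero_smul, add_zero] at hc
      refine mem_closure_of_tendsto hc ?_
      filter_upwards [Ioo_mem_nhdsGT (show (0:ℝ) < 2 by norm_num)] with ς hς
      exact habove ς ⟨hς.1, hς.2.le⟩
    refine ⟨h1.2, h.mem_frontier_of_eq_zero hcl ?_ h1.2, ?_⟩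
    · exact (h2 _ 0 (hnorm _ (by linarith [h1.1])) (by simp; positivity)).1
    · intro ς hς
      rcases hς.1.eq_or_lt with rfl | hς0
      · simpa using hcl
      · exact subset_closure (habove ς ⟨hς0, hς.2⟩)

end BoundarySeq
end

section

section TaylorBounds

variable {E : Type*} [NormedAddCommGroup E] [InnerProductSpace ℝ E]

theorem exists_taylor_three {ψ : E → ℝ} (hψ : ContDiff ℝ 3 ψ) (q : E) :
    ∃ δ > 0, ∃ K ≥ 0, ∀ p ∈ Metric.ball q δ, ∀ z, p + z ∈ Metric.ball q δ →
      |ψ (p + z) - ψ p - fderiv ℝ ψ p z - hess ψ p z z / 2| ≤ K * ‖z‖ ^ 3 ∧ ‖hess ψ p‖ ≤ K := by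
  have h1 : ContDiff ℝ 2 (fderiv ℝ ψ) := hψ.fderiv_right (by norm_num)
  have h2 : ContDiff ℝ 1 (hess ψ) := h1.fderiv_right (by norm_num)
  obtain ⟨K, t, ht, hK⟩ := h2.contDiffAt.exists_lipschitzOnWith (x := q)
  obtain ⟨δ, hδ, hδt⟩ := Metric.mem_nhds_iff.1 ht
  refine ⟨min δ 1, by positivity, K + ‖hess ψ q‖, by positivity, fun p hp z hz => ⟨?_, ?_⟩⟩
  · have h3 : TwiceDiffOn univ ψ := fun x _ =>
      ⟨hψ.differentiable (by norm_num) x, h1.differentiable (by norm_num) x⟩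
    have h4 := taylor_on_segment h3 (p := p) (w := z) (fun _ _ => mem_univ _) (B := hess ψ p)
      (K := K * ‖z‖) (by
        intro σ hσ
        have h5 : p + σ • z ∈ Metric.ball q (min δ 1) :=
          (convex_ball _ _).segIn hp hz σ hσ
        have h6 := hK.dist_le_mul _ (hδt (Metric.ball_subset_ball (min_le_left _ _) h5)) _
          (hδt (Metric.ball_subset_ball (min_le_left _ _) hp))
        rw [dist_eq_norm, dist_eq_norm, add_sub_cancel_left, norm_smul,
          Real.norm_of_nonneg hσ.1] at h6
        refine h6.trans ?_
        gcongr
        exact mul_le_of_le_one_left (norm_nonneg _) hσ.2)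
    refine h4.trans ?_
    have : 0 ≤ ‖hess ψ q‖ * ‖z‖ ^ 3 := by positivity
    nlinarith
  · have h6 := hK.dist_le_mul _ (hδt (Metric.ball_subset_ball (min_le_left _ _) hp)) q
      (hδt (Metric.mem_ball_self hδ))
    have h7 : dist p q ≤ 1 := (Metric.mem_ball.1 hp).le.trans (min_le_right _ _)
    rw [dist_eq_norm] at h6
    have h8 : (K : ℝ) * dist p q ≤ K := mul_le_of_le_one_right K.2 h7
    have h9 := norm_sub_norm_le (hess ψ p) (hess ψ q)
    linarith

/-- A bound on the second derivative and two values control the increments of a function. -/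
theorem abs_sub_le_of_two_values {g g' g'' : ℝ → ℝ} {B C : ℝ}
    (hg : ∀ t ∈ Icc (0:ℝ) 1, HasDerivAt g (g' t) t)
    (hg' : ∀ t ∈ Icc (0:ℝ) 1, HasDerivAt g' (g'' t) t) (hB : ∀ t ∈ Icc (0:ℝ) 1, |g'' t| ≤ B)
    (h1 : |g 1| ≤ C) (h2 : |g (1 / 2)| ≤ C) {σ : ℝ} (hσ : σ ∈ Icc (0:ℝ) 1) :
    |g σ - g 0| ≤ (4 * C + B) * σ := by
  have hsub : ∀ {x : ℝ}, x ∈ Icc (1 / 2 : ℝ) 1 → x ∈ Icc (0:ℝ) 1 := fun hx =>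
    ⟨by linarith [hx.1], hx.2⟩
  obtain ⟨ξ, hξ, hξ'⟩ := exists_hasDerivAt_eq_slope g g' (by norm_num : (1 / 2 : ℝ) < 1)
    (fun t ht => (hg t (hsub ht)).continuousAt.continuousWithinAt)
    (fun t ht => hg t (hsub ⟨ht.1.le, ht.2.le⟩))
  have hξm : ξ ∈ Icc (0:ℝ) 1 := hsub ⟨hξ.1.le, hξ.2.le⟩
  have hB0 : 0 ≤ B := (abs_nonneg _).trans (hB ξ hξm)
  have hξC : |g' ξ| ≤ 4 * C := by
    rw [hξ', show (1:ℝ) - 1 / 2 = 1 / 2 by norm_num, abs_div,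
      abs_of_pos (by norm_num : (0:ℝ) < 1 / 2)]
    have := abs_sub (g 1) (g (1 / 2))
    rw [div_le_iff₀ (by norm_num)]; linarith
  have hder : ∀ t ∈ Icc (0:ℝ) 1, |g' t| ≤ 4 * C + B := by
    intro t ht
    have h3 := (convex_Icc (0:ℝ) 1).norm_image_sub_le_of_norm_hasDerivWithin_le
      (fun x hx => (hg' x hx).hasDerivWithinAt) hB hξm ht
    rw [Real.norm_eq_abs, Real.norm_eq_abs] at h3
    have h4 : |t - ξ| ≤ 1 := by
      rw [abs_le]; constructor <;> linarith [ht.1, ht.2, hξm.1, hξm.2]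
    have h5 : B * |t - ξ| ≤ B := mul_le_of_le_one_right hB0 h4
    have := abs_add_le (g' t - g' ξ) (g' ξ)
    rw [sub_add_cancel] at this
    linarith
  have h3 := (convex_Icc (0:ℝ) 1).norm_image_sub_le_of_norm_hasDerivWithin_le
      (fun x hx => (hg x hx).hasDerivWithinAt) hder (by norm_num : (0:ℝ) ∈ Icc (0:ℝ) 1) hσ
  simpa [Real.norm_eq_abs, abs_of_nonneg hσ.1] using h3

/-- Comparison of a quadratic polynomial at a point of a curved hypersurface with its value at a
tangential point. -/
theorem abs_quadratic_sub_le {N b : E →L[ℝ] ℝ} {H B : E →L[ℝ] E →L[ℝ] ℝ} {n z y : E}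
    {ρ σ K R m : ℝ} (hn : ‖n‖ = 1) (hρ : 0 < ρ) (hρ1 : ρ ≤ 1) (hK : 0 ≤ K) (hR : 1 ≤ R) (hm : 0 < m)
    (hm' : m ≤ |N n|) (hz : N z = 0) (hy : y = z + σ • n) (hzR : ‖z‖ ≤ R) (hyR : ‖y‖ ≤ R)
    (hH : ‖H‖ ≤ K) (hcurve : |N y + ρ / 2 * H y y| ≤ K * ρ ^ 2 * ‖y‖ ^ 3) :
    |b y + B y y / 2 - (b z + B z z / 2 - ρ / 2 * H z z / N n * b n)| ≤
      ((K * R ^ 3 + K * R * (2 * K * R ^ 3 / m)) / m + R * (2 * K * R ^ 3 / m)) *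
        (ρ ^ 2 * ‖b‖ + ρ * ‖B‖) := by
  have hN0 : N n ≠ 0 := by
    rw [← abs_pos]; linarith
  have hNy : N y = σ * N n := by rw [hy, map_add, map_smul, hz, smul_eq_mul, zero_add]
  have hR0 : 0 ≤ R := by linarith
  have hquad : ∀ G : E →L[ℝ] E →L[ℝ] ℝ, |G y y - G z z| ≤ ‖G‖ * (2 * R * |σ|) := by
    intro G
    have e1 : G y y - G z z = G (σ • n) y + G z (σ • n) := by
      rw [hy]; simp only [map_add, add_apply]; ring
    have hσn : ‖σ • n‖ = |σ| := by rw [norm_smul, hn, mul_one, Real.norm_eq_abs]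
    rw [e1]
    refine (abs_add_le _ _).trans ?_
    have h1 := G.le_opNorm₂ (σ • n) y
    have h2 := G.le_opNorm₂ z (σ • n)
    rw [Real.norm_eq_abs, hσn] at h1 h2
    have h3 : ‖G‖ * |σ| * ‖y‖ ≤ ‖G‖ * |σ| * R := by gcongr
    have h4 : ‖G‖ * ‖z‖ * |σ| ≤ ‖G‖ * R * |σ| := by gcongr
    linarith
  have hHy : |H y y| ≤ K * R ^ 2 := by
    refine (H.le_opNorm₂ y y).trans ?_
    rw [mul_assoc, ← sq]
    gcongr
  have hc : K * ρ ^ 2 * ‖y‖ ^ 3 ≤ K * ρ ^ 2 * R ^ 3 := by gcongr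
  have hσ : |σ| ≤ 2 * K * R ^ 3 / m * ρ := by
    rw [div_mul_eq_mul_div, le_div_iff₀ hm]
    have h1 : |σ| * m ≤ |N y| := by
      rw [hNy, abs_mul]; gcongr
    refine h1.trans ?_
    have h2 : |N y| ≤ |N y + ρ / 2 * H y y| + |ρ / 2 * H y y| := by
      have := abs_sub (N y + ρ / 2 * H y y) (ρ / 2 * H y y)
      rwa [add_sub_cancel_right] at this
    rw [abs_mul, abs_of_pos (by positivity : 0 < ρ / 2)] at h2
    have h3 : ρ / 2 * |H y y| ≤ ρ / 2 * (K * R ^ 2) := by gcongr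
    have h4 : K * R ^ 2 ≤ K * R ^ 3 := by gcongr; norm_num
    have h5 : K * ρ ^ 2 * R ^ 3 ≤ K * ρ * R ^ 3 := by
      gcongr; nlinarith
    have h6 : ρ / 2 * (K * R ^ 2) ≤ ρ / 2 * (K * R ^ 3) := by gcongr
    have h7 : 0 ≤ K * ρ * R ^ 3 := by positivity
    nlinarith
  obtain ⟨c, hcdef⟩ : ∃ c, c = 2 * K * R ^ 3 / m := ⟨_, rfl⟩
  have hc0 : 0 ≤ c := by rw [hcdef]; positivity
  rw [← hcdef] at hσ ⊢
  have he : |σ + ρ / 2 * H z z / N n| ≤ (K * R ^ 3 + K * R * c) / m * ρ ^ 2 := by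
    rw [show (K * R ^ 3 + K * R * c) / m * ρ ^ 2 = (K * R ^ 3 + K * R * c) * ρ ^ 2 / m by ring,
      le_div_iff₀ hm]
    have h1 : |σ + ρ / 2 * H z z / N n| * m ≤ |σ + ρ / 2 * H z z / N n| * |N n| := by gcongr
    have h2 : (σ + ρ / 2 * H z z / N n) * N n =
        (N y + ρ / 2 * H y y) - ρ / 2 * (H y y - H z z) := by
      rw [hNy]; field_simp; ring
    rw [← abs_mul, h2] at h1
    refine h1.trans ((abs_sub _ _).trans ?_)
    rw [abs_mul, abs_of_pos (by positivity : 0 < ρ / 2)]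
    have h3 : |H y y - H z z| ≤ K * (2 * R * (c * ρ)) := (hquad H).trans (by gcongr)
    have h4 : ρ / 2 * |H y y - H z z| ≤ ρ / 2 * (K * (2 * R * (c * ρ))) := by gcongr
    nlinarith
  have e2 : b y + B y y / 2 - (b z + B z z / 2 - ρ / 2 * H z z / N n * b n) =
      (σ + ρ / 2 * H z z / N n) * b n + (B y y - B z z) / 2 := by
    have : b y = b z + σ * b n := by rw [hy, map_add, map_smul, smul_eq_mul]
    rw [this]; ring
  rw [e2]
  refine (abs_add_le _ _).trans ?_
  rw [abs_mul, abs_div, abs_two]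
  have h1 : |b n| ≤ ‖b‖ := by simpa [hn] using b.le_opNorm n
  have h2 : |σ + ρ / 2 * H z z / N n| * |b n| ≤ (K * R ^ 3 + K * R * c) / m * ρ ^ 2 * ‖b‖ := by
    gcongr
  have h3 : |B y y - B z z| ≤ ‖B‖ * (2 * R * (c * ρ)) := (hquad B).trans (by gcongr)
  have h4 : 0 ≤ (K * R ^ 3 + K * R * c) / m * (ρ * ‖B‖) := by positivity
  have h5 : 0 ≤ R * c * (ρ ^ 2 * ‖b‖) := by positivity
  nlinarith

theorem eq_zero_of_dilation {f : E → ℝ} {p : E → Prop} (hp : ∀ (c : ℝ) y, p y → p (c • y))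
    {c K γ : ℝ} (hc0 : 0 < c) (hc : c ≤ 4) (hγ : 0 < γ) (hf : ∀ y, p y → f ((2:ℝ) • y) = c * f y)
    (hK : ∀ y, p y → |f y| ≤ K * ‖y‖ ^ (2 + γ)) {y : E} (hy : p y) : f y = 0 := by
  have h1 : ∀ j : ℕ, f y = c ^ j * f ((2⁻¹ : ℝ) ^ j • y) := by
    intro j
    induction j with
    | zero => simp
    | succ j ih =>
      rw [ih, pow_succ c, mul_assoc, ← hf _ (hp _ _ hy), smul_smul]
      congr 3
      rw [pow_succ]; ring
  have hq : (2:ℝ) ^ (2 + γ) > 4 := by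
    rw [Real.rpow_add (by norm_num), Real.rpow_two]
    have : (1:ℝ) < 2 ^ γ := Real.one_lt_rpow (by norm_num) hγ
    linarith
  have h2 : ∀ j : ℕ, |f y| ≤ (K * ‖y‖ ^ (2 + γ)) * (c / (2:ℝ) ^ (2 + γ)) ^ j := by
    intro j
    rw [h1 j, abs_mul, abs_of_pos (by positivity)]
    have h3 := hK _ (hp ((2⁻¹ : ℝ) ^ j) _ hy)
    have h4 : ((2⁻¹ : ℝ) ^ j) ^ (2 + γ) = (((2:ℝ) ^ (2 + γ))⁻¹) ^ j := by
      rw [← Real.rpow_natCast (2⁻¹ : ℝ) j, ← Real.rpow_mul (by norm_num), mul_comm (j : ℝ),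
        Real.rpow_mul (by norm_num), Real.inv_rpow (by norm_num), Real.rpow_natCast]
    rw [norm_smul, Real.norm_of_nonneg (by positivity), Real.mul_rpow (by positivity)
      (norm_nonneg _), h4] at h3
    calc c ^ j * |f ((2⁻¹ : ℝ) ^ j • y)|
        ≤ c ^ j * (K * ((((2:ℝ) ^ (2 + γ))⁻¹) ^ j * ‖y‖ ^ (2 + γ))) :=
          mul_le_mul_of_nonneg_left h3 (by positivity)
      _ = _ := by rw [div_pow, inv_pow]; ring
  have h4 : Tendsto (fun j : ℕ => (K * ‖y‖ ^ (2 + γ)) * (c / (2:ℝ) ^ (2 + γ)) ^ j) atTop (𝓝 0) := by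
    have := tendsto_pow_atTop_nhds_zero_of_lt_one (r := c / (2:ℝ) ^ (2 + γ)) (by positivity)
      (by rw [div_lt_one (by positivity)]; linarith)
    simpa using this.const_mul (K * ‖y‖ ^ (2 + γ))
  exact abs_nonpos_iff.1 (ge_of_tendsto' h4 h2)

theorem eq_zero_of_quadratic_relation {f : E → ℝ} {p : E → Prop}
    (hp : ∀ (c : ℝ) y, p y → p (c • y)) {K γ : ℝ} (hγ : 0 < γ)
    (hf : ∀ y, p y → f ((4:ℝ) • y) - 6 * f ((2:ℝ) • y) + 8 * f y = 0)
    (hK : ∀ y, p y → |f y| ≤ K * ‖y‖ ^ (2 + γ)) {y : E} (hy : p y) : f y = 0 := by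
  have e : ∀ y : E, (2:ℝ) • (2:ℝ) • y = (4:ℝ) • y := fun y => by rw [smul_smul]; norm_num
  have h1 : ∀ y, p y → f ((2:ℝ) • y) - 2 * f y = 0 := by
    intro y hy
    refine eq_zero_of_dilation (f := fun y => f ((2:ℝ) • y) - 2 * f y) hp (c := 4)
      (K := K * 2 ^ (2 + γ) + 2 * K) (by norm_num) le_rfl hγ (fun y hy => ?_) (fun y hy => ?_) hy
    · simp only [e]
      linarith [hf y hy]
    · have h2 := hK _ (hp 2 y hy)
      have h3 := hK _ hy
      rw [norm_smul, Real.norm_of_nonneg (by norm_num), Real.mul_rpow (by norm_num)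
        (norm_nonneg _)] at h2
      rw [abs_le] at h2 h3 ⊢
      constructor <;> linarith [h2.1, h2.2, h3.1, h3.2]
  exact eq_zero_of_dilation hp (c := 2) (by norm_num) (by norm_num) hγ
    (fun y hy => by linarith [h1 y hy]) hK hy

end TaylorBounds

namespace BoundarySeq

variable {d : ℕ} {F : Filter ℕ} {D U : Set (Euc d)} {ψ : Euc d → ℝ} {p : ℕ → Euc d}
  {ρ : ℕ → ℝ} {q n : Euc d} {κ : ℝ}

/-- Projection along `n` onto the tangent space at `x` of the hypersurface `ψ = const`. -/
def tangentProj (ψ : Euc d → ℝ) (n x y : Euc d) : Euc d :=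
  y - (fderiv ℝ ψ x y / fderiv ℝ ψ x n) • n

theorem tangentProj_smul (c : ℝ) (x y : Euc d) :
    tangentProj ψ n x (c • y) = c • tangentProj ψ n x y := by
  simp only [tangentProj, map_smul, smul_eq_mul]
  module

/-- Quadratic approximation of a quadratic polynomial along the scaled boundary. -/
def boundaryPoly (ψ : Euc d → ℝ) (n x : Euc d) (r : ℝ) (b : Euc d →L[ℝ] ℝ)
    (B : Euc d →L[ℝ] Euc d →L[ℝ] ℝ) (y : Euc d) : ℝ :=
  b (tangentProj ψ n x y) + B (tangentProj ψ n x y) (tangentProj ψ n x y) / 2 -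
    r / 2 * hess ψ x (tangentProj ψ n x y) (tangentProj ψ n x y) / fderiv ℝ ψ x n * b n

theorem boundaryPoly_relation (x : Euc d) (r : ℝ) (b : Euc d →L[ℝ] ℝ)
    (B : Euc d →L[ℝ] Euc d →L[ℝ] ℝ) (y : Euc d) :
    boundaryPoly ψ n x r b B ((4:ℝ) • y) - 6 * boundaryPoly ψ n x r b B ((2:ℝ) • y) +
      8 * boundaryPoly ψ n x r b B y = 0 := by
  simp only [boundaryPoly, tangentProj_smul, map_smul, smul_apply, smul_eq_mul]
  ring

theorem tendsto_sub_boundaryPoly (h : BoundarySeq F D U ψ p ρ q n κ) {y : Euc d}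
    (hy : inner ℝ n y = 0) {σ : ℕ → ℝ} (hσ : Tendsto σ F (𝓝 0))
    (hroot : ∀ᶠ k in F, ψ (p k + ρ k • (y + σ k • n)) = 0) {b : ℕ → Euc d →L[ℝ] ℝ}
    {B : ℕ → Euc d →L[ℝ] Euc d →L[ℝ] ℝ} (hb : Tendsto (fun k => ρ k ^ 2 * ‖b k‖) F (𝓝 0))
    (hB : Tendsto (fun k => ρ k * ‖B k‖) F (𝓝 0)) :
    Tendsto (fun k => b k (y + σ k • n) + B k (y + σ k • n) (y + σ k • n) / 2 -
      boundaryPoly ψ n (p k) (ρ k) (b k) (B k) y) F (𝓝 0) := by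
  have hκ := h.κ_pos
  obtain ⟨δ, hδ, K, hK, htaylor⟩ := exists_taylor_three h.contDiff q
  have hnn : inner ℝ n n = 1 := by rw [real_inner_self_eq_norm_sq, h.norm_normal]; norm_num
  have hc : Continuous (fderiv ℝ ψ) := h.contDiff.continuous_fderiv (by norm_num)
  have hNlim : ∀ z, Tendsto (fun k => fderiv ℝ ψ (p k) z) F (𝓝 (-(κ * inner ℝ n z))) := by
    intro z
    rw [← h.fderiv_eq]
    exact ((hc.clm_apply continuous_const).tendsto q).comp h.tendsto_point
  have hNn := hNlim n
  have hNy := hNlim y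
  rw [hnn, mul_one] at hNn
  rw [hy, mul_zero, neg_zero] at hNy
  have hquot : Tendsto (fun k => fderiv ℝ ψ (p k) y / fderiv ℝ ψ (p k) n) F (𝓝 0) := by
    have := hNy.div hNn (neg_ne_zero.2 hκ.ne')
    rwa [zero_div] at this
  have hm : ∀ᶠ k in F, κ / 2 ≤ |fderiv ℝ ψ (p k) n| := by
    filter_upwards [hNn.eventually (gt_mem_nhds (show -κ < -(κ / 2) by linarith))] with k hk
    rw [abs_of_neg (by linarith)]; linarith
  obtain ⟨R, hRdef⟩ : ∃ R, R = ‖y‖ + 1 := ⟨_, rfl⟩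
  have hR : 1 ≤ R := by rw [hRdef]; linarith [norm_nonneg y]
  have hnorm : ∀ t : ℝ, |t| ≤ 1 → ‖y + t • n‖ ≤ R := by
    intro t ht
    refine (norm_add_le _ _).trans ?_
    rw [norm_smul, h.norm_normal, mul_one, Real.norm_eq_abs, hRdef]
    linarith
  have hsmall : ∀ {t : ℕ → ℝ}, Tendsto t F (𝓝 0) → ∀ᶠ k in F, |t k| ≤ 1 := by
    intro t ht
    have := Metric.tendsto_nhds.1 ht 1 one_pos
    filter_upwards [this] with k hk
    rw [Real.dist_eq, sub_zero] at hk
    exact hk.le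
  have hρ1 := hsmall h.tendsto_scale
  have hlim : Tendsto (fun k => ((K * R ^ 3 + K * R * (2 * K * R ^ 3 / (κ / 2))) / (κ / 2) +
      R * (2 * K * R ^ 3 / (κ / 2))) * (ρ k ^ 2 * ‖b k‖ + ρ k * ‖B k‖)) F (𝓝 0) := by
    simpa using (hb.add hB).const_mul _
  refine squeeze_zero_norm' ?_ hlim
  filter_upwards [hroot, hsmall hσ, hsmall hquot, hρ1, hm, h.eventually_ball R hδ,
    h.eventually_ball R (Metric.isOpen_iff.1 h.isOpen_chart q h.mem_chart).choose_spec.1]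
    with k h1 h2 h3 h4 h5 h6 h7
  have hpos := h.pos k
  have hyR := hnorm _ h2
  have hp0 : p k ∈ Metric.ball q δ := by simpa using h6 0 (by simp; linarith)
  have hpU : p k ∈ U := by
    have := h7 0 (by simp; linarith)
    rw [smul_zero, add_zero] at this
    exact (Metric.isOpen_iff.1 h.isOpen_chart q h.mem_chart).choose_spec.2 this
  obtain ⟨h8, h9⟩ := htaylor (p k) hp0 (ρ k • (y + σ k • n)) (h6 _ hyR)
  have hψ0 := h.eq_zero_of_mem_frontier (h.mem_frontier k) hpU
  rw [Real.norm_eq_abs, boundaryPoly]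
  have hN0 : fderiv ℝ ψ (p k) n ≠ 0 := by rw [← abs_pos]; linarith
  refine abs_quadratic_sub_le (N := fderiv ℝ ψ (p k)) (H := hess ψ (p k))
    (σ := σ k + fderiv ℝ ψ (p k) y / fderiv ℝ ψ (p k) n) (K := K) (R := R) h.norm_normal hpos
    (le_of_abs_le h4) hK hR (half_pos hκ) h5 ?_ ?_ ?_ hyR h9 ?_
  · rw [tangentProj, map_sub, map_smul, smul_eq_mul, div_mul_cancel₀ _ hN0, sub_self]
  · rw [tangentProj]; module
  · rw [tangentProj, sub_eq_add_neg, ← neg_smul]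
    exact hnorm _ (by rwa [abs_neg])
  · rw [h1, hψ0, norm_smul, Real.norm_of_nonneg hpos.le] at h8
    simp only [map_smul, smul_apply, smul_eq_mul] at h8
    rw [← mul_le_mul_iff_right₀ hpos]
    calc ρ k * |fderiv ℝ ψ (p k) (y + σ k • n) + ρ k / 2 * hess ψ (p k) (y + σ k • n) (y + σ k • n)|
        = |0 - 0 - ρ k * fderiv ℝ ψ (p k) (y + σ k • n) -
          ρ k * (ρ k * hess ψ (p k) (y + σ k • n) (y + σ k • n)) / 2| := by
          rw [← abs_of_pos hpos, ← abs_mul, abs_of_pos hpos, ← abs_neg]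
          congr 1; ring
      _ ≤ _ := h8
      _ = _ := by ring

end BoundarySeq
end

section

namespace ScaledSol

variable {E ι : Type*} [NormedAddCommGroup E] [InnerProductSpace ℝ E] [Fintype ι]
  {b : OrthonormalBasis ι ℝ E} {ν γ L T : ℝ} {S : Set E} {w f : ℝ → E → ℝ}

theorem taylorRem_le (h : ScaledSol b ν γ L T S w f) (hγ : 0 < γ) (hν : 0 ≤ ν) (hL : 0 ≤ L)
    {R τ : ℝ} (hτ : τ ∈ Icc (-T) 0) (hτR : -R ≤ τ) {y : E} (hy : SegIn S 0 y) (hyR : ‖y‖ ≤ R)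
    (hf : ∀ τ' ∈ Icc τ 0, |f τ' y - f 0 0| ≤ 1) :
    |taylorRem b ν w f τ y| ≤ L * R ^ (2 + γ) + R * (ν * (Fintype.card ι * L) * R ^ (γ / 2) + 1) +
      R * (ν * (Fintype.card ι * (L * R ^ γ))) := by
  have hyS : y ∈ S := by simpa using hy.right
  have hτ0 : 0 ≤ -τ := by linarith [hτ.2]
  have hτR' : -τ ≤ R := by linarith
  have hR0 : 0 ≤ R := hτ0.trans hτR'
  have h1 := h.time_le hγ hν hL (τ := 0) (σ := -τ) (ε := 1) hτ0 le_rfl (by simpa using hτ.1) hyS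
    (by simpa using hf)
  have h2 := h.init_le hγ hL hy
  obtain ⟨tr, htr⟩ : ∃ x : ℝ, x = ∑ i, (hess (w 0) y - hess (w 0) 0) (b i) (b i) := ⟨_, rfl⟩
  have h4 : |tr| ≤ Fintype.card ι * (L * R ^ γ) := by
    rw [htr]
    refine (abs_trace_le b _).trans ?_
    have h5 := h.hess_sub_le (τ := 0) ⟨by linarith [h.nonneg], le_rfl⟩ hyS
    rw [abs_zero, Real.zero_rpow (by positivity), add_zero] at h5
    refine mul_le_mul_of_nonneg_left (h5.trans ?_) (by positivity)
    gcongr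
  rw [← htr, zero_sub, neg_neg] at h1
  have h5 : |(-τ) * (ν * tr)| ≤ R * (ν * (Fintype.card ι * (L * R ^ γ))) := by
    rw [abs_mul, abs_mul, abs_of_nonneg hτ0, abs_of_nonneg hν]
    gcongr
  have h6 : L * ‖y‖ ^ (2 + γ) ≤ L * R ^ (2 + γ) := by gcongr
  have h7 : -τ * (ν * (Fintype.card ι * L) * (-τ) ^ (γ / 2) + 1) ≤
      R * (ν * (Fintype.card ι * L) * R ^ (γ / 2) + 1) := by gcongr
  rw [abs_le] at h1 h2 h5 ⊢
  constructor <;> linarith [h1.1, h1.2, h2.1, h2.2, h5.1, h5.2]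

theorem taylorRem_sub_le (h : ScaledSol b ν γ L T S w f) {τ : ℝ} (hτ : τ ∈ Icc (-T) 0) {q e : E}
    (hs : SegIn S q e) {B C : ℝ}
    (hB : ∀ σ ∈ Icc (0:ℝ) 1, ‖hess (w τ) (q + σ • e) - hess (w 0) 0‖ ≤ B)
    (h1 : |taylorRem b ν w f τ (q + e)| ≤ C)
    (h2 : |taylorRem b ν w f τ (q + (1 / 2 : ℝ) • e)| ≤ C) {σ : ℝ} (hσ : σ ∈ Icc (0:ℝ) 1) :
    |taylorRem b ν w f τ (q + σ • e) - taylorRem b ν w f τ q| ≤ (4 * C + B * ‖e‖ ^ 2) * σ := by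
  obtain ⟨Q, hQ⟩ : ∃ Q, Q = hess (w 0) 0 := ⟨_, rfl⟩
  have hline : ∀ t : ℝ, HasDerivAt (fun t : ℝ => q + t • e) e t := fun t => by
    simpa using ((hasDerivAt_id t).smul_const e).const_add q
  obtain ⟨c, hc⟩ : ∃ c : ℝ, c = w 0 0 + fderiv ℝ (w 0) 0 q + Q q q / 2 +
    τ * (ν * ∑ i, Q (b i) (b i) + f 0 0) := ⟨_, rfl⟩
  obtain ⟨a, ha⟩ : ∃ a : ℝ, a = fderiv ℝ (w 0) 0 e + (Q q e + Q e q) / 2 := ⟨_, rfl⟩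
  have e1 : ∀ t : ℝ, taylorRem b ν w f τ (q + t • e) =
      w τ (q + t • e) - (c + t * a + t ^ 2 * (Q e e / 2)) := by
    intro t
    simp only [taylorRem, ← hQ, hc, ha, map_add, map_smul, add_apply, smul_apply, smul_eq_mul]
    ring
  have key := abs_sub_le_of_two_values (g := fun t : ℝ => taylorRem b ν w f τ (q + t • e))
    (g' := fun t => fderiv ℝ (w τ) (q + t • e) e - (a + 2 * t * (Q e e / 2)))
    (g'' := fun t => hess (w τ) (q + t • e) e e - Q e e) (B := B * ‖e‖ ^ 2) (C := C)
    (fun t ht => ?_) (fun t ht => ?_) (fun t ht => ?_) (by simpa using h1) h2 hσ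
  · simpa using key
  · simp only [e1]
    have h3 := ((h.twice τ hτ _ (hs t ht)).1.hasFDerivAt.comp_hasDerivAt t (hline t))
    have h4 : HasDerivAt (fun t : ℝ => c + t * a + t ^ 2 * (Q e e / 2))
        (a + 2 * t * (Q e e / 2)) t := by
      have := (((hasDerivAt_id t).mul_const a).const_add c).add
        ((hasDerivAt_pow 2 t).mul_const (Q e e / 2))
      simpa using! this
    exact h3.sub h4
  · have h3 : HasDerivAt (fun t : ℝ => fderiv ℝ (w τ) (q + t • e)) (hess (w τ) (q + t • e) e) t :=
      (h.twice τ hτ _ (hs t ht)).2.hasFDerivAt.comp_hasDerivAt t (hline t)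
    have h4 : HasDerivAt (fun t : ℝ => a + 2 * t * (Q e e / 2)) (Q e e) t := by
      have := (((hasDerivAt_id t).const_mul 2).mul_const (Q e e / 2)).const_add a
      refine this.congr_deriv ?_
      ring
    have h5 := h3.clm_apply (hasDerivAt_const t e)
    rw [map_zero, add_zero] at h5
    exact h5.sub h4
  · have := (hess (w τ) (q + t • e) - hess (w 0) 0).le_opNorm₂ e e
    rw [sub_apply, sub_apply, Real.norm_eq_abs, ← hQ, mul_assoc, ← sq] at this
    refine this.trans ?_
    have := hB t ht
    rw [hQ]
    gcongr

end ScaledSol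

namespace BoundarySeq

variable {d : ℕ} {F : Ultrafilter ℕ} {D U : Set (Euc d)} {ψ : Euc d → ℝ} {p : ℕ → Euc d}
  {ρ : ℕ → ℝ} {q n : Euc d} {κ : ℝ} {ι : Type*} [Fintype ι] {b : OrthonormalBasis ι ℝ (Euc d)}
  {ν γ L : ℝ} {T : ℕ → ℝ} {w f : ℕ → ℝ → Euc d → ℝ}

theorem eventually_taylorRem_le (hB : BoundarySeq (F : Filter ℕ) D U ψ p ρ q n κ) (hν : 0 ≤ ν)
    (hγ : 0 < γ) (hL : 0 ≤ L)
    (h : ∀ k, ScaledSol b ν γ L (T k) {y | p k + ρ k • y ∈ closure D} (w k) (f k))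
    (hT : ∀ R, ∀ᶠ k in (F : Filter ℕ), R ≤ T k)
    (hf : ∀ R, ∀ ε > 0, ∀ᶠ k in (F : Filter ℕ), ∀ τ ∈ Icc (-R) 0,
      ∀ y ∈ {y | p k + ρ k • y ∈ closure D}, ‖y‖ ≤ R → |f k τ y - f k 0 0| ≤ ε)
    {R : ℝ} (hR : 0 < R) : ∃ C, 0 ≤ C ∧ ∀ c > 0, ∀ᶠ k in (F : Filter ℕ), ∀ τ ∈ Icc (-R) 0,
      ∀ y : Euc d, c ≤ inner ℝ n y → ‖y‖ ≤ R → |taylorRem b ν (w k) (f k) τ y| ≤ C := by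
  refine ⟨L * R ^ (2 + γ) + R * (ν * (Fintype.card ι * L) * R ^ (γ / 2) + 1) +
      R * (ν * (Fintype.card ι * (L * R ^ γ))), by positivity, fun c hc => ?_⟩
  filter_upwards [hB.eventually_segIn_zero hR hc, hT R, hf R 1 one_pos] with
    k h1 h2 h3 τ hτ y hy hyR
  have hs := h1 y hyR hy
  refine (h k).taylorRem_le hγ hν hL ⟨by linarith [hτ.1], hτ.2⟩ hτ.1 hs hyR ?_
  intro τ' hτ'
  exact h3 τ' ⟨hτ.1.trans hτ'.1, hτ'.2⟩ y (by simpa using hs.right) hyR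

theorem exists_increment_le (hB : BoundarySeq (F : Filter ℕ) D U ψ p ρ q n κ) (hν : 0 ≤ ν)
    (hγ : 0 < γ) (hL : 0 ≤ L)
    (h : ∀ k, ScaledSol b ν γ L (T k) {y | p k + ρ k • y ∈ closure D} (w k) (f k))
    (hT : ∀ R, ∀ᶠ k in (F : Filter ℕ), R ≤ T k)
    (hf : ∀ R, ∀ ε > 0, ∀ᶠ k in (F : Filter ℕ), ∀ τ ∈ Icc (-R) 0,
      ∀ y ∈ {y | p k + ρ k • y ∈ closure D}, ‖y‖ ≤ R → |f k τ y - f k 0 0| ≤ ε)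
    (hfr : ∀ k, ∀ y, p k + ρ k • y ∈ frontier D → ∀ τ ∈ Icc (-T k) 0,
      taylorRem b ν (w k) (f k) τ y = -(fderiv ℝ (w k 0) 0 y) - hess (w k 0) 0 y y / 2)
    {R : ℝ} (hR : 0 < R) : ∃ C, 0 ≤ C ∧ ∀ z : Euc d, inner ℝ n z = 0 → ‖z‖ ≤ R →
      ∃ σ : ℕ → ℝ, Tendsto σ F (𝓝 0) ∧
        (∀ᶠ k in (F : Filter ℕ), ψ (p k + ρ k • (z + σ k • n)) = 0) ∧
        ∀ s ∈ Ioo (0:ℝ) 1, ∀ᶠ k in (F : Filter ℕ), ∀ τ ∈ Icc (-R) 0,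
          |taylorRem b ν (w k) (f k) τ (z + s • n) + (fderiv ℝ (w k 0) 0 (z + σ k • n) +
            hess (w k 0) 0 (z + σ k • n) (z + σ k • n) / 2)| ≤ C * (s - σ k) := by
  have hR3 : 0 < R + 3 := by linarith
  have hnn : inner ℝ n n = (1:ℝ) := by rw [real_inner_self_eq_norm_sq, hB.norm_normal]; norm_num
  obtain ⟨C, hC, hCb⟩ := hB.eventually_taylorRem_le hν hγ hL h hT hf hR3
  refine ⟨4 * C + L * ((R + 3) ^ γ + (R + 3) ^ (γ / 2)), by positivity, fun z hz hzR => ?_⟩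
  obtain ⟨σ, hσ, hroot⟩ := hB.exists_root hz
  refine ⟨σ, hσ, hroot.mono fun k hk => hk.1, fun s hs => ?_⟩
  have hsmall : ∀ᶠ k in (F : Filter ℕ), |σ k| < min (1 / 4) (min s (1 - s)) := by
    have := Metric.tendsto_nhds.1 hσ (min (1 / 4) (min s (1 - s)))
      (lt_min (by norm_num) (lt_min hs.1 (by linarith [hs.2])))
    simpa [Real.dist_eq] using this
  have hnorm : ∀ t : ℝ, |t| ≤ 3 → ‖z + t • n‖ ≤ R + 3 := by
    intro t ht
    refine (norm_add_le _ _).trans ?_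
    rw [norm_smul, hB.norm_normal, mul_one, Real.norm_eq_abs]
    linarith
  have hinner : ∀ t : ℝ, inner ℝ n (z + t • n) = t := by
    intro t
    rw [inner_add_right, hz, inner_smul_right, hnn]; ring
  filter_upwards [hroot, hsmall, hCb (1 / 4) (by norm_num), hT (R + 3)] with k h1 h2 h3 h4 τ hτ
  obtain ⟨-, hfro, hseg⟩ := h1
  have h5 : |σ k| < 1 / 4 := h2.trans_le (min_le_left _ _)
  have h6 : |σ k| < s := h2.trans_le ((min_le_right _ _).trans (min_le_left _ _))
  have h7 : |σ k| < 1 - s := h2.trans_le ((min_le_right _ _).trans (min_le_right _ _))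
  rw [abs_lt] at h5 h6 h7
  have hτ3 : τ ∈ Icc (-(R + 3)) 0 := ⟨by linarith [hτ.1], hτ.2⟩
  have hτT : τ ∈ Icc (-T k) 0 := ⟨by linarith [hτ.1], hτ.2⟩
  have e1 : ∀ t : ℝ, z + σ k • n + t • n = z + (σ k + t) • n := fun t => by module
  have hsI : SegIn {y | p k + ρ k • y ∈ closure D} (z + σ k • n) n := fun t ht =>
    hseg t ⟨ht.1, by linarith [ht.2]⟩
  have key := (h k).taylorRem_sub_le hτT hsI (B := L * ((R + 3) ^ γ + (R + 3) ^ (γ / 2))) (C := C)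
    (fun t ht => ?_) ?_ ?_ (σ := s - σ k) ⟨by linarith, by linarith⟩
  · rw [hfr k _ hfro τ hτT, e1, hB.norm_normal, one_pow, mul_one, add_sub_cancel] at key
    refine le_trans (le_of_eq ?_) key
    congr 1; ring
  · refine ((h k).hess_sub_le hτT (hsI t ht)).trans ?_
    have h8 : |τ| ≤ R + 3 := by rw [abs_le]; constructor <;> linarith [hτ3.1, hτ3.2]
    have h9 : ‖z + σ k • n + t • n‖ ≤ R + 3 := by
      rw [e1]
      exact hnorm _ (abs_le.2 ⟨by linarith [ht.1], by linarith [ht.2]⟩)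
    gcongr
  · have e2 : z + σ k • n + n = z + (σ k + 1) • n := by module
    rw [e2]
    exact h3 τ hτ3 _ (by rw [hinner]; linarith) (hnorm _ (abs_le.2 ⟨by linarith, by linarith⟩))
  · rw [e1]
    exact h3 τ hτ3 _ (by rw [hinner]; linarith) (hnorm _ (abs_le.2 ⟨by linarith, by linarith⟩))

/-- Limits of Taylor remainders grow at most linearly away from the boundary. -/
theorem exists_linear_bound (hB : BoundarySeq (F : Filter ℕ) D U ψ p ρ q n κ) (hν : 0 ≤ ν)
    (hγ : 0 < γ) (hL : 0 ≤ L)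
    (h : ∀ k, ScaledSol b ν γ L (T k) {y | p k + ρ k • y ∈ closure D} (w k) (f k))
    (hT : ∀ R, ∀ᶠ k in (F : Filter ℕ), R ≤ T k)
    (hf : ∀ R, ∀ ε > 0, ∀ᶠ k in (F : Filter ℕ), ∀ τ ∈ Icc (-R) 0,
      ∀ y ∈ {y | p k + ρ k • y ∈ closure D}, ‖y‖ ≤ R → |f k τ y - f k 0 0| ≤ ε)
    (hfr : ∀ k, ∀ y, p k + ρ k • y ∈ frontier D → ∀ τ ∈ Icc (-T k) 0,
      taylorRem b ν (w k) (f k) τ y = -(fderiv ℝ (w k 0) 0 y) - hess (w k 0) 0 y y / 2)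
    (hb : Tendsto (fun k => ρ k ^ 2 * ‖fderiv ℝ (w k 0) 0‖) F (𝓝 0))
    (hH : Tendsto (fun k => ρ k * ‖hess (w k 0) 0‖) F (𝓝 0)) {v : ℝ → Euc d → ℝ}
    (hv : ∀ τ ≤ 0, ∀ y : Euc d, 0 < inner ℝ n y →
      Tendsto (fun k => taylorRem b ν (w k) (f k) τ y) F (𝓝 (v τ y))) {K : ℝ}
    (hv0 : ∀ y : Euc d, 0 < inner ℝ n y → |v 0 y| ≤ K * ‖y‖ ^ (2 + γ)) (R : ℝ) :
    ∃ C, ∀ τ ∈ Icc (-R) 0, ∀ y : Euc d, 0 < inner ℝ n y → ‖y‖ ≤ R →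
      |v τ y| ≤ C * inner ℝ n y := by
  have hnn : inner ℝ n n = (1:ℝ) := by rw [real_inner_self_eq_norm_sq, hB.norm_normal]; norm_num
  have hinner : ∀ (z : Euc d) (t : ℝ), inner ℝ n z = 0 → inner ℝ n (z + t • n) = t := by
    intro z t hz
    rw [inner_add_right, hz, inner_smul_right, hnn]; ring
  obtain ⟨P, hP⟩ : ∃ P : ℕ → Euc d → ℝ, P = fun k => boundaryPoly ψ n (p k) (ρ k)
    (fderiv ℝ (w k 0) 0) (hess (w k 0) 0) := ⟨_, rfl⟩
  have hinc : ∀ R > 0, ∃ C, 0 ≤ C ∧ ∀ z : Euc d, inner ℝ n z = 0 → ‖z‖ ≤ R →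
      ∃ P₀, Tendsto (fun k => P k z) F (𝓝 P₀) ∧
        ∀ s ∈ Ioo (0:ℝ) 1, ∀ τ ∈ Icc (-R) 0, |v τ (z + s • n) + P₀| ≤ C * s := by
    intro R hR
    obtain ⟨C, hC, hCb⟩ := hB.exists_increment_le hν hγ hL h hT hf hfr hR
    refine ⟨C, hC, fun z hz hzR => ?_⟩
    obtain ⟨σ, hσ, hroot, hle⟩ := hCb z hz hzR
    have hvt : ∀ s ∈ Ioo (0:ℝ) 1, ∀ τ ∈ Icc (-R) 0, Tendsto
        (fun k => taylorRem b ν (w k) (f k) τ (z + s • n)) F (𝓝 (v τ (z + s • n))) :=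
      fun s hs τ hτ => hv τ hτ.2 _ (by rw [hinner z s hz]; exact hs.1)
    have hrhs : ∀ s : ℝ, Tendsto (fun k => C * (s - σ k)) F (𝓝 (C * s)) := fun s => by
      simpa using (hσ.const_sub s).const_mul C
    have hhalf : (1 / 2 : ℝ) ∈ Ioo (0:ℝ) 1 := by norm_num
    have h0R : (0:ℝ) ∈ Icc (-R) 0 := ⟨by linarith, le_rfl⟩
    obtain ⟨P₀, hP₀⟩ := exists_ultrafilter_lim F (g := fun k => fderiv ℝ (w k 0) 0 (z + σ k • n) +
        hess (w k 0) 0 (z + σ k • n) (z + σ k • n) / 2)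
        (B := (C * (1 / 2) + 1) + (|v 0 (z + (1 / 2 : ℝ) • n)| + 1)) (by
      filter_upwards [hle _ hhalf, (hrhs (1 / 2)).eventually (gt_mem_nhds (lt_add_one _)),
        (hvt _ hhalf 0 h0R).abs.eventually (gt_mem_nhds (lt_add_one _))] with k h1 h2 h3
      have h4 := h1 0 h0R
      rw [Real.norm_eq_abs]
      have h5 := abs_sub (taylorRem b ν (w k) (f k) 0 (z + (1 / 2 : ℝ) • n) +
        (fderiv ℝ (w k 0) 0 (z + σ k • n) + hess (w k 0) 0 (z + σ k • n) (z + σ k • n) / 2))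
        (taylorRem b ν (w k) (f k) 0 (z + (1 / 2 : ℝ) • n))
      rw [add_sub_cancel_left] at h5
      linarith)
    refine ⟨P₀, ?_, fun s hs τ hτ => ?_⟩
    · have := hP₀.sub (hB.tendsto_sub_boundaryPoly hz hσ hroot hb hH)
      simpa [hP] using this
    · refine le_of_tendsto_of_tendsto ((hvt s hs τ hτ).add hP₀).abs (hrhs s) ?_
      filter_upwards [hle s hs] with k hk
      exact hk τ hτ
  have hex : ∀ z : Euc d, ∃ P₀, inner ℝ n z = 0 →
      Tendsto (fun k => P k z) F (𝓝 P₀) ∧ |P₀| ≤ K * ‖z‖ ^ (2 + γ) := by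
    intro z
    by_cases hz : inner ℝ n z = 0
    swap
    · exact ⟨0, fun hz' => absurd hz' hz⟩
    obtain ⟨C, -, hCb⟩ := hinc (‖z‖ + 1) (by positivity)
    obtain ⟨P₀, hP₀, hle⟩ := hCb z hz (by linarith)
    refine ⟨P₀, fun _ => ⟨hP₀, ?_⟩⟩
    have hlim : Tendsto (fun s : ℝ => C * s + K * ‖z + s • n‖ ^ (2 + γ)) (𝓝[>] 0)
        (𝓝 (K * ‖z‖ ^ (2 + γ))) := by
      refine Tendsto.mono_left ?_ nhdsWithin_le_nhds
      have hc : Continuous fun s : ℝ => C * s + K * ‖z + s • n‖ ^ (2 + γ) := by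
        have : Continuous fun s : ℝ => ‖z + s • n‖ ^ (2 + γ) :=
          (by fun_prop : Continuous fun s : ℝ => ‖z + s • n‖).rpow_const
            fun _ => Or.inr (by linarith)
        fun_prop
      simpa using hc.tendsto 0
    refine ge_of_tendsto hlim ?_
    filter_upwards [Ioo_mem_nhdsGT (zero_lt_one' ℝ)] with s hs
    have h1 := hle s hs 0 ⟨by linarith [norm_nonneg z], le_rfl⟩
    have h2 := hv0 (z + s • n) (by rw [hinner z s hz]; exact hs.1)
    have h3 := abs_sub (v 0 (z + s • n) + P₀) (v 0 (z + s • n))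
    rw [add_sub_cancel_left] at h3
    linarith
  choose P₀ hP₀ using hex
  have hzero : ∀ z : Euc d, inner ℝ n z = 0 → P₀ z = 0 := by
    intro z hz
    have hp : ∀ (c : ℝ) (y : Euc d), inner ℝ n y = (0:ℝ) → inner ℝ n (c • y) = (0:ℝ) := by
      intro c y hy
      rw [inner_smul_right, hy, mul_zero]
    refine eq_zero_of_quadratic_relation (p := fun y => inner ℝ n y = (0:ℝ)) hp hγ
      (fun y hy => ?_) (fun y hy => (hP₀ y hy).2) hz
    have h1 := (((hP₀ _ (hp 4 y hy)).1.sub ((hP₀ _ (hp 2 y hy)).1.const_mul 6)).add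
      ((hP₀ y hy).1.const_mul 8))
    refine tendsto_nhds_unique h1 ?_
    simp only [hP, boundaryPoly_relation]
    exact tendsto_const_nhds
  obtain ⟨R', hR'⟩ : ∃ R', R' = 2 * max R 1 := ⟨_, rfl⟩
  have hRR : R ≤ R' / 2 := by rw [hR']; linarith [le_max_left R 1]
  have hR1 : 2 ≤ R' := by rw [hR']; linarith [le_max_right R 1]
  obtain ⟨C, hC, hCb⟩ := hinc R' (by linarith)
  obtain ⟨C', hC', hCb'⟩ := hB.eventually_taylorRem_le hν hγ hL h hT hf (R := R') (by linarith)
  refine ⟨max C C', fun τ hτ y hy hyR => ?_⟩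
  have hτ' : τ ∈ Icc (-R') 0 := ⟨by linarith [hτ.1], hτ.2⟩
  rcases lt_or_ge (inner ℝ n y) 1 with hlt | hge
  · obtain ⟨z, hz⟩ : ∃ z, z = y - (inner ℝ n y : ℝ) • n := ⟨_, rfl⟩
    have hyz : y = z + (inner ℝ n y : ℝ) • n := by rw [hz, sub_add_cancel]
    have hz0 : inner ℝ n z = (0:ℝ) := by
      rw [hz, inner_sub_right, inner_smul_right, hnn, mul_one, sub_self]
    have hzR : ‖z‖ ≤ R' := by
      rw [hz]
      refine (norm_sub_le _ _).trans ?_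
      rw [norm_smul, hB.norm_normal, mul_one, Real.norm_of_nonneg hy.le]
      linarith
    obtain ⟨Q, hQ, hle⟩ := hCb z hz0 hzR
    have hQ0 : Q = 0 := by
      rw [← hzero z hz0]
      exact tendsto_nhds_unique hQ (hP₀ z hz0).1
    have h1 := hle _ ⟨hy, hlt⟩ τ hτ'
    rw [← hyz, hQ0, add_zero] at h1
    exact h1.trans (by gcongr; exact le_max_left _ _)
  · have h1 : |v τ y| ≤ C' := by
      refine le_of_tendsto (hv τ hτ.2 y hy).abs ?_
      filter_upwards [hCb' _ hy] with k hk
      exact hk τ hτ' y le_rfl (by linarith)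
    calc |v τ y| ≤ C' * 1 := by rwa [mul_one]
      _ ≤ max C C' * inner ℝ n y := by
        refine mul_le_mul (le_max_right _ _) hge zero_le_one ?_
        exact hC.trans (le_max_left _ _)

end BoundarySeq
end

section

theorem mem_closure_halfSpace {d : ℕ} {n y : Euc d} (hn : ‖n‖ = 1) (hy : 0 ≤ inner ℝ n y) :
    y ∈ closure {y : Euc d | 0 < inner ℝ n y} := by
  rw [Metric.mem_closure_iff]
  intro ε hε
  refine ⟨y + (ε / 2) • n, ?_, ?_⟩
  · rw [mem_ofPred_eq, inner_add_right, inner_smul_right, real_inner_self_eq_norm_sq, hn]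
    linarith
  · rw [dist_eq_norm, sub_add_cancel_left, norm_neg, norm_smul, hn,
      Real.norm_of_nonneg (by positivity)]
    linarith

namespace BlowUp

variable {d : ℕ} {D : Set (Euc d)} {γ ν : ℝ} {A : ℝ → Fin d → ℝ} {N b s C r₁ : ℝ}
  {F : Ultrafilter ℕ}

theorem tendsto_zero_of_le_div (hF : (F : Filter ℕ) ≤ atTop) {g : ℕ → ℝ} {K : ℝ}
    (h0 : ∀ n, 0 ≤ g n) (hg : ∀ n, g n ≤ K * (1 / ((n : ℝ) + 1))) : Tendsto g F (𝓝 0) := by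
  have h1 : Tendsto (fun n : ℕ => K * (1 / ((n : ℝ) + 1))) F (𝓝 0) := by
    simpa using (tendsto_one_div_add_atTop_nhds_zero_nat (𝕜 := ℝ)).mono_left hF |>.const_mul K
  exact squeeze_zero h0 hg h1

theorem tendsto_ρ (hF : (F : Filter ℕ) ≤ atTop) (hC : 1 ≤ C)
    (X : ∀ n : ℕ, BlowUp D γ ν A N b s C r₁ (1 / ((n : ℝ) + 1))) :
    Tendsto (fun n => (X n).ρ) F (𝓝 0) := by
  refine tendsto_zero_of_le_div hF (K := C) (fun n => (X n).ρ_pos.le) fun n => ?_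
  refine (X n).ρ_le.trans ?_
  have := (X n).ℓ_le
  gcongr

theorem eventually_le_time (hF : (F : Filter ℕ) ≤ atTop) (R : ℝ) :
    ∀ᶠ n : ℕ in (F : Filter ℕ), R ≤ 1 / (2 * (1 / ((n : ℝ) + 1)) ^ 2) := by
  obtain ⟨m, hm⟩ := exists_nat_ge (2 * R)
  filter_upwards [hF (eventually_ge_atTop m)] with n hn
  have h1 : (m : ℝ) ≤ n := by exact_mod_cast hn
  have h2 : 1 / (2 * (1 / ((n : ℝ) + 1)) ^ 2) = ((n : ℝ) + 1) ^ 2 / 2 := by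
    field_simp
  rw [h2]
  nlinarith

theorem eventually_rhs_sub_le (hF : (F : Filter ℕ) ≤ atTop) (hγ : γ ∈ Ioo (0:ℝ) 1) (hC : 1 ≤ C)
    (hr : 0 < r₁) (X : ∀ n : ℕ, BlowUp D γ ν A N b s C r₁ (1 / ((n : ℝ) + 1))) {p : ℕ → Euc d}
    (hp : ∀ n, p n ∈ closure D) (R : ℝ) {η : ℝ} (hη : 0 < η) :
    ∀ᶠ n in (F : Filter ℕ), ∀ τ ∈ Icc (-R) 0, ∀ y ∈ (X n).dom (p n), ‖y‖ ≤ R →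
      |(X n).rhs (p n) τ y - (X n).rhs (p n) 0 0| ≤ η := by
  have h1 : Tendsto (fun n : ℕ => 3 * C ^ 3 * max R 1 ^ 2 * (1 / ((n : ℝ) + 1))) F (𝓝 0) :=
    tendsto_zero_of_le_div hF (fun n => by positivity) fun n => le_rfl
  have h2 : Tendsto (fun n => max R 1 * (X n).ρ) F (𝓝 0) := by
    simpa using (tendsto_ρ hF hC X).const_mul (max R 1)
  filter_upwards [h1.eventually (gt_mem_nhds hη), h2.eventually (gt_mem_nhds hr),
    eventually_le_time hF R] with n h3 h4 h5 τ hτ y hy hyR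
  refine ((X n).rhs_sub_le hγ hC (by positivity) ?_ (hp n) (le_max_right R 1) h4.le
    ⟨by linarith [hτ.1], hτ.2⟩ ?_ hy (hyR.trans (le_max_left _ _))).trans h3.le
  · rw [div_le_one (by positivity)]
    linarith [(Nat.cast_nonneg n : (0:ℝ) ≤ n)]
  · linarith [hτ.1, le_max_left R 1]

theorem false_of_limit (hF : (F : Filter ℕ) ≤ atTop) (hD : IsOpen D) (hγ : γ ∈ Ioo (0:ℝ) 1)
    (hν : 0 < ν) (hA : ContDiff ℝ 2 A) (hC : 1 ≤ C) (hr : 0 < r₁)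
    (X : ∀ n : ℕ, BlowUp D γ ν A N b s C r₁ (1 / ((n : ℝ) + 1))) {p : ℕ → Euc d}
    (hp : ∀ n, p n ∈ closure D) {Ω : Set (Euc d)}
    (h0 : ∀ y ∈ Ω, ∀ᶠ n in (F : Filter ℕ), SegIn ((X n).dom (p n)) 0 y)
    (hseg : ∀ y ∈ Ω, ∀ e, y + e ∈ Ω → ∀ᶠ n in (F : Filter ℕ), SegIn ((X n).dom (p n)) y e)
    (hcl : ∀ (y : ℕ → Euc d) y₀, (∀ᶠ n in (F : Filter ℕ), y n ∈ (X n).dom (p n)) →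
      Tendsto y F (𝓝 y₀) → y₀ ∈ closure Ω) {B : ℝ}
    (hB : ∀ᶠ n in (F : Filter ℕ), ‖(X n).ρ⁻¹ • ((X n).x₂ - p n)‖ ≤ B)
    (hL : ∀ K ≥ 0, ∀ v M, IsLimitPair (EuclideanSpace.basisFun (Fin d) ℝ) ν γ K Ω v M →
      (∀ τ ≤ 0, ∀ y ∈ Ω, Tendsto (fun n => taylorRem (EuclideanSpace.basisFun (Fin d) ℝ) ν
        ((X n).sol (p n)) ((X n).rhs (p n)) τ y) F (𝓝 (v τ y))) →
      ∀ τ ≤ 0, ∀ y ∈ Ω, M τ y = 0) : False := by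
  have hsol : ∀ n : ℕ, ScaledSol (EuclideanSpace.basisFun (Fin d) ℝ) ν γ 4
      (1 / (2 * (1 / ((n : ℝ) + 1)) ^ 2)) ((X n).dom (p n)) ((X n).sol (p n)) ((X n).rhs (p n)) :=
    fun n => (X n).scaledSol hD hA (by positivity) (hp n)
  obtain ⟨v, M, hpair, hv, hM⟩ := exists_isLimitPair F hν.le hγ.1 (by norm_num) hsol
    (eventually_le_time hF) (fun R ε hε => eventually_rhs_sub_le hF hγ hC hr X hp R hε) h0 hseg
  have hM0 := hL _ (by positivity) v M hpair hv
  have hM' : ∀ τ ≤ 0, ∀ y ∈ Ω, Tendsto (fun n => hess ((X n).sol (p n) τ) y -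
      hess ((X n).sol (p n) 0) 0) F (𝓝 0) := fun τ hτ y hy => by
    rw [← hM0 τ hτ y hy]; exact hM τ hτ y hy
  obtain ⟨y₂, hy₂⟩ := exists_ultrafilter_lim F hB
  obtain ⟨y₁, hy₁⟩ := exists_ultrafilter_lim F
    (g := fun n => (X n).ρ⁻¹ • ((X n).x₁ - p n)) (B := B + 1) (by
    filter_upwards [hB] with n hn
    have h1 := (X n).pair_close (p n)
    have h2 := norm_sub_norm_le ((X n).ρ⁻¹ • ((X n).x₁ - p n)) ((X n).ρ⁻¹ • ((X n).x₂ - p n))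
    linarith)
  have hm₁ : ∀ᶠ n in (F : Filter ℕ), (X n).ρ⁻¹ • ((X n).x₁ - p n) ∈ (X n).dom (p n) :=
    Eventually.of_forall fun n => (X n).pair_mem₁ (p n)
  have hm₂ : ∀ᶠ n in (F : Filter ℕ), (X n).ρ⁻¹ • ((X n).x₂ - p n) ∈ (X n).dom (p n) :=
    Eventually.of_forall fun n => (X n).pair_mem₂ (p n)
  have l₁ := tendsto_hess_of_limit_eq_zero F (R := 1) hγ.1 (by norm_num) hsol
    (eventually_le_time hF) h0 hM'
    (τ := fun n => ((X n).t₁ - (X n).t₂) / (X n).ρ ^ 2)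
    (Eventually.of_forall fun n => (X n).pair_time_mem) hm₁ hy₁ (hcl _ _ hm₁ hy₁)
  have l₂ := tendsto_hess_of_limit_eq_zero F (R := 1) hγ.1 (by norm_num) hsol
    (eventually_le_time hF) h0 hM' (τ := fun _ => 0)
    (Eventually.of_forall fun n => by norm_num) hm₂ hy₂ (hcl _ _ hm₂ hy₂)
  have l := (l₁.sub l₂).norm
  rw [sub_zero, norm_zero] at l
  have : (1 / 2 : ℝ) ≤ 0 := by
    refine ge_of_tendsto l (Eventually.of_forall fun n => ?_)
    rw [sub_sub_sub_cancel_right]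
    exact (X n).pair_large (p n)
  norm_num at this

theorem not_forall_blowUp (hd : 0 < d) (hD : GoodDomain D) (hγ : γ ∈ Ioo (0:ℝ) 1)
    (hν : 0 < ν) (hA : ContDiff ℝ 2 A) (hC : 1 ≤ C) (hr : 0 < r₁)
    (X : ∀ n : ℕ, BlowUp D γ ν A N b s C r₁ (1 / ((n : ℝ) + 1))) : False := by
  have : Nonempty (Fin d) := ⟨⟨0, hd⟩⟩
  have : NoncompactSpace (Euc d) := NormedSpace.noncompactSpace ℝ (Euc d)
  obtain ⟨hDo, -, hDb, hDc⟩ := hD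
  obtain ⟨F, hF⟩ : ∃ F : Ultrafilter ℕ, (F : Filter ℕ) ≤ atTop :=
    ⟨hyperfilter ℕ, Nat.hyperfilter_le_atTop⟩
  have hne : closure D ≠ univ := (hDb.isCompact_closure).ne_univ
  by_cases hcase : ∀ B : ℝ, ∀ᶠ n in (F : Filter ℕ),
      B * (X n).ρ ≤ Metric.infDist (X n).x₂ (closure D)ᶜ
  · have hmem : ∀ R : ℝ, ∀ᶠ n in (F : Filter ℕ), ∀ z : Euc d, ‖z‖ ≤ R →
        z ∈ (X n).dom (X n).x₂ := by
      intro R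
      filter_upwards [hcase (R + 1)] with n hn z hz
      change (X n).x₂ + (X n).ρ • z ∈ closure D
      by_contra hcon
      have h1 := Metric.infDist_le_dist_of_mem (x := (X n).x₂) (mem_compl hcon)
      rw [dist_eq_norm, sub_add_cancel_left, norm_neg, norm_smul,
        Real.norm_of_nonneg (X n).ρ_pos.le] at h1
      nlinarith [(X n).ρ_pos]
    have hseg : ∀ y e : Euc d, ∀ᶠ n in (F : Filter ℕ), SegIn ((X n).dom (X n).x₂) y e := by
      intro y e
      filter_upwards [hmem (‖y‖ + ‖e‖)] with n hn σ hσ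
      refine hn _ ((norm_add_le _ _).trans ?_)
      rw [norm_smul, Real.norm_of_nonneg hσ.1]
      nlinarith [hσ.2, norm_nonneg e]
    exact false_of_limit hF hDo hγ hν hA hC hr X (p := fun n => (X n).x₂)
      (fun n => (X n).x₂_mem) (Ω := univ) (fun y _ => hseg 0 y) (fun y _ e _ => hseg y e)
      (fun y y₀ _ _ => by simp) (B := 0) (Eventually.of_forall fun n => by simp)
      (fun K hK v M hpair _ τ hτ y _ => hpair.eq_zero_univ hν hγ hK hτ y)
  · push Not at hcase
    obtain ⟨B, hB⟩ := hcase
    have hB' : ∀ᶠ n in (F : Filter ℕ), Metric.infDist (X n).x₂ (closure D)ᶜ < B * (X n).ρ :=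
      hB
    choose p hpf hpd using fun n => exists_mem_frontier_infDist_compl_eq_dist (X n).x₂_mem hne
    have hpf' : ∀ n, p n ∈ frontier D := fun n => frontier_closure_subset (hpf n)
    have hpc : ∀ n, p n ∈ closure D := fun n => frontier_subset_closure (hpf' n)
    have hcpt : IsCompact (frontier D) :=
      hDb.isCompact_closure.of_isClosed_subset isClosed_frontier frontier_subset_closure
    obtain ⟨q, hq, hpq⟩ := hcpt.ultrafilter_le_nhds (F.map p) (by
      rw [le_principal_iff, Ultrafilter.coe_map, Filter.mem_map]
      exact Eventually.of_forall hpf')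
    obtain ⟨U, ψ, hU, hqU, hψ, hψ0, hDU⟩ := hDc q hq
    obtain ⟨n, hn, hnψ⟩ := exists_riesz (fderiv ℝ ψ q) (hψ0 q hqU)
    have hbs : BoundarySeq (F : Filter ℕ) D U ψ p (fun n => (X n).ρ) q n ‖fderiv ℝ ψ q‖ :=
      ⟨hDo, hU, hqU, hψ, hDU, hpf', fun n => (X n).ρ_pos, tendsto_ρ hF hC X, hpq, hn,
        norm_pos_iff.2 (hψ0 q hqU), hnψ⟩
    have hε : ∀ k : ℕ, (0:ℝ) < 1 / ((k : ℝ) + 1) := fun k => by positivity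
    have hε1 : ∀ k : ℕ, 1 / ((k : ℝ) + 1) ≤ 1 := fun k => by
      rw [div_le_one (by positivity)]
      linarith [(Nat.cast_nonneg k : (0:ℝ) ≤ k)]
    refine false_of_limit hF hDo hγ hν hA hC hr X hpc (Ω := {y | 0 < inner ℝ n y})
      (fun y hy => ?_) (fun y hy e he => hbs.eventually_segIn hy he)
      (fun y y₀ hy hy₀ => mem_closure_halfSpace hn (hbs.inner_nonneg_of_tendsto hy hy₀))
      (B := B) ?_ ?_
    · filter_upwards [hbs.eventually_segIn_zero (R := ‖y‖ + 1) (by positivity) hy] with k hk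
      exact hk y (by linarith) le_rfl
    · filter_upwards [hB'] with k hk
      rw [hpd, dist_eq_norm] at hk
      rw [norm_smul, norm_inv, Real.norm_of_nonneg (X k).ρ_pos.le, inv_mul_le_iff₀ (X k).ρ_pos]
      linarith
    · intro K hK v M hpair hv τ hτ y hy
      refine hpair.eq_zero_halfSpace hn hν hγ hK (fun R => ?_) hτ hy
      refine hbs.exists_linear_bound (b := EuclideanSpace.basisFun (Fin d) ℝ) hν.le hγ.1
        (by norm_num : (0:ℝ) ≤ 4)
        (fun k => (X k).scaledSol hDo hA (hε k) (hpc k)) (eventually_le_time hF)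
        (fun R η hη => eventually_rhs_sub_le hF hγ hC hr X hpc R hη)
        (fun k y hy τ hτ => (X k).taylorRem_frontier hA (hε k) (hpf' k) hy hτ) ?_ ?_ hv
        hpair.init R
      · exact tendsto_zero_of_le_div hF (fun k => by positivity)
          fun k => (X k).norm_fderiv_sol_le hγ hC (hε k) (hε1 k) (hpc k)
      · exact tendsto_zero_of_le_div hF
          (fun k => mul_nonneg (X k).ρ_pos.le (norm_nonneg _))
          fun k => (X k).norm_hess_sol_le hγ hC (hε k) (hpc k)

end BlowUp
end

section

/-- A bounded function which is Lipschitz at small distances is Hölder continuous. -/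
theorem holder_of_lipschitz_of_le {X Y : Type*} [NormedAddCommGroup X] [NormedAddCommGroup Y]
    {S : Set X} {g : X → Y} {γ δ K L : ℝ} (hγ : γ ∈ Ioo (0:ℝ) 1) (hδ : 0 < δ) (hL : 0 ≤ L)
    (hK : ∀ x ∈ S, ‖g x‖ ≤ K)
    (hg : ∀ x ∈ S, ∀ y ∈ S, ‖x - y‖ ≤ δ → ‖g x - g y‖ ≤ L * ‖x - y‖) :
    ∀ x ∈ S, ∀ y ∈ S, ‖g x - g y‖ ≤ (2 * K / δ ^ γ + L * δ ^ (1 - γ)) * ‖x - y‖ ^ γ := by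
  intro x hx y hy
  have hK0 : 0 ≤ K := (norm_nonneg _).trans (hK x hx)
  have p1 : 0 < δ ^ γ := Real.rpow_pos_of_pos hδ _
  have p2 : 0 < δ ^ (1 - γ) := Real.rpow_pos_of_pos hδ _
  have p3 : 0 ≤ ‖x - y‖ ^ γ := by positivity
  rw [add_mul]
  rcases le_or_gt ‖x - y‖ δ with h | h
  · have e : ‖x - y‖ = ‖x - y‖ ^ (1 - γ) * ‖x - y‖ ^ γ := by
      rw [← Real.rpow_add_of_nonneg (norm_nonneg _) (by linarith [hγ.2]) hγ.1.le]
      simp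
    have h1 : ‖x - y‖ ^ (1 - γ) ≤ δ ^ (1 - γ) :=
      Real.rpow_le_rpow (norm_nonneg _) h (by linarith [hγ.2])
    have h2 : L * ‖x - y‖ ≤ L * δ ^ (1 - γ) * ‖x - y‖ ^ γ := by
      calc L * ‖x - y‖ = L * (‖x - y‖ ^ (1 - γ) * ‖x - y‖ ^ γ) := by rw [← e]
        _ ≤ L * (δ ^ (1 - γ) * ‖x - y‖ ^ γ) := by gcongr
        _ = _ := by ring
    have h3 : 0 ≤ 2 * K / δ ^ γ * ‖x - y‖ ^ γ := by positivity
    linarith [hg x hx y hy h]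
  · have h1 : δ ^ γ ≤ ‖x - y‖ ^ γ := Real.rpow_le_rpow hδ.le h.le hγ.1.le
    have h2 : 2 * K ≤ 2 * K / δ ^ γ * ‖x - y‖ ^ γ := by
      rw [div_mul_eq_mul_div, le_div_iff₀ p1]
      gcongr
    have h3 : 0 ≤ L * δ ^ (1 - γ) * ‖x - y‖ ^ γ := by positivity
    linarith [norm_sub_le (g x) (g y), hK x hx, hK y hy]

theorem parHolderBound.mono {d : ℕ} {Y : Type*} [NormedAddCommGroup Y] {γ : ℝ} {J : Set ℝ}
    {D : Set (Euc d)} {f : ℝ → Euc d → Y} {N N' : ℝ} (h : parHolderBound γ J D f N)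
    (hN : N ≤ N') : parHolderBound γ J D f N' :=
  ⟨fun t ht x hx => (h.1 t ht x hx).trans hN, fun t₁ ht₁ t₂ ht₂ x₁ hx₁ x₂ hx₂ =>
    (h.2 t₁ ht₁ t₂ ht₂ x₁ hx₁ x₂ hx₂).trans (by gcongr)⟩

/-- Interpolation: bounds on a function and on the Hölder seminorm of its second differential
control the full `C^{2+γ}` norm. -/
theorem exists_c2gammaBound {d : ℕ} {D : Set (Euc d)} {γ : ℝ} (hD : GoodDomain D)
    (hγ : γ ∈ Ioo (0:ℝ) 1) {M Λ : ℝ} (hM0 : 0 ≤ M) (hΛ : 0 ≤ Λ) :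
    ∃ K ≥ 0, ∀ f : Euc d → ℝ, TwiceDiffOn (closure D) f →
      (∀ x ∈ closure D, ∀ v w, hess f x v w = hess f x w v) → (∀ x ∈ closure D, |f x| ≤ M) →
      (∀ x ∈ closure D, ∀ y ∈ closure D, ‖hess f x - hess f y‖ ≤ Λ * ‖x - y‖ ^ γ) →
      C2gammaBound γ D f K := by
  obtain ⟨r, κ, hS⟩ := exists_coneCond hD
  have hr : 0 < r := hS.1
  have hκ : 0 < κ := hS.2.1
  have hγ0 := hγ.1
  obtain ⟨B₂, hB₂⟩ : ∃ y : ℝ, y = 16 * M / (κ * r) ^ 2 + 2 * (Λ * (2 * r) ^ γ) := ⟨_, rfl⟩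
  obtain ⟨B₁, hB₁⟩ : ∃ y : ℝ, y = 4 * M / (κ * r) + 4 * B₂ * r := ⟨_, rfl⟩
  obtain ⟨δ, hδ⟩ : ∃ y : ℝ, y = κ * r / 2 := ⟨_, rfl⟩
  have hδ0 : 0 < δ := by rw [hδ]; positivity
  have hB₂0 : 0 ≤ B₂ := by rw [hB₂]; positivity
  have hB₁0 : 0 ≤ B₁ := by rw [hB₁]; positivity
  obtain ⟨H₀, hH₀⟩ : ∃ y : ℝ, y = 2 * M / δ ^ γ + (4 / κ + 1) * B₁ * δ ^ (1 - γ) := ⟨_, rfl⟩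
  obtain ⟨H₁, hH₁⟩ : ∃ y : ℝ, y = 2 * B₁ / δ ^ γ + (4 / κ + 1) * B₂ * δ ^ (1 - γ) := ⟨_, rfl⟩
  have hH₀0 : 0 ≤ H₀ := by rw [hH₀]; positivity
  have hH₁0 : 0 ≤ H₁ := by rw [hH₁]; positivity
  refine ⟨M + B₁ + B₂ + H₀ + H₁ + Λ, by positivity, fun f hf hsymm hM hH => ?_⟩
  have b2 : ∀ x ∈ closure D, ‖hess f x‖ ≤ B₂ := fun x hx => by
    rw [hB₂]
    refine hS.hess_le hf hx (hsymm x hx) hM hr le_rfl fun y hy hyx => ?_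
    exact (hH y hy x hx).trans (by gcongr)
  have b1 : ∀ x ∈ closure D, ‖fderiv ℝ f x‖ ≤ B₁ := fun x hx => by
    rw [hB₁]
    exact hS.fderiv_le hf hx hM hr le_rfl b2
  have n0 := holder_of_lipschitz_of_le (g := f) hγ hδ0
    (by positivity : 0 ≤ (4 / κ + 1) * B₁) hM fun x hx y hy h =>
      hS.sub_le hf hy hx (by linarith) b1
  have n1 := holder_of_lipschitz_of_le (g := fderiv ℝ f) hγ hδ0
    (by positivity : 0 ≤ (4 / κ + 1) * B₂) b1 fun x hx y hy h =>
      hS.fderiv_sub_le hf hy hx (by linarith) b2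
  rw [← hH₀] at n0
  rw [← hH₁] at n1
  refine ⟨⟨fun x hx => (hM x hx).trans (by linarith), fun x hx y hy =>
    (n0 x hx y hy).trans ?_⟩, ⟨fun x hx => (b1 x hx).trans (by linarith), fun x hx y hy =>
    (n1 x hx y hy).trans ?_⟩, ⟨fun x hx => (b2 x hx).trans (by linarith), fun x hx y hy =>
    (hH x hx y hy).trans ?_⟩⟩
  all_goals exact mul_le_mul_of_nonneg_right (by linarith) (by positivity)

/-- Uniform smoothing estimate with fixed bounds on the data. -/
theorem AdmSol.exists_c2gammaNorm_le {d : ℕ} {D : Set (Euc d)} {γ ν N b : ℝ}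
    {A : ℝ → Fin d → ℝ} (hd : 0 < d) (hD : GoodDomain D) (hγ : γ ∈ Ioo (0:ℝ) 1) (hν : 0 < ν)
    (hA : ContDiff ℝ 2 A) (hN : 0 ≤ N) (hb : 0 ≤ b) {s : ℝ} (hs : 0 < s) :
    ∃ K ≥ 0, ∀ h u, AdmSol D γ ν A N b h u → C2gammaNorm γ D (u s) ≤ K := by
  obtain ⟨Θ, hΘ, H⟩ := AdmSol.exists_uniform_weightedHolder hD hγ hν hA hN hb hs
    fun C r₁ hC hr X => BlowUp.not_forall_blowUp hd hD hγ hν hA hC hr X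
  have p : 0 < s ^ (1 + γ / 2) := Real.rpow_pos_of_pos hs _
  obtain ⟨K, hK, H'⟩ := exists_c2gammaBound hD hγ
    (by positivity : 0 ≤ b + (N + 1) * s) (by positivity : 0 ≤ Θ / s ^ (1 + γ / 2))
  refine ⟨K, hK, fun h u S => csInf_le ⟨0, fun _ h => h.1⟩ ⟨hK, H' _ (S.twiceDiff hs.le)
    (fun x hx => S.hess_symm hD.1 hs.le hx)
    (fun x hx => S.abs_le hD.1 hD.2.2.1 hν hA hs.le hx) fun x hx y hy => ?_⟩⟩
  have := H h u S s s hs le_rfl le_rfl x hx y hy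
  rw [sub_self, abs_zero, Real.zero_rpow (by linarith [hγ.1]), zero_add] at this
  rw [div_mul_eq_mul_div, le_div_iff₀ p]
  linarith

theorem exists_monotone_majorant (B : ℕ → ℕ → ℝ) (hB : ∀ i j, 0 ≤ B i j) :
    ∃ Cs : ℝ → ℝ → ℝ, (∀ a₁ a₂ b₁ b₂, a₁ ≤ a₂ → b₁ ≤ b₂ → Cs a₁ b₁ ≤ Cs a₂ b₂) ∧
      (∀ a b, 0 ≤ Cs a b) ∧ ∀ a b, B ⌈a⌉₊ ⌈b⌉₊ ≤ Cs a b := by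
  refine ⟨fun a b => ∑ p ∈ Finset.range (⌈a⌉₊ + 1) ×ˢ Finset.range (⌈b⌉₊ + 1), B p.1 p.2,
    fun a₁ a₂ b₁ b₂ ha hb => ?_, fun a b => Finset.sum_nonneg fun _ _ => hB _ _, fun a b => ?_⟩
  · have h1 := Nat.ceil_mono ha
    have h2 := Nat.ceil_mono hb
    refine Finset.sum_le_sum_of_subset_of_nonneg (Finset.product_subset_product ?_ ?_)
      fun _ _ _ => hB _ _
    all_goals exact Finset.range_subset_range.2 (by omega)
  · exact Finset.single_le_sum (f := fun p : ℕ × ℕ => B p.1 p.2) (fun _ _ => hB _ _)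
      (a := (⌈a⌉₊, ⌈b⌉₊)) (by simp)

theorem SignCondition.pos_dim {d : ℕ} {A : ℝ → Fin d → ℝ} {c C : ℝ} (h : SignCondition A c C)
    (hc : 0 < c) (hC : 0 < C) : 0 < d := by
  rcases Nat.eq_zero_or_pos d with rfl | hd
  · have := h ((C + 1) / c)
    rw [abs_of_pos (by positivity), mul_div_cancel₀ _ hc.ne'] at this
    simp at this
    linarith
  · exact hd

theorem parHolderBound_norm_add_one {d : ℕ} {γ : ℝ} {J : Set ℝ} {D : Set (Euc d)}
    {h : ℝ → Euc d → ℝ} (H : MemParHolder γ J D h) :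
    parHolderBound γ J D h (parHolderNorm γ J D h + 1) := by
  obtain ⟨-, N, hN⟩ := H
  have hne : {N : ℝ | 0 ≤ N ∧ parHolderBound γ J D h N}.Nonempty :=
    ⟨max N 0, le_max_right _ _, hN.mono (le_max_left _ _)⟩
  obtain ⟨N', hN', hlt⟩ := Real.lt_sInf_add_pos hne one_pos
  exact hN'.2.mono hlt.le

end

end

/-- parabolic regularisation, inequality (1.15): for any `s > 0` there is a
function `C_s`, increasing in both arguments, such that
`‖u(s,·)‖_{C^{2+γ}} ≤ C_s(|||h|||_γ, ‖u₀‖_{L^∞})` for every solution `u ∈ X^γ`. -/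
theorem stmt_6 {d : ℕ} (D : Set (Euc d)) (hD : GoodDomain D)
    (γ ν c C : ℝ) (hγ : γ ∈ Ioo (0:ℝ) 1) (hν : 0 < ν) (hc : 0 < c) (hC : 0 < C)
    (A : ℝ → Fin d → ℝ) (hA : ContDiff ℝ 2 A) (hA0 : A 0 = 0) (hsgn : SignCondition A c C) :
    ∀ s : ℝ, 0 < s → ∃ Cs : ℝ → ℝ → ℝ,
      (∀ a₁ a₂ b₁ b₂ : ℝ, a₁ ≤ a₂ → b₁ ≤ b₂ → Cs a₁ b₁ ≤ Cs a₂ b₂) ∧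
      (∀ a b, 0 ≤ Cs a b) ∧
      ∀ h : ℝ → Euc d → ℝ, ∀ u₀ : Euc d → ℝ, ∀ u : ℝ → Euc d → ℝ,
        MemParHolder γ (Ici 0) D h →
        MemXgamma γ (Ici 0) D u → SolvesPDE ν A (Ioi 0) D h u → DirichletBC (Ici 0) D u →
        (∀ x ∈ closure D, u 0 x = u₀ x) →
        C2gammaNorm γ D (u s) ≤ Cs (parHolderNorm γ (Ici 0) D h) (supNorm D u₀) := by
  intro s hs
  have hd := hsgn.pos_dim hc hC
  choose B hB HB using fun i j : ℕ => AdmSol.exists_c2gammaNorm_le (N := (i:ℝ) + 1)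
    (b := (j:ℝ)) hd hD hγ hν hA (by positivity) (by positivity) hs
  obtain ⟨Cs, hmono, hpos, hle⟩ := exists_monotone_majorant B hB
  refine ⟨Cs, hmono, hpos, fun h u₀ u hh hu hpde hbc hu₀ => le_trans (HB _ _ h u ?_) (hle _ _)⟩
  refine ⟨(parHolderBound_norm_add_one hh).mono (by gcongr; exact Nat.le_ceil _), hh.1, hu, hpde,
    hbc, fun x hx => ?_⟩
  obtain ⟨N, hN⟩ := hu.2
  have hbdd : BddAbove ((fun x => |u₀ x|) '' closure D) := by
    refine ⟨N, ?_⟩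
    rintro _ ⟨y, hy, rfl⟩
    have := hN.1 0 self_mem_Ici y hy
    rwa [hu₀ y hy] at this
  rw [hu₀ x hx]
  exact (le_csSup hbdd ⟨x, hx, rfl⟩).trans (Nat.le_ceil _)

end
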